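/- (Forward direction of Beals' criterion, Theorem 3.7.) Let Φ ∈ S^0_0(ℝ^{2d}). Then Op^A(Φ) maps 𝓢(ℝ^d) into 𝓢(ℝ^d), and for every n ∈ ℕ and every choice of operators L₁, …, L_n, each equal to some Q_j (multiplication by the coordinate x_j) or to some P^A_j := −i∂_{x_j} − A_j (1 ≤ j ≤ d), there exists a constant C > 0 such that ‖[L₁,[L₂, …, [L_n, Op^A(Φ)] … ]]φ‖_{L²} ≤ C ‖φ‖_{L²} for all φ ∈ 𝓢(ℝ^d); for n = 0 this states that ‖Op^A(Φ)φ‖_{L²} ≤ C‖φ‖_{L²}. -/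

import Mathlib

open MeasureTheory Complex
open scoped BigOperators ComplexConjugate ComplexInnerProductSpace

noncomputable section

/-- Euclidean dot product on `ℝ^d` (realized as `Fin d → ℝ`). -/
def dotR {d : ℕ} (x y : Fin d → ℝ) : ℝ := ∑ i, x i * y i

/-- Japanese bracket `⟨x⟩ = (1+|x|²)^(1/2)` (Euclidean norm). -/
def jap {d : ℕ} (x : Fin d → ℝ) : ℝ := Real.sqrt (1 + dotR x x)

/-- Euclidean norm on `ℝ^d`. -/
def enr {d : ℕ} (x : Fin d → ℝ) : ℝ := Real.sqrt (dotR x x)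

/-- Embedding of the lattice `ℤ^d` into `ℝ^d`. -/
def zToR {d : ℕ} (γ : Fin d → ℤ) : Fin d → ℝ := fun i => (γ i : ℝ)

/-- The point `2πk` of the dual lattice `(2πℤ)^d`, for `k ∈ ℤ^d`. -/
def dualV {d : ℕ} (k : Fin d → ℤ) : Fin d → ℝ := fun i => 2 * Real.pi * (k i : ℝ)

/-- The magnetic phase `Λ^A(x,y) = exp(−i ∫₀¹ ⟨A(x+t(y−x)), y−x⟩ dt)`. -/
def magPhase {d : ℕ} (A : (Fin d → ℝ) → (Fin d → ℝ)) (x y : Fin d → ℝ) : ℂ :=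
  Complex.exp (-Complex.I *
    ((∫ t in (0:ℝ)..1, dotR (A (x + t • (y - x))) (y - x)) : ℝ))

/-- The magnetic Gabor frame function
`G^A_{γ,γ*}(x) = Λ^A(x,γ) θ_{γ*}(x−γ) g(x−γ)` with `γ* = 2πk`. -/
def gaborF {d : ℕ} (A : (Fin d → ℝ) → (Fin d → ℝ)) (g : (Fin d → ℝ) → ℝ)
    (γ k : Fin d → ℤ) (x : Fin d → ℝ) : ℂ :=
  magPhase A x (zToR γ) * (((2 * Real.pi) ^ (-(d : ℝ) / 2) : ℝ) : ℂ) *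
    Complex.exp (Complex.I * ((dotR (dualV k) (x - zToR γ) / (2 * Real.pi) : ℝ) : ℂ)) *
    ((g (x - zToR γ) : ℝ) : ℂ)

/-- `g` is a smooth `[0,1]`-valued quadratic partition of unity with support in `(−1,1)^d`. -/
def IsQuadPartition {d : ℕ} (g : (Fin d → ℝ) → ℝ) : Prop :=
  ContDiff ℝ (⊤ : ℕ∞) g ∧ (∀ x, g x ∈ Set.Icc (0:ℝ) 1) ∧
    tsupport g ⊆ Set.univ.pi (fun _ : Fin d => Set.Ioo (-1:ℝ) 1) ∧
    ∀ x, HasSum (fun γ : Fin d → ℤ => (g (x - zToR γ)) ^ 2) 1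

/-- Iterated directional derivative along a list of directions. -/
def dList {E F : Type*} [NormedAddCommGroup E] [NormedSpace ℝ E]
    [NormedAddCommGroup F] [NormedSpace ℝ F] : List E → (E → F) → (E → F)
  | [], f => f
  | v :: L, f => fun x => fderiv ℝ (dList L f) x v

/-- Direction of differentiation in the first (position) variable. -/
def dirX {d : ℕ} (j : Fin d) : (Fin d → ℝ) × (Fin d → ℝ) := (Pi.single j 1, 0)

/-- Direction of differentiation in the second (momentum) variable. -/
def dirXi {d : ℕ} (j : Fin d) : (Fin d → ℝ) × (Fin d → ℝ) := (0, Pi.single j 1)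

/-- The Hörmander class `S^p_0(ℝ^{2d})`. -/
def HormClass (d : ℕ) (p : ℝ) (Φ : ((Fin d → ℝ) × (Fin d → ℝ)) → ℂ) : Prop :=
  ContDiff ℝ (⊤ : ℕ∞) Φ ∧
    ∀ a b : List (Fin d), ∃ C : ℝ,
      ∀ x ξ : Fin d → ℝ,
        ‖dList (a.map dirX ++ b.map dirXi) Φ (x, ξ)‖ ≤ C * jap ξ ^ p

/-- The magnetic field `B_{jk} = ∂_j A_k − ∂_k A_j` of a vector potential `A`. -/
def Bof {d : ℕ} (A : (Fin d → ℝ) → (Fin d → ℝ)) (j k : Fin d) (x : Fin d → ℝ) : ℝ :=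
  fderiv ℝ A x (Pi.single j 1) k - fderiv ℝ A x (Pi.single k 1) j

/-- Each component `B j k` is bounded together with all its partial derivatives. -/
def BBounded {d : ℕ} (B : Fin d → Fin d → (Fin d → ℝ) → ℝ) : Prop :=
  ∀ j k : Fin d, ∀ L : List (Fin d), ∃ C : ℝ,
    ∀ x, ‖dList (L.map (fun i => Pi.single i (1:ℝ))) (B j k) x‖ ≤ C

/-- Flux of `B` through the triangle with vertices `a, b, c`. -/
def fluxB {d : ℕ} (B : Fin d → Fin d → (Fin d → ℝ) → ℝ) (a b c : Fin d → ℝ) : ℝ :=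
  ∫ t in (0:ℝ)..1, ∫ s in (0:ℝ)..1,
    ∑ j, ∑ k, B j k (a + t • (b - a) + (s * t) • (c - b)) *
      ((b - a) j + s * (c - b) j) * (t * (c - b) k)

/-- `Ω^B(a,b,c) = exp(−i ∫_{⟨a,b,c⟩} B)`. -/
def OmegaB {d : ℕ} (B : Fin d → Fin d → (Fin d → ℝ) → ℝ) (a b c : Fin d → ℝ) : ℂ :=
  Complex.exp (-Complex.I * (fluxB B a b c : ℝ))


/-- `J_φ(x,ξ)`, the inner integral of the magnetic Weyl quantization
`Op^A(Φ)φ (x) = ∫ J_φ(x,ξ) dξ`. -/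
def opInt {d : ℕ} (A : (Fin d → ℝ) → (Fin d → ℝ))
    (Φ : ((Fin d → ℝ) × (Fin d → ℝ)) → ℂ) (φ : (Fin d → ℝ) → ℂ) (x ξ : Fin d → ℝ) : ℂ :=
  (((2 * Real.pi) ^ (-(d : ℝ) / 2) : ℝ) : ℂ) *
    ∫ y : Fin d → ℝ,
      magPhase A x y * Complex.exp (Complex.I * ((dotR ξ (x - y) : ℝ) : ℂ)) *
      Φ ((2:ℝ)⁻¹ • (x + y), ξ) * φ y

/-- The commutator `[L, T] = L∘T − T∘L` of linear endomorphisms. -/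
def commL {M : Type*} [AddCommGroup M] [Module ℂ M] (L T : M →ₗ[ℂ] M) : M →ₗ[ℂ] M :=
  L ∘ₗ T - T ∘ₗ L

/-- Iterated commutator `[L₁,[L₂,…,[Lₙ,T]…]]`. -/
def iterComm {M : Type*} [AddCommGroup M] [Module ℂ M] :
    List (M →ₗ[ℂ] M) → (M →ₗ[ℂ] M) → (M →ₗ[ℂ] M)
  | [], T => T
  | L :: Ls, T => commL L (iterComm Ls T)

open scoped ContDiff Topology

set_option linter.unusedSectionVars false

/-! ### Directional derivatives -/

section DirectionalDerivative

variable {E F : Type*} [NormedAddCommGroup E] [NormedSpace ℝ E]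
  [NormedAddCommGroup F] [NormedSpace ℝ F]

/-- The directional derivative of `f` along the constant vector `v`. -/
def dirD (v : E) (f : E → ℂ) : E → ℂ := fun p => fderiv ℝ f p v

theorem ContDiff.dirD {f : E → ℂ} (hf : ContDiff ℝ ∞ f) (v : E) : ContDiff ℝ ∞ (dirD v f) :=
  (hf.fderiv_right (m := ∞) (by simp)).clm_apply contDiff_const

theorem ContDiff.diff_at {f : E → ℂ} (hf : ContDiff ℝ ∞ f) (p : E) : DifferentiableAt ℝ f p :=
  (hf.differentiable (by simp)) p

theorem dirD_add {f g : E → ℂ} (hf : ContDiff ℝ ∞ f) (hg : ContDiff ℝ ∞ g) (v : E) :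
    dirD v (fun p => f p + g p) = fun p => dirD v f p + dirD v g p := by
  funext p
  simp only [dirD]
  rw [fderiv_fun_add (hf.diff_at p) (hg.diff_at p)]
  rfl

theorem dirD_mul {f g : E → ℂ} (hf : ContDiff ℝ ∞ f) (hg : ContDiff ℝ ∞ g) (v : E) :
    dirD v (fun p => f p * g p) = fun p => dirD v f p * g p + f p * dirD v g p := by
  funext p
  simp only [dirD]
  rw [fderiv_fun_mul (hf.diff_at p) (hg.diff_at p)]
  simp
  ring

theorem dirD_const (c : ℂ) (v : E) : dirD v (fun _ => c) = fun _ => 0 := by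
  funext p
  simp [dirD]

theorem dirD_const_mul {f : E → ℂ} (hf : ContDiff ℝ ∞ f) (c : ℂ) (v : E) :
    dirD v (fun p => c * f p) = fun p => c * dirD v f p := by
  rw [dirD_mul contDiff_const hf, dirD_const]
  simp

theorem dirD_comp_affine {f : F → ℂ} (hf : ContDiff ℝ ∞ f) (l : E →L[ℝ] F) (c : F) (v : E) :
    dirD v (fun p => f (l p + c)) = fun p => dirD (l v) f (l p + c) := by
  funext p
  simp only [dirD]
  have h : HasFDerivAt (fun p => f (l p + c)) ((fderiv ℝ f (l p + c)).comp l) p :=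
    (hf.diff_at _).hasFDerivAt.comp p (l.hasFDerivAt.add_const c)
  rw [h.fderiv]
  rfl

theorem dirD_exp {f : E → ℂ} (hf : ContDiff ℝ ∞ f) (v : E) :
    dirD v (fun p => cexp (f p)) = fun p => dirD v f p * cexp (f p) := by
  funext p
  simp only [dirD]
  rw [((hf.diff_at p).hasFDerivAt.cexp).fderiv]
  simp
  ring

theorem dirD_comm {f : E → ℂ} (hf : ContDiff ℝ ∞ f) (v w : E) :
    dirD v (dirD w f) = dirD w (dirD v f) := by
  funext p
  have key : ∀ v w : E, dirD v (dirD w f) p = fderiv ℝ (fderiv ℝ f) p v w := by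
    intro v w
    have h1 : DifferentiableAt ℝ (fderiv ℝ f) p :=
      ((hf.fderiv_right (m := ∞) (by simp)).differentiable (by simp)) p
    have h2 := (h1.hasFDerivAt.clm_apply (hasFDerivAt_const w p)).fderiv
    have h3 : dirD v (dirD w f) p = fderiv ℝ (fun y => fderiv ℝ f y w) p v := rfl
    rw [h3, h2]
    simp
  rw [key, key]
  exact second_derivative_symmetric (f' := fderiv ℝ f)
    (fun y => (hf.diff_at y).hasFDerivAt)
    (((hf.fderiv_right (m := ∞) (by simp)).differentiable (by simp)) p).hasFDerivAt v w

theorem dirD_linear {f : E → ℂ} (p : E) {ι : Type*} (s : Finset ι) (c : ι → ℝ) (b : ι → E) :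
    dirD (∑ i ∈ s, c i • b i) f p = ∑ i ∈ s, (c i : ℂ) * dirD (b i) f p := by
  simp [dirD, map_sum]

theorem dList_cons (v : E) (L : List E) (f : E → ℂ) : dList (v :: L) f = dirD v (dList L f) := rfl

theorem dList_append (L L' : List E) (f : E → ℂ) :
    dList (L ++ L') f = dList L (dList L' f) := by
  induction L with
  | nil => rfl
  | cons v L ih => rw [List.cons_append, dList_cons, dList_cons, ih]

theorem dList_concat (L : List E) (v : E) (f : E → ℂ) :
    dList (L ++ [v]) f = dList L (dirD v f) := dList_append L [v] f

theorem ContDiff.dList {f : E → ℂ} (hf : ContDiff ℝ ∞ f) (L : List E) :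
    ContDiff ℝ ∞ (dList L f) := by
  induction L with
  | nil => exact hf
  | cons v L ih => exact ih.dirD v

theorem dList_perm {f : E → ℂ} (hf : ContDiff ℝ ∞ f) {L L' : List E} (h : L.Perm L') :
    dList L f = dList L' f := by
  induction h with
  | nil => rfl
  | cons v _ ih => rw [dList_cons, dList_cons, ih]
  | swap v w L => simp only [dList_cons]; exact dirD_comm (hf.dList L) _ _
  | trans _ _ ih1 ih2 => rw [ih1, ih2]

theorem dList_comp_affine {f : F → ℂ} (hf : ContDiff ℝ ∞ f) (l : E →L[ℝ] F) (c : F)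
    (L : List E) :
    dList L (fun p => f (l p + c)) = fun p => dList (L.map l) f (l p + c) := by
  induction L with
  | nil => rfl
  | cons v L ih => rw [dList_cons, ih, dirD_comp_affine (hf.dList _)]; rfl

end DirectionalDerivative

/-! ### Symbol estimates for parametrized families of functions -/

section SymbolClass

variable {ι κ E F : Type*} [NormedAddCommGroup E] [NormedSpace ℝ E]
  [NormedAddCommGroup F] [NormedSpace ℝ F]

/-- All directional derivatives of order at most `n` of the family `f` are bounded by a
constant multiple of the weight `m`, uniformly in the parameter. -/
def SymB (m : ι → E → ℝ) : ℕ → (ι → E → ℂ) → Prop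
  | 0, f => ∃ C : ℝ, ∀ i p, ‖f i p‖ ≤ C * m i p
  | n + 1, f => (∃ C : ℝ, ∀ i p, ‖f i p‖ ≤ C * m i p) ∧
      ∀ v : E, SymB m n (fun i => dirD v (f i))

namespace SymB

variable {m m' : ι → E → ℝ} {f g : ι → E → ℂ} {n : ℕ}

theorem bound (h : SymB m n f) : ∃ C : ℝ, ∀ i p, ‖f i p‖ ≤ C * m i p := by
  cases n with
  | zero => exact h
  | succ n => exact h.1

theorem of_succ : ∀ {n : ℕ} {f : ι → E → ℂ}, SymB m (n + 1) f → SymB m n f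
  | 0, _, h => h.1
  | _ + 1, _, h => ⟨h.1, fun v => of_succ (h.2 v)⟩

theorem weight_mono {K : ℝ} (hm : ∀ i p, 0 ≤ m i p) (hK : ∀ i p, m i p ≤ K * m' i p)
    (h : SymB m n f) : SymB m' n f := by
  induction n generalizing f with
  | zero =>
    obtain ⟨C, hC⟩ := h
    refine ⟨|C| * K, fun i p => (hC i p).trans ?_⟩
    calc C * m i p ≤ |C| * m i p := mul_le_mul_of_nonneg_right (le_abs_self C) (hm i p)
      _ ≤ |C| * (K * m' i p) := mul_le_mul_of_nonneg_left (hK i p) (abs_nonneg C)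
      _ = _ := by ring
  | succ n ih =>
    refine ⟨?_, fun v => ih (h.2 v)⟩
    obtain ⟨C, hC⟩ := h.1
    refine ⟨|C| * K, fun i p => (hC i p).trans ?_⟩
    calc C * m i p ≤ |C| * m i p := mul_le_mul_of_nonneg_right (le_abs_self C) (hm i p)
      _ ≤ |C| * (K * m' i p) := mul_le_mul_of_nonneg_left (hK i p) (abs_nonneg C)
      _ = _ := by ring

theorem bound_add (hf : ∃ C : ℝ, ∀ i p, ‖f i p‖ ≤ C * m i p)
    (hg : ∃ C : ℝ, ∀ i p, ‖g i p‖ ≤ C * m i p) :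
    ∃ C : ℝ, ∀ i p, ‖f i p + g i p‖ ≤ C * m i p := by
  obtain ⟨C, hC⟩ := hf
  obtain ⟨D, hD⟩ := hg
  refine ⟨C + D, fun i p => (norm_add_le _ _).trans ?_⟩
  rw [add_mul]
  exact add_le_add (hC i p) (hD i p)

theorem add (hfs : ∀ i, ContDiff ℝ ∞ (f i)) (hgs : ∀ i, ContDiff ℝ ∞ (g i))
    (hf : SymB m n f) (hg : SymB m n g) : SymB m n (fun i p => f i p + g i p) := by
  induction n generalizing f g with
  | zero => exact bound_add hf hg
  | succ n ih =>
    refine ⟨bound_add hf.1 hg.1, fun v => ?_⟩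
    have := ih (fun i => (hfs i).dirD v) (fun i => (hgs i).dirD v) (hf.2 v) (hg.2 v)
    have e : (fun i => dirD v (fun p => f i p + g i p)) =
        fun i p => dirD v (f i) p + dirD v (g i) p :=
      funext fun i => dirD_add (hfs i) (hgs i) v
    rw [e]
    exact this

theorem bound_mul (hm' : ∀ i p, 0 ≤ m' i p)
    (hf : ∃ C : ℝ, ∀ i p, ‖f i p‖ ≤ C * m i p)
    (hg : ∃ C : ℝ, ∀ i p, ‖g i p‖ ≤ C * m' i p) :
    ∃ C : ℝ, ∀ i p, ‖f i p * g i p‖ ≤ C * (m i p * m' i p) := by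
  obtain ⟨C, hC⟩ := hf
  obtain ⟨D, hD⟩ := hg
  refine ⟨C * |D|, fun i p => ?_⟩
  rw [norm_mul]
  calc ‖f i p‖ * ‖g i p‖ ≤ (C * m i p) * (|D| * m' i p) :=
        mul_le_mul (hC i p) ((hD i p).trans (mul_le_mul_of_nonneg_right (le_abs_self D) (hm' i p)))
          (norm_nonneg _) ((norm_nonneg _).trans (hC i p))
    _ = _ := by ring

theorem mul (hm' : ∀ i p, 0 ≤ m' i p)
    (hfs : ∀ i, ContDiff ℝ ∞ (f i)) (hgs : ∀ i, ContDiff ℝ ∞ (g i))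
    (hf : SymB m n f) (hg : SymB m' n g) :
    SymB (fun i p => m i p * m' i p) n (fun i p => f i p * g i p) := by
  induction n generalizing f g with
  | zero => exact bound_mul hm' hf hg
  | succ n ih =>
    refine ⟨bound_mul hm' hf.1 hg.1, fun v => ?_⟩
    have e : (fun i => dirD v (fun p => f i p * g i p)) =
        fun i p => dirD v (f i) p * g i p + f i p * dirD v (g i) p :=
      funext fun i => dirD_mul (hfs i) (hgs i) v
    rw [e]
    exact add (fun i => ((hfs i).dirD v).mul (hgs i)) (fun i => (hfs i).mul ((hgs i).dirD v))
      (ih (fun i => (hfs i).dirD v) hgs (hf.2 v) hg.of_succ)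
      (ih hfs (fun i => (hgs i).dirD v) hf.of_succ (hg.2 v))

theorem zero : SymB m n (fun _ _ => (0 : ℂ)) := by
  induction n with
  | zero => exact ⟨0, by simp⟩
  | succ n ih => exact ⟨⟨0, by simp⟩, fun v => by simpa [dirD_const] using ih⟩

theorem const (c : ℂ) (hm : ∀ i p, 1 ≤ m i p) : SymB m n (fun _ _ => c) := by
  have h0 : ∃ C : ℝ, ∀ (i : ι) (p : E), ‖c‖ ≤ C * m i p :=
    ⟨‖c‖, fun i p => le_mul_of_one_le_right (norm_nonneg c) (hm i p)⟩
  cases n with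
  | zero => exact h0
  | succ n => exact ⟨h0, fun v => by simpa [dirD_const] using zero⟩

theorem const_mul (c : ℂ) (hfs : ∀ i, ContDiff ℝ ∞ (f i)) (hf : SymB m n f) :
    SymB m n (fun i p => c * f i p) := by
  have h1 : SymB (fun (_ : ι) (_ : E) => (1 : ℝ)) n (fun _ _ => c) := const c (fun _ _ => le_rfl)
  induction n generalizing f with
  | zero =>
    obtain ⟨C, hC⟩ := hf
    refine ⟨‖c‖ * C, fun i p => ?_⟩
    rw [norm_mul, mul_assoc]
    exact mul_le_mul_of_nonneg_left (hC i p) (norm_nonneg c)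
  | succ n ih =>
    refine ⟨?_, fun v => ?_⟩
    · obtain ⟨C, hC⟩ := hf.1
      refine ⟨‖c‖ * C, fun i p => ?_⟩
      rw [norm_mul, mul_assoc]
      exact mul_le_mul_of_nonneg_left (hC i p) (norm_nonneg c)
    · have e : (fun i => dirD v (fun p => c * f i p)) = fun i p => c * dirD v (f i) p :=
        funext fun i => dirD_const_mul (hfs i) c v
      rw [e]
      exact ih (fun i => (hfs i).dirD v) (hf.2 v) h1.of_succ

theorem sum {α : Type*} (s : Finset α) {f : α → ι → E → ℂ}
    (hfs : ∀ a ∈ s, ∀ i, ContDiff ℝ ∞ (f a i))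
    (hf : ∀ a ∈ s, SymB m n (f a)) : SymB m n (fun i p => ∑ a ∈ s, f a i p) := by
  classical
  induction s using Finset.induction_on with
  | empty => simpa using zero
  | insert a s ha ih =>
    simp only [Finset.sum_insert ha]
    refine add (hfs a (Finset.mem_insert_self a s)) ?_ (hf a (Finset.mem_insert_self a s))
      (ih (fun b hb => hfs b (Finset.mem_insert_of_mem hb))
        (fun b hb => hf b (Finset.mem_insert_of_mem hb)))
    exact fun i => ContDiff.sum fun b hb => hfs b (Finset.mem_insert_of_mem hb) i

theorem comp_affine {f : κ → F → ℂ} {w : κ → F → ℝ} (hfs : ∀ i, ContDiff ℝ ∞ (f i))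
    (hf : SymB w n f) (σ : ι → κ) (l : E →L[ℝ] F) (c : ι → F) :
    SymB (fun i p => w (σ i) (l p + c i)) n (fun i p => f (σ i) (l p + c i)) := by
  induction n generalizing f with
  | zero =>
    obtain ⟨C, hC⟩ := hf
    exact ⟨C, fun i p => hC _ _⟩
  | succ n ih =>
    refine ⟨?_, fun v => ?_⟩
    · obtain ⟨C, hC⟩ := hf.1
      exact ⟨C, fun i p => hC _ _⟩
    · have e : (fun i => dirD v (fun p => f (σ i) (l p + c i))) =
          fun i p => dirD (l v) (f (σ i)) (l p + c i) :=
        funext fun i => dirD_comp_affine (hfs _) l (c i) v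
      rw [e]
      exact ih (fun i => (hfs i).dirD _) (hf.2 (l v))

theorem dirD_mem (hf : SymB m (n + 1) f) (v : E) : SymB m n (fun i => dirD v (f i)) := hf.2 v

theorem dList_bound (L : List E) (h : SymB m n f) (hL : L.length ≤ n) :
    ∃ C : ℝ, ∀ i p, ‖dList L (f i) p‖ ≤ C * m i p := by
  induction L using List.reverseRecOn generalizing n f with
  | nil => exact h.bound
  | append_singleton L v ih =>
    obtain ⟨n, rfl⟩ : ∃ k, n = k + 1 := ⟨n - 1, by simp at hL; omega⟩
    simp only [dList_concat]
    exact ih (h.2 v) (by simpa using hL)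

/-- Bounds on the derivatives along a spanning family of directions suffice. -/
theorem of_basis [FiniteDimensional ℝ E] {α : Type*} [Fintype α] (b : Module.Basis α ℝ E)
    (hfs : ∀ i, ContDiff ℝ ∞ (f i))
    (h : ∀ L : List α, ∃ C : ℝ, ∀ i p, ‖dList (L.map b) (f i) p‖ ≤ C * m i p) :
    SymB m n f := by
  induction n generalizing f with
  | zero => exact h []
  | succ n ih =>
    refine ⟨h [], fun v => ?_⟩
    have e : (fun i => dirD v (f i)) =
        fun i p => ∑ a, (b.repr v a : ℂ) * dirD (b a) (f i) p := by
      funext i p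
      conv_lhs => rw [← b.sum_repr v]
      rw [dirD_linear]
    rw [e]
    refine sum Finset.univ (fun a _ i => contDiff_const.mul ((hfs i).dirD _)) fun a _ =>
      const_mul _ (fun i => (hfs i).dirD _) (ih (fun i => (hfs i).dirD _) fun L => ?_)
    obtain ⟨C, hC⟩ := h (L ++ [a])
    refine ⟨C, fun i p => ?_⟩
    rw [← dList_concat]
    simpa using hC i p

end SymB

/-- Families of smooth functions all of whose derivatives are bounded by powers of `W`, where
the exponent depends only on the order of the derivative. -/
structure PolyB (W : ι → E → ℝ) (f : ι → E → ℂ) : Prop where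
  smooth : ∀ i, ContDiff ℝ ∞ (f i)
  bounds : ∀ n : ℕ, ∃ k : ℕ, SymB (fun i p => W i p ^ k) n f

namespace PolyB

variable {W : ι → E → ℝ} {f g : ι → E → ℂ}

theorem _root_.SymB.pow_mono {n k l : ℕ} (hW : ∀ i p, 1 ≤ W i p) (h : SymB (fun i p => W i p ^ k) n f)
    (hkl : k ≤ l) : SymB (fun i p => W i p ^ l) n f :=
  h.weight_mono (K := 1) (fun i p => pow_nonneg (zero_le_one.trans (hW i p)) _)
    (fun i p => by rw [one_mul]; exact pow_le_pow_right₀ (hW i p) hkl)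

theorem add (hW : ∀ i p, 1 ≤ W i p) (hf : PolyB W f) (hg : PolyB W g) :
    PolyB W (fun i p => f i p + g i p) := by
  refine ⟨fun i => (hf.smooth i).add (hg.smooth i), fun n => ?_⟩
  obtain ⟨k, hk⟩ := hf.bounds n
  obtain ⟨l, hl⟩ := hg.bounds n
  exact ⟨max k l, (hk.pow_mono hW (le_max_left _ _)).add hf.smooth hg.smooth
    (hl.pow_mono hW (le_max_right _ _))⟩

theorem mul (hW : ∀ i p, 1 ≤ W i p) (hf : PolyB W f) (hg : PolyB W g) :
    PolyB W (fun i p => f i p * g i p) := by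
  refine ⟨fun i => (hf.smooth i).mul (hg.smooth i), fun n => ?_⟩
  obtain ⟨k, hk⟩ := hf.bounds n
  obtain ⟨l, hl⟩ := hg.bounds n
  refine ⟨k + l, ?_⟩
  have := hk.mul (fun i p => pow_nonneg (zero_le_one.trans (hW i p)) _) hf.smooth hg.smooth hl
  simpa only [pow_add] using this

theorem const (c : ℂ) : PolyB W (fun _ _ => c) :=
  ⟨fun _ => contDiff_const, fun _ => ⟨0, SymB.const c (fun _ _ => by simp)⟩⟩

theorem const_mul (c : ℂ) (hf : PolyB W f) : PolyB W (fun i p => c * f i p) :=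
  ⟨fun i => contDiff_const.mul (hf.smooth i), fun n =>
    (hf.bounds n).imp fun _ hk => hk.const_mul c hf.smooth⟩

theorem sum (hW : ∀ i p, 1 ≤ W i p) {α : Type*} (s : Finset α) {f : α → ι → E → ℂ}
    (hf : ∀ a ∈ s, PolyB W (f a)) : PolyB W (fun i p => ∑ a ∈ s, f a i p) := by
  classical
  induction s using Finset.induction_on with
  | empty => simpa using const 0
  | insert a s ha ih =>
    simp only [Finset.sum_insert ha]
    exact add hW (hf a (Finset.mem_insert_self a s))
      (ih fun b hb => hf b (Finset.mem_insert_of_mem hb))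

theorem dirD (hf : PolyB W f) (v : E) : PolyB W (fun i => dirD v (f i)) :=
  ⟨fun i => (hf.smooth i).dirD v, fun n =>
    (hf.bounds (n + 1)).imp fun _ hk => hk.2 v⟩

/-- The exponential of a family with values in the left half plane is polynomially bounded
once its first derivatives are. -/
theorem exp (hW : ∀ i p, 1 ≤ W i p) (hfs : ∀ i, ContDiff ℝ ∞ (f i))
    (hre : ∀ i p, (f i p).re ≤ 0)
    (hf : ∀ n : ℕ, ∃ k : ℕ, ∀ v : E, SymB (fun i p => W i p ^ k) n (fun i => _root_.dirD v (f i))) :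
    PolyB W (fun i p => cexp (f i p)) := by
  have h0 : ∃ C : ℝ, ∀ i p, ‖cexp (f i p)‖ ≤ C * W i p ^ 0 :=
    ⟨1, fun i p => by rw [Complex.norm_exp]; simpa using hre i p⟩
  have hs : ∀ i, ContDiff ℝ ∞ (fun p => cexp (f i p)) := fun i => (hfs i).cexp
  refine ⟨hs, fun n => ?_⟩
  induction n with
  | zero => exact ⟨0, h0⟩
  | succ n ih =>
    obtain ⟨k, hk⟩ := ih
    obtain ⟨l, hl⟩ := hf n
    refine ⟨l + k, ?_, fun v => ?_⟩
    · exact SymB.bound (SymB.pow_mono (n := 0) hW h0 (Nat.zero_le _))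
    · have e : (fun i => _root_.dirD v (fun p => cexp (f i p))) =
          fun i p => _root_.dirD v (f i) p * cexp (f i p) :=
        funext fun i => dirD_exp (hfs i) v
      rw [e]
      have := (hl v).mul (fun i p => pow_nonneg (zero_le_one.trans (hW i p)) _)
        (fun i => (hfs i).dirD v) hs hk
      simpa only [pow_add] using this

theorem exp' (hW : ∀ i p, 1 ≤ W i p) (hre : ∀ i p, (f i p).re ≤ 0) (hf : PolyB W f) :
    PolyB W (fun i p => cexp (f i p)) :=
  exp hW hf.smooth hre fun n => (hf.bounds (n + 1)).imp fun _ hk => hk.2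

theorem comp_affine {f : κ → F → ℂ} {V : κ → F → ℝ} (hf : PolyB V f)
    (σ : ι → κ) (l : E →L[ℝ] F) (c : ι → F) :
    PolyB (fun i p => V (σ i) (l p + c i)) (fun i p => f (σ i) (l p + c i)) :=
  ⟨fun _ => (hf.smooth _).comp (l.contDiff.add contDiff_const), fun n =>
    (hf.bounds n).imp fun _ hk => hk.comp_affine hf.smooth σ l c⟩

theorem weight_mono {W' : ι → E → ℝ} {K : ℝ} (hW : ∀ i p, 0 ≤ W i p)
    (h : ∀ i p, W i p ≤ K * W' i p)
    (hf : PolyB W f) : PolyB W' f :=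
  ⟨hf.smooth, fun n => (hf.bounds n).imp fun k hk =>
    hk.weight_mono (K := K ^ k) (fun i p => pow_nonneg (hW i p) _)
      (fun i p => by rw [← mul_pow]; exact pow_le_pow_left₀ (hW i p) (h i p) k)⟩

end PolyB

end SymbolClass

/-! ### Differentiation of parameter integrals -/

section ParametricIntegral

variable {P Y : Type*} [NormedAddCommGroup P] [NormedSpace ℝ P] [FiniteDimensional ℝ P]
  [NormedAddCommGroup Y] [NormedSpace ℝ Y] [FiniteDimensional ℝ Y]
  [MeasurableSpace Y] [BorelSpace Y] {μ : Measure Y}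

/-- Local domination of a function on `P × Y` by integrable functions on `Y`. -/
def LocDom (μ : Measure Y) (G : P × Y → ℂ) : Prop :=
  ∀ p₀ : P, ∃ b : Y → ℝ, Integrable b μ ∧ ∀ p ∈ Metric.ball p₀ 1, ∀ᵐ y ∂μ, ‖G (p, y)‖ ≤ b y

theorem LocDom.integrable {G : P × Y → ℂ} (hc : Continuous G) (h : LocDom μ G) (p : P) :
    Integrable (fun y => G (p, y)) μ := by
  obtain ⟨b, hb, hG⟩ := h p
  exact hb.mono' (hc.comp (by fun_prop)).aestronglyMeasurable
    (hG p (Metric.mem_ball_self one_pos))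

theorem LocDom.continuous_integral {G : P × Y → ℂ} (hc : Continuous G) (h : LocDom μ G) :
    Continuous (fun p => ∫ y, G (p, y) ∂μ) := by
  refine continuous_iff_continuousAt.2 fun p₀ => ?_
  obtain ⟨b, hb, hG⟩ := h p₀
  refine continuousAt_of_dominated (bound := b) ?_ ?_ hb ?_
  · exact Filter.Eventually.of_forall fun p =>
      (hc.comp (by fun_prop : Continuous fun y => (p, y))).aestronglyMeasurable
  · filter_upwards [Metric.ball_mem_nhds p₀ one_pos] with p hp using hG p hp
  · exact Filter.Eventually.of_forall fun y =>
      (hc.comp (by fun_prop : Continuous fun p => (p, y))).continuousAt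

theorem LocDom.hasFDerivAt_integral {G : P × Y → ℂ} (hG : ContDiff ℝ 1 G) (h0 : LocDom μ G)
    (h1 : ∀ v : P, LocDom μ (fun z => fderiv ℝ G z (v, 0))) (p₀ : P) :
    DifferentiableAt ℝ (fun p => ∫ y, G (p, y) ∂μ) p₀ ∧
      ∀ v, fderiv ℝ (fun p => ∫ y, G (p, y) ∂μ) p₀ v = ∫ y, fderiv ℝ G (p₀, y) (v, 0) ∂μ := by
  classical
  let B := Module.finBasis ℝ P
  obtain ⟨K, hK, hKb⟩ := B.exists_opNorm_le (F := ℂ)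
  choose b hb hbG using fun i => h1 (B i) p₀
  have hb0 : ∀ i y, 0 ≤ |b i y| := fun i y => abs_nonneg _
  let L : P → Y → P →L[ℝ] ℂ := fun p y => (fderiv ℝ G (p, y)).comp (ContinuousLinearMap.inl ℝ P Y)
  have hGc : Continuous (fderiv ℝ G) := hG.continuous_fderiv (by simp)
  have hLc : Continuous (fun y => L p₀ y) :=
    (ContinuousLinearMap.compL ℝ P (P × Y) ℂ).flip (ContinuousLinearMap.inl ℝ P Y)
      |>.continuous.comp (hGc.comp (by fun_prop))
  have hder : ∀ p y, HasFDerivAt (fun p => G (p, y)) (L p y) p := fun p y =>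
    ((hG.differentiable (by simp)) (p, y)).hasFDerivAt.comp p (hasFDerivAt_prodMk_left p y)
  have hsum : Integrable (fun y => K * ∑ i, |b i y|) μ :=
    (integrable_finsetSum _ fun i _ => (hb i).abs).const_mul K
  -- the domination holds off a null set independent of `p` because both sides are tested on
  -- a countable dense set of parameters
  have hae : ∀ᵐ y ∂μ, ∀ p ∈ Metric.ball p₀ 1, ‖L p y‖ ≤ K * ∑ i, |b i y| := by
    obtain ⟨s, hs, hd⟩ := TopologicalSpace.exists_countable_dense (Metric.ball p₀ (1 : ℝ))
    have h2 : ∀ᵐ y ∂μ, ∀ p ∈ s, ∀ i, ‖fderiv ℝ G (p.1, y) (B i, 0)‖ ≤ b i y :=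
      (ae_ball_iff hs).2 fun p _ => ae_all_iff.2 fun i => hbG i p.1 p.2
    filter_upwards [h2] with y hy p hp
    have h3 : ∀ q : Metric.ball p₀ (1 : ℝ), ∀ i, ‖fderiv ℝ G (q.1, y) (B i, 0)‖ ≤ b i y := by
      intro q i
      have hcl : IsClosed {q : Metric.ball p₀ (1 : ℝ) | ‖fderiv ℝ G (q.1, y) (B i, 0)‖ ≤ b i y} := by
        refine isClosed_le ?_ continuous_const
        have : Continuous fun q : Metric.ball p₀ (1 : ℝ) => fderiv ℝ G (q.1, y) :=
          hGc.comp (by fun_prop)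
        exact (this.clm_apply continuous_const).norm
      exact (hcl.closure_subset_iff.2 fun q hq => hy q hq i) (hd q)
    refine hKb (u := L p y) (M := ∑ i, |b i y|) (Finset.sum_nonneg fun i _ => hb0 i y) fun i => ?_
    exact ((h3 ⟨p, hp⟩ i).trans (le_abs_self _)).trans
      (Finset.single_le_sum (f := fun i => |b i y|) (fun i _ => hb0 i y) (Finset.mem_univ i))
  have main := hasFDerivAt_integral_of_dominated_of_fderiv_le (𝕜 := ℝ) (μ := μ)
    (F := fun p y => G (p, y)) (F' := L) (x₀ := p₀) (bound := fun y => K * ∑ i, |b i y|)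
    (Metric.ball_mem_nhds p₀ one_pos)
    (Filter.Eventually.of_forall fun p =>
      (hG.continuous.comp (by fun_prop : Continuous fun y => (p, y))).aestronglyMeasurable)
    (h0.integrable hG.continuous p₀) hLc.aestronglyMeasurable hae hsum
    (Filter.Eventually.of_forall fun y p _ => hder p y)
  refine ⟨main.differentiableAt, fun v => ?_⟩
  rw [main.fderiv, ContinuousLinearMap.integral_apply]
  · rfl
  · refine hsum.mono' hLc.aestronglyMeasurable ?_
    filter_upwards [hae] with y hy using hy p₀ (Metric.mem_ball_self one_pos)

theorem contDiff_one_of_dirD {f : P → ℂ} (hf : Differentiable ℝ f)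
    (h : ∀ v, Continuous (fun p => fderiv ℝ f p v)) : ContDiff ℝ 1 f :=
  contDiff_one_iff_fderiv.2 ⟨hf, continuous_clm_apply.2 h⟩

theorem LocDom.contDiff_integral {G : P × Y → ℂ} (hG : ContDiff ℝ 1 G) (h0 : LocDom μ G)
    (h1 : ∀ v : P, LocDom μ (fun z => fderiv ℝ G z (v, 0))) :
    ContDiff ℝ 1 (fun p => ∫ y, G (p, y) ∂μ) := by
  refine contDiff_one_of_dirD (fun p => (hasFDerivAt_integral hG h0 h1 p).1) fun v => ?_
  simp only [(hasFDerivAt_integral hG h0 h1 _).2 v]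
  exact (h1 v).continuous_integral
    ((hG.continuous_fderiv (by simp)).clm_apply continuous_const)

end ParametricIntegral

/-! ### Temperate and bounded symbols, integrals along segments -/

section Segment

variable {E F : Type*} [NormedAddCommGroup E] [NormedSpace ℝ E]
  [NormedAddCommGroup F] [NormedSpace ℝ F]

/-- Smooth functions with polynomially bounded derivatives. -/
abbrev TempG (u : E → ℂ) : Prop := PolyB (fun (_ : Unit) (p : E) => 1 + ‖p‖) (fun _ => u)

/-- Smooth functions with bounded derivatives of all orders. -/
abbrev BddG (a : E → ℂ) : Prop := PolyB (fun (_ : Unit) (_ : E) => (1 : ℝ)) (fun _ => a)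

theorem one_le_one_add_norm (p : E) : 1 ≤ 1 + ‖p‖ := le_add_of_nonneg_right (norm_nonneg p)

theorem TempG.smooth {u : E → ℂ} (h : TempG u) : ContDiff ℝ ∞ u := PolyB.smooth h ()

theorem BddG.smooth {u : E → ℂ} (h : BddG u) : ContDiff ℝ ∞ u := PolyB.smooth h ()

theorem BddG.symB {a : E → ℂ} (h : BddG a) (n : ℕ) :
    SymB (fun (_ : Unit) (_ : E) => (1 : ℝ)) n (fun _ => a) := by
  obtain ⟨k, hk⟩ := PolyB.bounds h n
  simpa using hk

theorem BddG.of_symB {a : E → ℂ} (hs : ContDiff ℝ ∞ a)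
    (h : ∀ n, SymB (fun (_ : Unit) (_ : E) => (1 : ℝ)) n (fun _ => a)) : BddG a :=
  ⟨fun _ => hs, fun n => ⟨0, by simpa using h n⟩⟩

theorem TempG.mul {u v : E → ℂ} (hu : TempG u) (hv : TempG v) : TempG (fun p => u p * v p) :=
  PolyB.mul (fun _ p => one_le_one_add_norm p) hu hv

theorem BddG.add {u v : E → ℂ} (hu : BddG u) (hv : BddG v) : BddG (fun p => u p + v p) :=
  PolyB.add (fun _ _ => le_rfl) hu hv

theorem BddG.mul {u v : E → ℂ} (hu : BddG u) (hv : BddG v) : BddG (fun p => u p * v p) :=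
  PolyB.mul (fun _ _ => le_rfl) hu hv

theorem BddG.const_mul {u : E → ℂ} (c : ℂ) (hu : BddG u) : BddG (fun p => c * u p) :=
  PolyB.const_mul c hu

theorem BddG.dirD {u : E → ℂ} (hu : BddG u) (v : E) : BddG (dirD v u) := PolyB.dirD hu v

theorem BddG.sum {α : Type*} (s : Finset α) {f : α → E → ℂ} (hf : ∀ a ∈ s, BddG (f a)) :
    BddG (fun p => ∑ a ∈ s, f a p) := PolyB.sum (fun _ _ => le_rfl) s hf

theorem TempG.sum {α : Type*} (s : Finset α) {f : α → E → ℂ} (hf : ∀ a ∈ s, TempG (f a)) :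
    TempG (fun p => ∑ a ∈ s, f a p) := PolyB.sum (fun _ p => one_le_one_add_norm p) s hf

theorem BddG.comp_linear {a : F → ℂ} (ha : BddG a) (l : E →L[ℝ] F) : BddG (fun p => a (l p)) := by
  simpa using PolyB.comp_affine ha (fun _ : Unit => ()) l (fun _ => 0)

theorem SymB.of_iteratedFDeriv {m : E → ℝ} {n : ℕ} {f : E → ℂ} (hf : ContDiff ℝ ∞ f)
    (h : ∃ C : ℝ, ∀ N ≤ n, ∀ x, ‖iteratedFDeriv ℝ N f x‖ ≤ C * m x) :
    SymB (fun (_ : Unit) => m) n (fun _ => f) := by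
  have h0 : ∀ {n : ℕ} {f : E → ℂ},
      (∃ C : ℝ, ∀ N ≤ n, ∀ x, ‖iteratedFDeriv ℝ N f x‖ ≤ C * m x) →
      ∃ C : ℝ, ∀ (_ : Unit) p, ‖f p‖ ≤ C * m p := by
    rintro n f ⟨C, hC⟩
    exact ⟨C, fun _ p => by simpa using hC 0 (Nat.zero_le _) p⟩
  induction n generalizing f with
  | zero => exact h0 h
  | succ n ih =>
    refine ⟨h0 h, fun v => ih (hf.dirD v) ?_⟩
    obtain ⟨C, hC⟩ := h
    refine ⟨‖v‖ * C, fun N hN x => ?_⟩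
    have h1 : ContDiff ℝ ∞ (fderiv ℝ f) := hf.fderiv_right (by simp)
    calc ‖iteratedFDeriv ℝ N (_root_.dirD v f) x‖
        ≤ ‖v‖ * ‖iteratedFDeriv ℝ N (fderiv ℝ f) x‖ :=
          norm_iteratedFDeriv_clm_apply_const (c := v) h1.contDiffAt (by exact_mod_cast le_top)
      _ = ‖v‖ * ‖iteratedFDeriv ℝ (N + 1) f x‖ := by rw [norm_iteratedFDeriv_fderiv]
      _ ≤ ‖v‖ * (C * m x) :=
          mul_le_mul_of_nonneg_left (hC _ (Nat.succ_le_succ hN) x) (norm_nonneg v)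
      _ = _ := by ring

theorem TempG.of_hasTemperateGrowth {f : E → ℂ} (hf : Function.HasTemperateGrowth f) :
    TempG f := by
  refine ⟨fun _ => hf.1, fun n => ?_⟩
  obtain ⟨k, C, _, h⟩ := hf.norm_iteratedFDeriv_le_uniform n
  exact ⟨k, SymB.of_iteratedFDeriv hf.1 ⟨C, h⟩⟩

theorem TempG.clm {l : E →L[ℝ] ℂ} : TempG (fun p => l p) :=
  TempG.of_hasTemperateGrowth l.hasTemperateGrowth

theorem LocDom.of_continuous_Ioc {P : Type*} [NormedAddCommGroup P] [NormedSpace ℝ P]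
    [FiniteDimensional ℝ P] {G : P × ℝ → ℂ} (hG : Continuous G) :
    LocDom (volume.restrict (Set.Ioc 0 1)) G := by
  intro p₀
  have hc : IsCompact (Metric.closedBall p₀ 1 ×ˢ Set.Icc (0 : ℝ) 1) :=
    (isCompact_closedBall _ _).prod isCompact_Icc
  obtain ⟨C, hC⟩ := hc.exists_bound_of_continuousOn hG.continuousOn
  refine ⟨fun _ => C, integrable_const C, fun p hp => ?_⟩
  filter_upwards [ae_restrict_mem measurableSet_Ioc] with t ht
  exact hC (p, t) ⟨Metric.ball_subset_closedBall hp, Set.Ioc_subset_Icc_self ht⟩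

/-- Weighted integral of `β` along the segment from `x` to `y`. -/
def lineInt (w : ℝ → ℂ) (β : E → ℂ) (p : E × E) : ℂ :=
  ∫ t in Set.Ioc (0 : ℝ) 1, w t * β (p.1 + t • (p.2 - p.1))

theorem lineInt_integrable {w : ℝ → ℂ} {β : E → ℂ} (hw : Continuous w) (hβ : Continuous β)
    (p : E × E) :
    Integrable (fun t => w t * β (p.1 + t • (p.2 - p.1))) (volume.restrict (Set.Ioc (0 : ℝ) 1)) :=
  ((by fun_prop : Continuous fun t : ℝ => w t * β (p.1 + t • (p.2 - p.1))).continuousOn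
    |>.integrableOn_compact isCompact_Icc).mono_set Set.Ioc_subset_Icc_self

theorem lineInt_sum {α : Type*} (s : Finset α) {w : ℝ → ℂ} {β : α → E → ℂ} (c : α → ℂ)
    (hw : Continuous w) (hβ : ∀ a ∈ s, Continuous (β a)) (p : E × E) :
    lineInt w (fun x => ∑ a ∈ s, c a * β a x) p = ∑ a ∈ s, c a * lineInt w (β a) p := by
  simp only [lineInt, Finset.mul_sum]
  rw [integral_finsetSum]
  · refine Finset.sum_congr rfl fun a _ => ?_
    rw [← integral_const_mul]
    congr 1; funext t; ring
  · intro a ha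
    have := (lineInt_integrable hw (hβ a ha) p).const_mul (c a)
    refine this.congr (Filter.Eventually.of_forall fun t => ?_)
    simp only; ring

theorem lineInt_add {w : ℝ → ℂ} {β γ : E → ℂ} (hw : Continuous w) (hβ : Continuous β)
    (hγ : Continuous γ) (p : E × E) :
    lineInt w (fun x => β x + γ x) p = lineInt w β p + lineInt w γ p := by
  simp only [lineInt, mul_add]
  exact integral_add (lineInt_integrable hw hβ p) (lineInt_integrable hw hγ p)

theorem lineInt_sub_dirD {β : E → ℂ} (hβ : ContDiff ℝ ∞ β) (p : E × E) :
    lineInt (fun t => 1 - (t : ℂ)) (dirD (p.2 - p.1) β) p = lineInt (fun _ => 1) β p - β p.1 ∧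
    lineInt (fun t => (t : ℂ)) (dirD (p.2 - p.1) β) p = β p.2 - lineInt (fun _ => 1) β p := by
  have hd : ∀ t : ℝ, HasDerivAt (fun t : ℝ => β (p.1 + t • (p.2 - p.1)))
      (dirD (p.2 - p.1) β (p.1 + t • (p.2 - p.1))) t := by
    intro t
    have h1 : HasDerivAt (fun t : ℝ => p.1 + t • (p.2 - p.1)) (p.2 - p.1) t := by
      simpa using ((hasDerivAt_id t).smul_const (p.2 - p.1)).const_add p.1
    exact (hβ.diff_at _).hasFDerivAt.comp_hasDerivAt t h1
  have hcd : Continuous (dirD (p.2 - p.1) β) := (hβ.dirD _).continuous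
  have hc : Continuous β := hβ.continuous
  have hof : ∀ t : ℝ, HasDerivAt (fun t : ℝ => (t : ℂ)) 1 t := fun t =>
    (hasDerivAt_id t).ofReal_comp
  constructor
  · have h := intervalIntegral.integral_eq_sub_of_hasDerivAt (a := 0) (b := 1)
      (f := fun t : ℝ => (1 - (t : ℂ)) * β (p.1 + t • (p.2 - p.1)))
      (fun t _ => (((hof t).const_sub 1).mul (hd t)))
      (Continuous.intervalIntegrable (by fun_prop) _ _)
    rw [intervalIntegral.integral_of_le zero_le_one, integral_add] at h
    · simp only [neg_mul, integral_neg, Complex.ofReal_one, sub_self, zero_mul,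
        Complex.ofReal_zero, zero_smul, add_zero, sub_zero, one_mul] at h
      simp only [lineInt, one_mul]
      linear_combination h
    · exact lineInt_integrable (w := fun _ => -1) continuous_const hc p
    · exact lineInt_integrable (w := fun t => 1 - (t : ℂ)) (by fun_prop) hcd p
  · have h := intervalIntegral.integral_eq_sub_of_hasDerivAt (a := 0) (b := 1)
      (f := fun t : ℝ => (t : ℂ) * β (p.1 + t • (p.2 - p.1)))
      (fun t _ => ((hof t).mul (hd t)))
      (Continuous.intervalIntegrable (by fun_prop) _ _)
    rw [intervalIntegral.integral_of_le zero_le_one, integral_add] at h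
    · simp only [Complex.ofReal_one, one_smul, add_sub_cancel,
        Complex.ofReal_zero, zero_mul, sub_zero, one_mul] at h
      simp only [lineInt, one_mul]
      linear_combination h
    · exact lineInt_integrable (w := fun _ => 1) continuous_const hc p
    · exact lineInt_integrable (w := fun t => (t : ℂ)) (by fun_prop) hcd p

variable [FiniteDimensional ℝ E]

theorem lineInt_diff {w : ℝ → ℂ} {β : E → ℂ} (hw : ContDiff ℝ ∞ w) (hβ : ContDiff ℝ ∞ β) :
    Differentiable ℝ (lineInt w β) ∧ ∀ v : E × E, dirD v (lineInt w β) = fun p =>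
      lineInt (fun t => (1 - (t : ℂ)) * w t) (dirD v.1 β) p +
        lineInt (fun t => (t : ℂ) * w t) (dirD v.2 β) p := by
  let G : (E × E) × ℝ → ℂ := fun z => w z.2 * β (z.1.1 + z.2 • (z.1.2 - z.1.1))
  have hG : ContDiff ℝ ∞ G := by
    have := hw.comp (contDiff_snd (𝕜 := ℝ) (E := E × E) (F := ℝ))
    exact this.mul (hβ.comp (by fun_prop))
  have hG1 : ContDiff ℝ 1 G := hG.of_le (by exact_mod_cast le_top)
  have h0 : LocDom (volume.restrict (Set.Ioc (0 : ℝ) 1)) G := .of_continuous_Ioc hG.continuous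
  have h1 : ∀ v : E × E, LocDom (volume.restrict (Set.Ioc (0 : ℝ) 1))
      (fun z => fderiv ℝ G z (v, 0)) := fun v =>
    .of_continuous_Ioc ((hG1.continuous_fderiv (by simp)).clm_apply continuous_const)
  have hmain := fun p => LocDom.hasFDerivAt_integral hG1 h0 h1 p
  refine ⟨fun p => (hmain p).1, fun v => funext fun p => ?_⟩
  have e := (hmain p).2 v
  refine Eq.trans e ?_
  have hc1 : Continuous (dirD v.1 β) := (hβ.dirD _).continuous
  have hc2 : Continuous (dirD v.2 β) := (hβ.dirD _).continuous
  have hwc : Continuous w := hw.continuous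
  rw [lineInt, lineInt, ← integral_add (lineInt_integrable (by fun_prop) hc1 p)
    (lineInt_integrable (by fun_prop) hc2 p)]
  congr 1
  funext t
  let l : E × E →L[ℝ] E := ContinuousLinearMap.fst ℝ E E +
    t • (ContinuousLinearMap.snd ℝ E E - ContinuousLinearMap.fst ℝ E E)
  have h2 : HasFDerivAt (fun q : E × E => G (q, t))
      ((fderiv ℝ G (p, t)).comp (ContinuousLinearMap.inl ℝ (E × E) ℝ)) p :=
    HasFDerivAt.comp (f := fun q : E × E => (q, t)) p (hG.diff_at (p, t)).hasFDerivAt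
      (hasFDerivAt_prodMk_left p t)
  have h3 : HasFDerivAt (fun q : E × E => G (q, t))
      (w t • ((fderiv ℝ β (p.1 + t • (p.2 - p.1))).comp l)) p := by
    have := (hβ.diff_at (l p)).hasFDerivAt.comp p l.hasFDerivAt
    exact this.const_mul (w t)
  have h4 := congrArg (fun L => L v) (h2.unique h3)
  have h5 : l v = (1 - t) • v.1 + t • v.2 := by
    simp only [l, add_apply, ContinuousLinearMap.coe_fst',
      smul_apply, sub_apply, ContinuousLinearMap.coe_snd']
    module
  have h6 : fderiv ℝ G (p, t) (v, 0) = w t * fderiv ℝ β (p.1 + t • (p.2 - p.1)) (l v) := h4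
  rw [h6, h5, map_add, map_smul, map_smul]
  simp only [dirD, Complex.real_smul]
  push_cast
  ring

theorem lineInt_contDiff {w : ℝ → ℂ} {β : E → ℂ} (hw : ContDiff ℝ ∞ w) (hβ : ContDiff ℝ ∞ β) :
    ContDiff ℝ ∞ (lineInt w β) := by
  refine contDiff_infty.2 fun n => ?_
  induction n generalizing w β with
  | zero => exact contDiff_zero.2 (lineInt_diff hw hβ).1.continuous
  | succ n ih =>
    refine (contDiff_succ_iff_fderiv_apply (n := (n : WithTop ℕ∞))).2
      ⟨(lineInt_diff hw hβ).1, by simp, fun v => ?_⟩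
    have e : (fun p => fderiv ℝ (lineInt w β) p v) = _ := (lineInt_diff hw hβ).2 v
    rw [e]
    have hof : ContDiff ℝ ∞ (fun t : ℝ => (t : ℂ)) := Complex.ofRealCLM.contDiff
    exact (ih ((contDiff_const.sub hof).mul hw) (hβ.dirD _)).add
      (ih (hof.mul hw) (hβ.dirD _))

theorem SymB.lineInt {w : ℝ → ℂ} {β : E → ℂ} (hw : ContDiff ℝ ∞ w) (hβ : ContDiff ℝ ∞ β)
    {m : E → ℝ} {m' : E × E → ℝ} {n : ℕ} (hm0 : ∀ x, 0 ≤ m x)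
    (hm : ∀ p : E × E, ∀ t ∈ Set.Icc (0 : ℝ) 1, m (p.1 + t • (p.2 - p.1)) ≤ m' p)
    (h : SymB (fun (_ : Unit) => m) n (fun _ => β)) :
    SymB (fun (_ : Unit) => m') n (fun _ => lineInt w β) := by
  have hb : ∀ {w : ℝ → ℂ} {β : E → ℂ}, ContDiff ℝ ∞ w →
      (∃ C : ℝ, ∀ (_ : Unit) p, ‖β p‖ ≤ C * m p) →
      ∃ C : ℝ, ∀ (_ : Unit) p, ‖_root_.lineInt w β p‖ ≤ C * m' p := by
    rintro w β hw ⟨C, hC⟩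
    obtain ⟨D, hD⟩ := (isCompact_Icc (a := (0 : ℝ)) (b := 1)).exists_bound_of_continuousOn
      hw.continuous.continuousOn
    refine ⟨|D| * |C|, fun _ p => ?_⟩
    have hle : ∀ t ∈ Set.Ioc (0 : ℝ) 1,
        ‖w t * β (p.1 + t • (p.2 - p.1))‖ ≤ |D| * |C| * m' p := by
      intro t ht
      have ht' := Set.Ioc_subset_Icc_self ht
      rw [norm_mul, mul_assoc]
      refine mul_le_mul ((hD t ht').trans (le_abs_self D)) ?_ (norm_nonneg _) (abs_nonneg D)
      calc _ ≤ C * m (p.1 + t • (p.2 - p.1)) := hC () _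
        _ ≤ |C| * m (p.1 + t • (p.2 - p.1)) :=
          mul_le_mul_of_nonneg_right (le_abs_self C) (hm0 _)
        _ ≤ _ := mul_le_mul_of_nonneg_left (hm p t ht') (abs_nonneg C)
    have := norm_setIntegral_le_of_norm_le_const (μ := volume) (s := Set.Ioc (0 : ℝ) 1)
      (by simp) hle
    simpa [_root_.lineInt] using this
  have hof : ContDiff ℝ ∞ (fun t : ℝ => (t : ℂ)) := Complex.ofRealCLM.contDiff
  induction n generalizing w β with
  | zero => exact hb hw h
  | succ n ih =>
    refine ⟨hb hw h.1, fun v => ?_⟩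
    change SymB (fun _ => m') n (fun _ => dirD v (_root_.lineInt w β))
    rw [(lineInt_diff hw hβ).2 v]
    have w1 := (contDiff_const (c := (1 : ℂ))).sub hof |>.mul hw
    have w2 := hof.mul hw
    exact SymB.add (fun _ => lineInt_contDiff w1 (hβ.dirD _))
      (fun _ => lineInt_contDiff w2 (hβ.dirD _))
      (ih w1 (hβ.dirD _) (h.2 v.1)) (ih w2 (hβ.dirD _) (h.2 v.2))

theorem BddG.lineInt {w : ℝ → ℂ} {β : E → ℂ} (hw : ContDiff ℝ ∞ w) (hβ : BddG β) :
    BddG (lineInt w β) :=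
  BddG.of_symB (lineInt_contDiff hw hβ.smooth) fun n =>
    SymB.lineInt hw hβ.smooth (fun _ => zero_le_one) (fun _ _ _ => le_rfl) (hβ.symB n)

theorem TempG.lineInt {w : ℝ → ℂ} {β : E → ℂ} (hw : ContDiff ℝ ∞ w) (hβ : TempG β) :
    TempG (lineInt w β) := by
  refine ⟨fun _ => lineInt_contDiff hw hβ.smooth, fun n => (PolyB.bounds hβ n).imp fun k hk => ?_⟩
  refine SymB.lineInt hw hβ.smooth (fun x => by positivity) (fun p t ht => ?_) hk
  refine pow_le_pow_left₀ (by positivity) (add_le_add le_rfl ?_) k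
  have e : p.1 + t • (p.2 - p.1) = (1 - t) • p.1 + t • p.2 := by module
  rw [e]
  calc ‖(1 - t) • p.1 + t • p.2‖ ≤ (1 - t) * ‖p.1‖ + t * ‖p.2‖ := by
        refine (norm_add_le _ _).trans (le_of_eq ?_)
        rw [norm_smul, norm_smul, Real.norm_of_nonneg ht.1, Real.norm_of_nonneg (by linarith [ht.2])]
    _ ≤ (1 - t) * ‖p‖ + t * ‖p‖ :=
        add_le_add (mul_le_mul_of_nonneg_left (norm_fst_le p) (by linarith [ht.2]))
          (mul_le_mul_of_nonneg_left (norm_snd_le p) ht.1)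
    _ = ‖p‖ := by ring

end Segment

/-! ### The magnetic phase -/

section MagneticPhase

theorem PolyB.exp_of_dirD {ι E : Type*} [NormedAddCommGroup E] [NormedSpace ℝ E]
    [FiniteDimensional ℝ E] {W : ι → E → ℝ} {f : ι → E → ℂ} (hW : ∀ i p, 1 ≤ W i p)
    (hfs : ∀ i, ContDiff ℝ ∞ (f i)) (hre : ∀ i p, (f i p).re ≤ 0)
    (hf : ∀ v : E, PolyB W (fun i => _root_.dirD v (f i))) :
    PolyB W (fun i p => cexp (f i p)) := by
  refine PolyB.exp hW hfs hre fun n => ?_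
  let b := Module.finBasis ℝ E
  choose k hk using fun j => (hf (b j)).bounds n
  refine ⟨Finset.univ.sup k, fun v => ?_⟩
  have hv : ∀ i, _root_.dirD v (f i) = fun p => ∑ j, (b.repr v j : ℂ) * _root_.dirD (b j) (f i) p := by
    intro i
    funext p
    conv_lhs => rw [← b.sum_repr v]
    exact dirD_linear p _ _ _
  simp only [hv]
  refine SymB.sum _ (fun j _ i => contDiff_const.mul ((hfs i).dirD _)) fun j _ => ?_
  exact ((hk j).pow_mono hW (Finset.le_sup (Finset.mem_univ j))).const_mul _
    (fun i => (hfs i).dirD _)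

variable {d : ℕ}

/-- The `j`-th component of a vector potential as a complex function. -/
def potC (A : (Fin d → ℝ) → (Fin d → ℝ)) (j : Fin d) (x : Fin d → ℝ) : ℂ := (A x j : ℝ)

/-- The components of the magnetic field as complex functions. -/
def fieldC (A : (Fin d → ℝ) → (Fin d → ℝ)) (j k : Fin d) (x : Fin d → ℝ) : ℂ := (Bof A j k x : ℝ)

/-- Circulation of the vector potential along the segment from `p.1` to `p.2`. -/
def circ (A : (Fin d → ℝ) → (Fin d → ℝ)) (p : (Fin d → ℝ) × (Fin d → ℝ)) : ℂ :=
  ∑ j, ((p.2 j - p.1 j : ℝ) : ℂ) * lineInt (fun _ => 1) (potC A j) p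

/-- The gauge invariant part of the differential of `circ A` in the direction `v`. -/
def fluxForm (A : (Fin d → ℝ) → (Fin d → ℝ)) (v p : (Fin d → ℝ) × (Fin d → ℝ)) : ℂ :=
  ∑ j, ∑ k, ((p.2 k - p.1 k : ℝ) : ℂ) *
    ((v.1 j : ℂ) * lineInt (fun t => 1 - (t : ℂ)) (fieldC A j k) p +
      (v.2 j : ℂ) * lineInt (fun t => (t : ℂ)) (fieldC A j k) p)

theorem eval_pi_eq_sum_single (v : Fin d → ℝ) :
    v = ∑ j, v j • (Pi.single j 1 : Fin d → ℝ) := by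
  simpa using (Pi.basisFun ℝ (Fin d)).sum_repr v |>.symm

theorem dirD_eq_sum_single {f : (Fin d → ℝ) → ℂ} (v x : Fin d → ℝ) :
    dirD v f x = ∑ j, (v j : ℂ) * dirD (Pi.single j 1) f x := by
  conv_lhs => rw [eval_pi_eq_sum_single v]
  exact dirD_linear x _ _ _

/-- The coordinate difference `p.2 k - p.1 k` as a continuous linear form. -/
def diffCoord (k : Fin d) : (Fin d → ℝ) × (Fin d → ℝ) →L[ℝ] ℂ :=
  (Complex.ofRealCLM.comp (ContinuousLinearMap.proj k)).comp
    (ContinuousLinearMap.snd ℝ _ _ - ContinuousLinearMap.fst ℝ _ _)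

theorem diffCoord_apply (k : Fin d) (p : (Fin d → ℝ) × (Fin d → ℝ)) :
    diffCoord k p = ((p.2 k - p.1 k : ℝ) : ℂ) := rfl

theorem dirD_clm {E : Type*} [NormedAddCommGroup E] [NormedSpace ℝ E] (l : E →L[ℝ] ℂ) (v : E) :
    dirD v (fun p => l p) = fun _ => l v := by
  funext p
  simp [dirD]

variable {A : (Fin d → ℝ) → (Fin d → ℝ)}

theorem potC_tempG (hA : Function.HasTemperateGrowth A) (j : Fin d) : TempG (potC A j) := by
  refine TempG.of_hasTemperateGrowth ?_
  exact (Complex.ofRealCLM.comp (ContinuousLinearMap.proj (R := ℝ) (φ := fun _ : Fin d => ℝ) j))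
    |>.hasTemperateGrowth.comp hA

theorem dirD_potC (hA : ContDiff ℝ ∞ A) (j : Fin d) (v x : Fin d → ℝ) :
    dirD v (potC A j) x = ((fderiv ℝ A x v j : ℝ) : ℂ) := by
  have h := (Complex.ofRealCLM.comp
    (ContinuousLinearMap.proj (R := ℝ) (φ := fun _ : Fin d => ℝ) j)).hasFDerivAt.comp x
      (hA.differentiable (by simp) x).hasFDerivAt
  exact congrArg (fun L => L v) h.fderiv

theorem fieldC_eq (hA : ContDiff ℝ ∞ A) (j k : Fin d) :
    fieldC A j k = fun x => dirD (Pi.single j 1) (potC A k) x - dirD (Pi.single k 1) (potC A j) x := by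
  funext x
  rw [dirD_potC hA, dirD_potC hA]
  simp [fieldC, Bof]

theorem contDiff_potC (hA : ContDiff ℝ ∞ A) (j : Fin d) : ContDiff ℝ ∞ (potC A j) :=
  (Complex.ofRealCLM.comp
    (ContinuousLinearMap.proj (R := ℝ) (φ := fun _ : Fin d => ℝ) j)).contDiff.comp hA

theorem contDiff_fieldC (hA : ContDiff ℝ ∞ A) (j k : Fin d) : ContDiff ℝ ∞ (fieldC A j k) := by
  rw [fieldC_eq hA]
  exact ((contDiff_potC hA k).dirD _).sub ((contDiff_potC hA j).dirD _)

theorem dList_ofReal {E : Type*} [NormedAddCommGroup E] [NormedSpace ℝ E] {f : E → ℝ}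
    (hf : ContDiff ℝ ∞ f) (L : List E) :
    ContDiff ℝ ∞ (dList L f) ∧
      dList L (fun x => (f x : ℂ)) = fun x => ((dList L f x : ℝ) : ℂ) := by
  induction L with
  | nil => exact ⟨hf, rfl⟩
  | cons v L ih =>
    refine ⟨(ih.1.fderiv_right (m := ∞) (by simp)).clm_apply contDiff_const, ?_⟩
    rw [dList_cons, ih.2]
    funext x
    exact congrArg (fun L => L v) (Complex.ofRealCLM.hasFDerivAt.comp x
      (ih.1.differentiable (by simp) x).hasFDerivAt).fderiv

theorem fieldC_bddG (hA : ContDiff ℝ ∞ A) (hB : BBounded (Bof A)) (j k : Fin d) :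
    BddG (fieldC A j k) := by
  refine BddG.of_symB (contDiff_fieldC hA j k) fun n => ?_
  refine SymB.of_basis (Pi.basisFun ℝ (Fin d)) (fun _ => contDiff_fieldC hA j k) fun L => ?_
  obtain ⟨C, hC⟩ := hB j k L
  have hs : ContDiff ℝ ∞ (Bof A j k) := by
    have h1 : ContDiff ℝ ∞ (fderiv ℝ A) := hA.fderiv_right (by simp)
    have h2 : ∀ v : Fin d → ℝ, ∀ i, ContDiff ℝ ∞ (fun x => fderiv ℝ A x v i) := fun v i =>
      contDiff_pi.1 (h1.clm_apply contDiff_const) i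
    exact (h2 _ _).sub (h2 _ _)
  refine ⟨C, fun _ p => ?_⟩
  have e : fieldC A j k = fun x => ((Bof A j k x : ℝ) : ℂ) := rfl
  have e2 : L.map (Pi.basisFun ℝ (Fin d)) = L.map (fun i => Pi.single i (1 : ℝ)) := by simp
  rw [e, (dList_ofReal hs _).2, e2, mul_one, Complex.norm_real]
  exact hC p

theorem contDiff_circ (hA : ContDiff ℝ ∞ A) : ContDiff ℝ ∞ (circ A) :=
  ContDiff.sum fun j _ => (diffCoord j).contDiff.mul
    (lineInt_contDiff contDiff_const (contDiff_potC hA j))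

theorem circ_tempG (hA : Function.HasTemperateGrowth A) : TempG (circ A) :=
  TempG.sum _ fun j _ => TempG.mul (TempG.clm (l := diffCoord j))
    (TempG.lineInt contDiff_const (potC_tempG hA j))

theorem lineInt_dirD_potC (hA : ContDiff ℝ ∞ A) {w : ℝ → ℂ} (hw : Continuous w)
    (v : Fin d → ℝ) (p : (Fin d → ℝ) × (Fin d → ℝ)) :
    ∑ k, ((p.2 k - p.1 k : ℝ) : ℂ) * lineInt w (dirD v (potC A k)) p =
      ∑ j, (v j : ℂ) * lineInt w (dirD (p.2 - p.1) (potC A j)) p +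
      ∑ j, ∑ k, ((p.2 k - p.1 k : ℝ) : ℂ) * ((v j : ℂ) * lineInt w (fieldC A j k) p) := by
  have hc : ∀ u j, Continuous (dirD u (potC A j)) := fun u j =>
    ((contDiff_potC hA j).dirD u).continuous
  have hf : ∀ j k, Continuous (fieldC A j k) := fun j k => (contDiff_fieldC hA j k).continuous
  have h1 : ∀ j, lineInt w (dirD (p.2 - p.1) (potC A j)) p =
      ∑ k, ((p.2 k - p.1 k : ℝ) : ℂ) * lineInt w (dirD (Pi.single k 1) (potC A j)) p := by
    intro j
    rw [← lineInt_sum _ _ hw fun k _ => hc _ j]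
    congr 1
    funext x
    exact dirD_eq_sum_single _ _
  have h2 : ∀ k, lineInt w (dirD v (potC A k)) p = ∑ j, (v j : ℂ) *
      (lineInt w (fieldC A j k) p + lineInt w (dirD (Pi.single k 1) (potC A j)) p) := by
    intro k
    simp only [← lineInt_add hw (hf _ _) (hc _ _)]
    rw [← lineInt_sum (β := fun j x => fieldC A j k x + dirD (Pi.single k 1) (potC A j) x)
      _ (fun j => (v j : ℂ)) hw fun j _ => (hf j k).add (hc (Pi.single k 1) j)]
    congr 1
    funext x
    rw [dirD_eq_sum_single]
    simp only [fieldC_eq hA, sub_add_cancel]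
  simp only [h1, h2, Finset.mul_sum]
  rw [Finset.sum_comm, ← Finset.sum_add_distrib]
  refine Finset.sum_congr rfl fun j _ => ?_
  rw [← Finset.sum_add_distrib]
  refine Finset.sum_congr rfl fun k _ => ?_
  ring

theorem dirD_sum {ι E : Type*} [NormedAddCommGroup E] [NormedSpace ℝ E] (s : Finset ι)
    {f : ι → E → ℂ} (hf : ∀ i ∈ s, ContDiff ℝ ∞ (f i)) (v : E) :
    dirD v (fun p => ∑ i ∈ s, f i p) = fun p => ∑ i ∈ s, dirD v (f i) p := by
  funext p
  simp only [dirD]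
  rw [fderiv_fun_sum fun i hi => (hf i hi).diff_at p]
  simp

theorem dirD_circ (hA : ContDiff ℝ ∞ A) (v : (Fin d → ℝ) × (Fin d → ℝ)) :
    dirD v (circ A) = fun p => ∑ j, (v.2 j : ℂ) * potC A j p.2 - ∑ j, (v.1 j : ℂ) * potC A j p.1 +
      fluxForm A v p := by
  funext p
  have hl : ∀ j, ContDiff ℝ ∞ (lineInt (fun _ => 1) (potC A j)) := fun j =>
    lineInt_contDiff contDiff_const (contDiff_potC hA j)
  have e : circ A = fun p => ∑ j, diffCoord j p * lineInt (fun _ => 1) (potC A j) p := rfl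
  have ej : ∀ j, dirD v (fun p => diffCoord j p * lineInt (fun _ => 1) (potC A j) p) p =
      (v.2 j - v.1 j) * lineInt (fun _ => 1) (potC A j) p +
        (((p.2 j - p.1 j : ℝ) : ℂ) * lineInt (fun t => 1 - (t : ℂ)) (dirD v.1 (potC A j)) p +
        ((p.2 j - p.1 j : ℝ) : ℂ) * lineInt (fun t => (t : ℂ)) (dirD v.2 (potC A j)) p) := by
    intro j
    rw [dirD_mul (diffCoord j).contDiff (hl j), dirD_clm,
      (lineInt_diff contDiff_const (contDiff_potC hA j)).2]
    simp [diffCoord_apply, mul_add]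
  rw [e, dirD_sum _ (fun j _ => (diffCoord j).contDiff.mul (hl j))]
  simp only [ej]
  rw [Finset.sum_add_distrib, Finset.sum_add_distrib,
    lineInt_dirD_potC hA (by fun_prop), lineInt_dirD_potC hA (by fun_prop)]
  simp only [(lineInt_sub_dirD (contDiff_potC hA _) p).1, (lineInt_sub_dirD (contDiff_potC hA _) p).2,
    fluxForm, mul_add, Finset.sum_add_distrib, mul_sub, Finset.sum_sub_distrib, Complex.ofReal_sub,
    sub_mul]
  ring

theorem magPhase_eq (hA : Continuous A) (x y : Fin d → ℝ) :
    magPhase A x y = cexp (-I * circ A (x, y)) := by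
  have h : ((∫ t in (0:ℝ)..1, dotR (A (x + t • (y - x))) (y - x) : ℝ) : ℂ) = circ A (x, y) := by
    have hi : ∀ j, Continuous (potC A j) := fun j => by unfold potC; fun_prop
    rw [intervalIntegral.integral_of_le zero_le_one, ← integral_complex_ofReal]
    simp only [circ]
    rw [← lineInt_sum _ (fun j => ((y j - x j : ℝ) : ℂ)) continuous_const (fun j _ => hi j)]
    simp [lineInt, dotR, potC, mul_comm]
  rw [magPhase, h]

theorem circ_im (A : (Fin d → ℝ) → (Fin d → ℝ)) (p : (Fin d → ℝ) × (Fin d → ℝ)) : (circ A p).im = 0 := by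
  have h : ∀ j, lineInt (fun _ => 1) (potC A j) p =
      ((∫ t in Set.Ioc (0 : ℝ) 1, A (p.1 + t • (p.2 - p.1)) j : ℝ) : ℂ) := by
    intro j
    rw [← integral_complex_ofReal]
    simp [lineInt, potC]
  simp only [circ, h, ← Complex.ofReal_mul, ← Complex.ofReal_sum, Complex.ofReal_im]

theorem circ_swap (A : (Fin d → ℝ) → (Fin d → ℝ)) (x y : Fin d → ℝ) :
    circ A (y, x) = - circ A (x, y) := by
  have h : ∀ j, lineInt (fun _ => 1) (potC A j) (y, x) = lineInt (fun _ => 1) (potC A j) (x, y) := by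
    intro j
    simp only [lineInt, one_mul]
    rw [← intervalIntegral.integral_of_le zero_le_one, ← intervalIntegral.integral_of_le zero_le_one]
    have := intervalIntegral.integral_comp_sub_left (a := 0) (b := 1)
      (fun t : ℝ => potC A j (x + t • (y - x))) 1
    simp only [sub_self, sub_zero] at this
    rw [← this]
    congr 1
    funext t
    congr 1
    module
  simp only [circ, h, ← Finset.sum_neg_distrib]
  refine Finset.sum_congr rfl fun j _ => ?_
  push_cast
  ring

theorem fluxForm_polyB (hA : ContDiff ℝ ∞ A) (hB : BBounded (Bof A))
    {W : (Fin d → ℝ) × (Fin d → ℝ) → ℝ} (hW : ∀ p, 1 ≤ W p)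
    (h : ∀ k : Fin d, PolyB (fun (_ : Unit) => W) (fun _ p => diffCoord k p))
    (v : (Fin d → ℝ) × (Fin d → ℝ)) :
    PolyB (fun (_ : Unit) => W) (fun _ => fluxForm A v) := by
  have hb : ∀ {u : (Fin d → ℝ) × (Fin d → ℝ) → ℂ}, BddG u → PolyB (fun (_ : Unit) => W) (fun _ => u) :=
    fun hu => PolyB.weight_mono (K := 1) (fun _ _ => zero_le_one) (fun _ p => by simpa using hW p) hu
  have hof : ContDiff ℝ ∞ (fun t : ℝ => (t : ℂ)) := Complex.ofRealCLM.contDiff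
  refine PolyB.sum (fun _ => hW) _ fun j _ => PolyB.sum (fun _ => hW) _ fun k _ => ?_
  exact PolyB.mul (fun _ => hW) (h k) (hb
    (((BddG.lineInt (contDiff_const.sub hof) (fieldC_bddG hA hB j k)).const_mul _).add
      ((BddG.lineInt hof (fieldC_bddG hA hB j k)).const_mul _)))

end MagneticPhase

/-! ### Oscillatory integral operators -/

section Oscillatory

variable {d : ℕ}

theorem integrable_one_add_norm_pow_inv :
    Integrable (fun y : Fin d → ℝ => ((1 + ‖y‖) ^ (d + 1))⁻¹) := by
  have h := integrable_one_add_norm (E := Fin d → ℝ) (μ := volume) (r := (d + 1 : ℝ)) (by simp)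
  refine h.congr (Filter.Eventually.of_forall fun y => ?_)
  simp only
  rw [Real.rpow_neg (by positivity)]
  exact_mod_cast congrArg _ (Real.rpow_natCast (1 + ‖y‖) (d + 1))

theorem SchwartzMap.exists_one_add_norm_pow_mul_le (φ : SchwartzMap (Fin d → ℝ) ℂ) (k : ℕ) :
    ∃ C : ℝ, 0 ≤ C ∧ ∀ y, (1 + ‖y‖) ^ k * ‖φ y‖ ≤ C := by
  have h := fun y => SchwartzMap.one_add_le_sup_seminorm_apply (𝕜 := ℂ) (m := (k, 0)) le_rfl le_rfl φ y
  simp only [norm_iteratedFDeriv_zero] at h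
  exact ⟨_, le_trans (by positivity) (h 0), h⟩

/-- Multiplication of a Schwartz function by the `j`-th coordinate. -/
def posMul (j : Fin d) (φ : SchwartzMap (Fin d → ℝ) ℂ) : SchwartzMap (Fin d → ℝ) ℂ :=
  SchwartzMap.smulLeftCLM ℂ (fun x : Fin d → ℝ => (x j : ℂ)) φ

theorem posMul_apply (j : Fin d) (φ : SchwartzMap (Fin d → ℝ) ℂ) (x : Fin d → ℝ) :
    posMul j φ x = (x j : ℂ) * φ x := by
  have h : Function.HasTemperateGrowth (fun x : Fin d → ℝ => (x j : ℂ)) :=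
    (Complex.ofRealCLM.comp (ContinuousLinearMap.proj (R := ℝ) (φ := fun _ : Fin d => ℝ) j))
      |>.hasTemperateGrowth
  rw [posMul, SchwartzMap.smulLeftCLM_apply_apply h, smul_eq_mul]

/-- The directional derivative of a Schwartz function. -/
def derS (v : Fin d → ℝ) (φ : SchwartzMap (Fin d → ℝ) ℂ) : SchwartzMap (Fin d → ℝ) ℂ :=
  LineDeriv.lineDerivOp v φ

theorem derS_apply (v : Fin d → ℝ) (φ : SchwartzMap (Fin d → ℝ) ℂ) (x : Fin d → ℝ) :
    derS v φ x = dirD v (fun y => φ y) x :=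
  SchwartzMap.lineDerivOp_apply_eq_fderiv v φ x

theorem SchwartzMap.contDiff_infty (φ : SchwartzMap (Fin d → ℝ) ℂ) : ContDiff ℝ ∞ (fun y => φ y) :=
  φ.smooth'

/-- Amplitudes `c(x,y,ξ)` whose derivatives grow polynomially in `(x,y)`, uniformly in `ξ`; the
growth of the derivatives of order at most `n` is governed by `k n`, regardless of additional
`ξ`-derivatives. -/
structure Amp (k : ℕ → ℕ) (c : (Fin d → ℝ) × (Fin d → ℝ) × (Fin d → ℝ) → ℂ) : Prop where
  smooth : ContDiff ℝ ∞ c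
  bounds : ∀ (n : ℕ) (L : List (Fin d → ℝ)),
    SymB (fun (_ : Unit) p => ((1 + ‖p.1‖) * (1 + ‖p.2.1‖)) ^ k n) n
      (fun _ => dList (L.map fun η => (0, 0, η)) c)

namespace Amp

variable {k : ℕ → ℕ} {c : (Fin d → ℝ) × (Fin d → ℝ) × (Fin d → ℝ) → ℂ}

theorem bound (hc : Amp k c) : ∃ C : ℝ, 0 ≤ C ∧ ∀ p, ‖c p‖ ≤ C *
    ((1 + ‖p.1‖) * (1 + ‖p.2.1‖)) ^ k 0 := by
  obtain ⟨C, hC⟩ := (hc.bounds 0 []).bound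
  exact ⟨|C|, abs_nonneg C, fun p => (hC () p).trans
    (mul_le_mul_of_nonneg_right (le_abs_self C) (by positivity))⟩

theorem dirD (hc : Amp k c) (v : (Fin d → ℝ) × (Fin d → ℝ) × (Fin d → ℝ)) :
    Amp (fun n => k (n + 1)) (dirD v c) := by
  refine ⟨hc.smooth.dirD v, fun n L => ?_⟩
  rw [← dList_concat, dList_perm hc.smooth (List.perm_append_singleton v _), dList_cons]
  exact (hc.bounds (n + 1) L).2 v

theorem dirD_xi (hc : Amp k c) (η : Fin d → ℝ) : Amp k (_root_.dirD (0, 0, η) c) := by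
  refine ⟨hc.smooth.dirD _, fun n L => ?_⟩
  have := hc.bounds n (L ++ [η])
  simpa [← dList_concat] using this

theorem dList_const_xi {E : Type*} [NormedAddCommGroup E] [NormedSpace ℝ E]
    {u a : E → ℂ} (hu : ContDiff ℝ ∞ u) (ha : ContDiff ℝ ∞ a) (L : List E)
    (h : ∀ v ∈ L, _root_.dirD v u = fun _ => 0) :
    dList L (fun p => u p * a p) = fun p => u p * dList L a p := by
  induction L with
  | nil => rfl
  | cons v L ih =>
    rw [dList_cons, ih fun v hv => h v (List.mem_cons_of_mem _ hv), dirD_mul hu (ha.dList L),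
      h v List.mem_cons_self]
    simp [dList_cons]

theorem of_mul {u : (Fin d → ℝ) × (Fin d → ℝ) → ℂ} (hu : TempG u)
    {k : ℕ → ℕ} (hk : ∀ n, SymB (fun (_ : Unit) p => (1 + ‖p‖) ^ k n) n (fun _ => u))
    {a : (Fin d → ℝ) × (Fin d → ℝ) × (Fin d → ℝ) → ℂ} (ha : BddG a) :
    Amp k (fun p => u (p.1, p.2.1) * a p) := by
  let l : (Fin d → ℝ) × (Fin d → ℝ) × (Fin d → ℝ) →L[ℝ] (Fin d → ℝ) × (Fin d → ℝ) :=
    (ContinuousLinearMap.fst ℝ _ _).prod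
      ((ContinuousLinearMap.fst ℝ _ _).comp (ContinuousLinearMap.snd ℝ _ _))
  have hus : ContDiff ℝ ∞ (fun p => u (l p)) := hu.smooth.comp l.contDiff
  refine ⟨hus.mul ha.smooth, fun n L => ?_⟩
  have h1 := dList_const_xi hus ha.smooth (L.map fun η => (0, 0, η)) (by
    intro v hv
    obtain ⟨η, _, rfl⟩ := List.mem_map.1 hv
    have := dirD_comp_affine hu.smooth l 0 (0, 0, η)
    simp only [add_zero] at this
    rw [this]
    funext p
    exact map_zero (fderiv ℝ u (l p)))
  change SymB _ n (fun _ => dList _ fun p => u (l p) * a p)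
  rw [h1]
  have h2 := (hk n).comp_affine (fun _ => hu.smooth) (fun _ : Unit => ()) l (fun _ => 0)
  simp only [add_zero] at h2
  have h3 : ∀ L : List ((Fin d → ℝ) × (Fin d → ℝ) × (Fin d → ℝ)), BddG (dList L a) := by
    intro L
    induction L with
    | nil => exact ha
    | cons v L ih => exact ih.dirD v
  have h4 := h2.mul (fun _ _ => zero_le_one) (fun _ => hus) (fun _ => BddG.smooth (h3 _))
    (BddG.symB (h3 (L.map fun η => (0, 0, η))) n)
  refine h4.weight_mono (K := 1) (fun _ p => by positivity) (fun _ p => ?_)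
  rw [mul_one, one_mul]
  refine pow_le_pow_left₀ (by positivity) ?_ _
  have : ‖l p‖ ≤ ‖p.1‖ + ‖p.2.1‖ := by
    change ‖(p.1, p.2.1)‖ ≤ _
    rw [Prod.norm_def]
    exact max_le_add_of_nonneg (norm_nonneg _) (norm_nonneg _)
  nlinarith [norm_nonneg p.1, norm_nonneg p.2.1]

theorem exists_of_mul {u : (Fin d → ℝ) × (Fin d → ℝ) → ℂ} (hu : TempG u) :
    ∃ k, ∀ {a : (Fin d → ℝ) × (Fin d → ℝ) × (Fin d → ℝ) → ℂ}, BddG a →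
      Amp k (fun p => u (p.1, p.2.1) * a p) := by
  choose k hk using fun n => PolyB.bounds hu n
  exact ⟨k, fun ha => of_mul hu hk ha⟩

end Amp

/-- The oscillating factor `exp(i⟨ξ, x - y⟩)` at `((x, ξ), y)`. -/
def wave (z : ((Fin d → ℝ) × (Fin d → ℝ)) × (Fin d → ℝ)) : ℂ :=
  cexp (I * ((dotR z.1.2 (z.1.1 - z.2) : ℝ) : ℂ))

theorem norm_wave (z : ((Fin d → ℝ) × (Fin d → ℝ)) × (Fin d → ℝ)) : ‖wave z‖ = 1 := by
  rw [wave, mul_comm, Complex.norm_exp_ofReal_mul_I]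

theorem hasFDerivAt_phase (z : ((Fin d → ℝ) × (Fin d → ℝ)) × (Fin d → ℝ)) :
    ContDiff ℝ ∞ (fun z : ((Fin d → ℝ) × (Fin d → ℝ)) × (Fin d → ℝ) =>
      I * ((dotR z.1.2 (z.1.1 - z.2) : ℝ) : ℂ)) ∧
    ∀ w, dirD w (fun z : ((Fin d → ℝ) × (Fin d → ℝ)) × (Fin d → ℝ) =>
      I * ((dotR z.1.2 (z.1.1 - z.2) : ℝ) : ℂ)) z =
      I * ((dotR w.1.2 (z.1.1 - z.2) + dotR z.1.2 (w.1.1 - w.2) : ℝ) : ℂ) := by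
  let f : ((Fin d → ℝ) × (Fin d → ℝ)) × (Fin d → ℝ) →L[ℝ] (Fin d → ℝ) :=
    (ContinuousLinearMap.snd ℝ _ _).comp (ContinuousLinearMap.fst ℝ _ _)
  let g : ((Fin d → ℝ) × (Fin d → ℝ)) × (Fin d → ℝ) →L[ℝ] (Fin d → ℝ) :=
    (ContinuousLinearMap.fst ℝ _ _).comp (ContinuousLinearMap.fst ℝ _ _) -
      ContinuousLinearMap.snd ℝ _ _
  let fi : Fin d → ((Fin d → ℝ) × (Fin d → ℝ)) × (Fin d → ℝ) →L[ℝ] ℂ := fun i =>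
    (Complex.ofRealCLM.comp (ContinuousLinearMap.proj (R := ℝ) (φ := fun _ : Fin d => ℝ) i)).comp f
  let gi : Fin d → ((Fin d → ℝ) × (Fin d → ℝ)) × (Fin d → ℝ) →L[ℝ] ℂ := fun i =>
    (Complex.ofRealCLM.comp (ContinuousLinearMap.proj (R := ℝ) (φ := fun _ : Fin d => ℝ) i)).comp g
  have e : (fun z : ((Fin d → ℝ) × (Fin d → ℝ)) × (Fin d → ℝ) =>
      I * ((dotR z.1.2 (z.1.1 - z.2) : ℝ) : ℂ)) = fun z => I * ∑ i, fi i z * gi i z := by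
    funext z
    simp only [dotR, Complex.ofReal_sum, Complex.ofReal_mul]
    rfl
  have hs : ∀ i ∈ Finset.univ, ContDiff ℝ ∞ (fun z => fi i z * gi i z) := fun i _ =>
    (fi i).contDiff.mul (gi i).contDiff
  rw [e]
  refine ⟨contDiff_const.mul (ContDiff.sum hs), fun w => ?_⟩
  rw [dirD_const_mul (ContDiff.sum hs), dirD_sum _ hs]
  simp only [dirD_mul (fi _).contDiff (gi _).contDiff, dirD_clm, dotR, Finset.sum_add_distrib,
    Complex.ofReal_add, Complex.ofReal_sum, Complex.ofReal_mul]
  rfl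

theorem contDiff_wave : ContDiff ℝ ∞ (wave (d := d)) := (hasFDerivAt_phase 0).1.cexp

theorem dirD_wave (w z : ((Fin d → ℝ) × (Fin d → ℝ)) × (Fin d → ℝ)) :
    dirD w wave z =
      I * ((dotR w.1.2 (z.1.1 - z.2) + dotR z.1.2 (w.1.1 - w.2) : ℝ) : ℂ) * wave z := by
  have h := congrFun (dirD_exp (hasFDerivAt_phase z).1 w) z
  simp only [(hasFDerivAt_phase z).2 w] at h
  exact h

/-- The integrand of the oscillatory integral with amplitude `c` applied to `φ`. -/
def osc (c : (Fin d → ℝ) × (Fin d → ℝ) × (Fin d → ℝ) → ℂ) (φ : (Fin d → ℝ) → ℂ)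
    (z : ((Fin d → ℝ) × (Fin d → ℝ)) × (Fin d → ℝ)) : ℂ :=
  wave z * (c (z.1.1, z.2, z.1.2) * φ z.2)

/-- The reordering `((x, ξ), y) ↦ (x, y, ξ)`. -/
def reord : ((Fin d → ℝ) × (Fin d → ℝ)) × (Fin d → ℝ) →L[ℝ]
    (Fin d → ℝ) × (Fin d → ℝ) × (Fin d → ℝ) :=
  ((ContinuousLinearMap.fst ℝ _ _).comp (ContinuousLinearMap.fst ℝ _ _)).prod
    ((ContinuousLinearMap.snd ℝ _ _).prod
      ((ContinuousLinearMap.snd ℝ _ _).comp (ContinuousLinearMap.fst ℝ _ _)))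

variable {k : ℕ → ℕ} {c : (Fin d → ℝ) × (Fin d → ℝ) × (Fin d → ℝ) → ℂ}

theorem contDiff_osc (hc : ContDiff ℝ ∞ c) {φ : (Fin d → ℝ) → ℂ} (hφ : ContDiff ℝ ∞ φ) :
    ContDiff ℝ ∞ (osc c φ) :=
  contDiff_wave.mul ((hc.comp (reord (d := d)).contDiff).mul (hφ.comp contDiff_snd))

theorem dirD_osc (hc : ContDiff ℝ ∞ c) (φ : SchwartzMap (Fin d → ℝ) ℂ)
    (w z : ((Fin d → ℝ) × (Fin d → ℝ)) × (Fin d → ℝ)) :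
    dirD w (osc c φ) z =
      I * ((dotR w.1.2 z.1.1 + dotR z.1.2 (w.1.1 - w.2) : ℝ) : ℂ) * osc c φ z
      - ∑ j, I * (w.1.2 j : ℂ) * osc c (posMul j φ) z
      + osc (dirD (w.1.1, w.2, w.1.2) c) φ z + osc c (derS w.2 φ) z := by
  have hφ := SchwartzMap.contDiff_infty φ
  have h1 : ContDiff ℝ ∞ (fun z => c (reord z)) := hc.comp (reord (d := d)).contDiff
  have h2 : ContDiff ℝ ∞ (fun z : ((Fin d → ℝ) × (Fin d → ℝ)) × (Fin d → ℝ) =>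
    φ (ContinuousLinearMap.snd ℝ _ _ z)) := hφ.comp (ContinuousLinearMap.contDiff _)
  have e : osc c φ = fun z => wave z * (c (reord z) * φ (ContinuousLinearMap.snd ℝ _ _ z)) := rfl
  have h3 := dirD_comp_affine hc reord 0 w
  have h4 := dirD_comp_affine hφ (ContinuousLinearMap.snd ℝ ((Fin d → ℝ) × (Fin d → ℝ)) _) 0 w
  simp only [add_zero] at h3 h4
  have h5 : dotR w.1.2 (z.1.1 - z.2) = dotR w.1.2 z.1.1 - ∑ j, w.1.2 j * z.2 j := by
    simp [dotR, mul_sub]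
  have h6 : ∑ j, I * (w.1.2 j : ℂ) * osc c (posMul j φ) z =
      I * (∑ j, (w.1.2 j : ℂ) * (z.2 j : ℂ)) * osc c φ z := by
    simp only [osc, posMul_apply, Finset.mul_sum, Finset.sum_mul]
    refine Finset.sum_congr rfl fun j _ => ?_
    ring
  rw [h6, e, dirD_mul contDiff_wave (h1.mul h2)]
  simp only
  rw [dirD_wave, dirD_mul h1 h2, h3, h4, h5]
  simp only [osc, derS_apply]
  push_cast
  simp only [reord, ContinuousLinearMap.prod_apply, ContinuousLinearMap.coe_comp,
    Function.comp_apply, ContinuousLinearMap.coe_fst', ContinuousLinearMap.coe_snd']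
  ring

theorem norm_osc_le (hc : Amp k c) (φ : SchwartzMap (Fin d → ℝ) ℂ) :
    ∃ C : ℝ, 0 ≤ C ∧ ∀ z, ‖osc c φ z‖ ≤ C * (1 + ‖z.1.1‖) ^ k 0 * ((1 + ‖z.2‖) ^ (d + 1))⁻¹ := by
  obtain ⟨C, hC0, hC⟩ := hc.bound
  obtain ⟨S, hS0, hS⟩ := SchwartzMap.exists_one_add_norm_pow_mul_le φ (k 0 + (d + 1))
  refine ⟨C * S, by positivity, fun z => ?_⟩
  rw [osc, norm_mul, norm_wave, one_mul, norm_mul]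
  have h1 := hC (z.1.1, z.2, z.1.2)
  have h2 := hS z.2
  have h3 : ‖φ z.2‖ * (1 + ‖z.2‖) ^ k 0 ≤ S * ((1 + ‖z.2‖) ^ (d + 1))⁻¹ := by
    rw [← div_eq_mul_inv, le_div_iff₀ (by positivity)]
    rw [pow_add] at h2
    linarith
  calc _ ≤ C * ((1 + ‖z.1.1‖) * (1 + ‖z.2‖)) ^ k 0 * ‖φ z.2‖ :=
        mul_le_mul_of_nonneg_right h1 (norm_nonneg _)
    _ = C * (1 + ‖z.1.1‖) ^ k 0 * (‖φ z.2‖ * (1 + ‖z.2‖) ^ k 0) := by rw [mul_pow]; ring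
    _ ≤ C * (1 + ‖z.1.1‖) ^ k 0 * (S * ((1 + ‖z.2‖) ^ (d + 1))⁻¹) :=
        mul_le_mul_of_nonneg_left h3 (by positivity)
    _ = _ := by ring

theorem locDom_osc (hc : Amp k c) (φ : SchwartzMap (Fin d → ℝ) ℂ) :
    LocDom volume (osc c φ) := by
  obtain ⟨C, hC0, hC⟩ := norm_osc_le hc φ
  intro p₀
  refine ⟨fun y => C * (2 + ‖p₀‖) ^ k 0 * ((1 + ‖y‖) ^ (d + 1))⁻¹,
    integrable_one_add_norm_pow_inv.const_mul _, fun p hp => Filter.Eventually.of_forall fun y => ?_⟩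
  refine (hC (p, y)).trans (mul_le_mul_of_nonneg_right (mul_le_mul_of_nonneg_left ?_ hC0)
    (by positivity))
  refine pow_le_pow_left₀ (by positivity) ?_ _
  have h1 : ‖p.1‖ ≤ ‖p‖ := norm_fst_le p
  have h2 : ‖p‖ ≤ ‖p₀‖ + ‖p - p₀‖ := by simpa using norm_add_le p₀ (p - p₀)
  have h3 : ‖p - p₀‖ < 1 := by rwa [← dist_eq_norm]
  simp only
  linarith

theorem LocDom.add {P Y : Type*} [NormedAddCommGroup P] [MeasurableSpace Y] {μ : Measure Y}
    {G H : P × Y → ℂ} (hG : LocDom μ G) (hH : LocDom μ H) : LocDom μ (fun z => G z + H z) := by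
  intro p₀
  obtain ⟨b, hb, h1⟩ := hG p₀
  obtain ⟨b', hb', h2⟩ := hH p₀
  refine ⟨fun y => b y + b' y, hb.add hb', fun p hp => ?_⟩
  filter_upwards [h1 p hp, h2 p hp] with y h3 h4
  exact (norm_add_le _ _).trans (add_le_add h3 h4)

theorem LocDom.zero {P Y : Type*} [NormedAddCommGroup P] [MeasurableSpace Y] {μ : Measure Y} :
    LocDom μ (fun _ : P × Y => (0 : ℂ)) :=
  fun _ => ⟨fun _ => 0, integrable_zero _ _ _, fun _ _ => Filter.Eventually.of_forall fun _ => by simp⟩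

theorem LocDom.sum {P Y ι : Type*} [NormedAddCommGroup P] [MeasurableSpace Y]
    {μ : Measure Y} (s : Finset ι) {G : ι → P × Y → ℂ} (hG : ∀ i ∈ s, LocDom μ (G i)) :
    LocDom μ (fun z => ∑ i ∈ s, G i z) := by
  classical
  induction s using Finset.induction_on with
  | empty => simpa using LocDom.zero
  | insert a s ha ih =>
    simp only [Finset.sum_insert ha]
    exact (hG a (Finset.mem_insert_self a s)).add
      (ih fun i hi => hG i (Finset.mem_insert_of_mem hi))

theorem LocDom.mul_left {P Y : Type*} [NormedAddCommGroup P] [ProperSpace P] [MeasurableSpace Y]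
    {μ : Measure Y} {G : P × Y → ℂ} (hG : LocDom μ G) {g : P → ℂ} (hg : Continuous g) :
    LocDom μ (fun z => g z.1 * G z) := by
  intro p₀
  obtain ⟨b, hb, h1⟩ := hG p₀
  obtain ⟨C, hC⟩ := (isCompact_closedBall p₀ 1).exists_bound_of_continuousOn hg.continuousOn
  refine ⟨fun y => |C| * b y, hb.const_mul _, fun p hp => ?_⟩
  filter_upwards [h1 p hp] with y h2
  rw [norm_mul]
  exact mul_le_mul ((hC p (Metric.ball_subset_closedBall hp)).trans (le_abs_self C)) h2
    (norm_nonneg _) (abs_nonneg C)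

theorem continuous_dotR {X : Type*} [TopologicalSpace X] {f g : X → Fin d → ℝ}
    (hf : Continuous f) (hg : Continuous g) : Continuous (fun x => dotR (f x) (g x)) := by
  unfold dotR
  fun_prop

theorem Amp.integrable_osc (hc : Amp k c) (φ : SchwartzMap (Fin d → ℝ) ℂ)
    (p : (Fin d → ℝ) × (Fin d → ℝ)) : Integrable (fun y => osc c φ (p, y)) :=
  (locDom_osc hc φ).integrable (contDiff_osc hc.smooth φ.contDiff_infty).continuous p

/-- The inner (`y`-)integral of the oscillatory integral operator with amplitude `c`. -/
def oscJ (c : (Fin d → ℝ) × (Fin d → ℝ) × (Fin d → ℝ) → ℂ) (φ : (Fin d → ℝ) → ℂ)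
    (p : (Fin d → ℝ) × (Fin d → ℝ)) : ℂ := ∫ y, osc c φ (p, y)

theorem integral_fderiv_eq_zero_of_integrable {g : (Fin d → ℝ) → ℂ} (hg : Differentiable ℝ g)
    {v : Fin d → ℝ} (h0 : Integrable g) (h1 : Integrable (fun y => fderiv ℝ g y v)) :
    ∫ y, fderiv ℝ g y v = 0 := by
  have h := integral_mul_fderiv_eq_neg_fderiv_mul_of_integrable (𝕜 := ℂ)
    (μ := (volume : Measure (Fin d → ℝ))) (f := fun _ => (1 : ℂ)) (g := g) (v := v)
    (by simp) (by simpa using h1) (by simpa using h0)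
    (fun _ _ => differentiableAt_const _) (fun x _ => hg x)
  simpa using h

/-- Integration by parts in `y`. -/
theorem Amp.oscJ_ibp (hc : Amp k c) (φ : SchwartzMap (Fin d → ℝ) ℂ) (v : Fin d → ℝ)
    (p : (Fin d → ℝ) × (Fin d → ℝ)) :
    I * (dotR p.2 v : ℂ) * oscJ c φ p = oscJ (_root_.dirD (0, v, 0) c) φ p + oscJ c (derS v φ) p := by
  have hG := contDiff_osc hc.smooth φ.contDiff_infty
  have hi0 := hc.integrable_osc φ p
  have hi1 := (hc.dirD (0, v, 0)).integrable_osc φ p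
  have hi2 := hc.integrable_osc (derS v φ) p
  let l : (Fin d → ℝ) →L[ℝ] ((Fin d → ℝ) × (Fin d → ℝ)) × (Fin d → ℝ) :=
    ContinuousLinearMap.inr ℝ _ _
  have e0 : (fun y => osc c φ (p, y)) = fun y => osc c φ (l y + (p, 0)) := by
    funext y; simp [l]
  have hs : ContDiff ℝ ∞ (fun y => osc c φ (p, y)) := by
    rw [e0]; exact hG.comp (l.contDiff.add contDiff_const)
  have e1 : ∀ y, fderiv ℝ (fun y => osc c φ (p, y)) y v =
      - (I * (dotR p.2 v : ℂ)) * osc c φ (p, y) + osc (_root_.dirD (0, v, 0) c) φ (p, y) +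
        osc c (derS v φ) (p, y) := by
    intro y
    change _root_.dirD v (fun y => osc c φ (p, y)) y = _
    rw [e0, dirD_comp_affine hG]
    simp only
    rw [dirD_osc hc.smooth]
    simp [l, dotR]
  have hi := ((hi0.const_mul (- (I * (dotR p.2 v : ℂ)))).add hi1).add hi2
  have h := integral_fderiv_eq_zero_of_integrable (hs.differentiable (by simp)) (v := v) hi0
    (by simp only [e1]; exact hi)
  simp only [e1] at h
  rw [integral_add (by exact (hi0.const_mul _).add hi1) hi2, integral_add (hi0.const_mul _) hi1,
    integral_const_mul] at h
  simp only [oscJ]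
  linear_combination (-1 : ℂ) * h

theorem Amp.oscJ_diff (hc : Amp k c) (φ : SchwartzMap (Fin d → ℝ) ℂ) :
    ContDiff ℝ 1 (oscJ c φ) ∧ ∀ (v η : Fin d → ℝ) p, fderiv ℝ (oscJ c φ) p (v, η) =
      I * (dotR η p.1 : ℂ) * oscJ c φ p - ∑ j, I * (η j : ℂ) * oscJ c (posMul j φ) p +
      oscJ (_root_.dirD (v, v, η) c) φ p + oscJ c (derS v φ) p := by
  have hG := contDiff_osc hc.smooth φ.contDiff_infty
  have hG1 : ContDiff ℝ 1 (osc c φ) := hG.of_le (by exact_mod_cast le_top)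
  have h0 := locDom_osc hc φ
  have hder : ∀ (v η : Fin d → ℝ) z, fderiv ℝ (osc c φ) z ((v, η), 0) =
      I * ((dotR η z.1.1 + dotR z.1.2 v : ℝ) : ℂ) * osc c φ z
      + ∑ j, -(I * (η j : ℂ)) * osc c (posMul j φ) z + osc (_root_.dirD (v, 0, η) c) φ z := by
    intro v η z
    refine (dirD_osc hc.smooth φ ((v, η), 0) z).trans ?_
    have : osc c (derS 0 φ) z = 0 := by simp [osc, derS_apply, _root_.dirD]
    simp only [this, add_zero, sub_zero, neg_mul, Finset.sum_neg_distrib]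
    ring
  have h1 : ∀ v : (Fin d → ℝ) × (Fin d → ℝ),
      LocDom volume (fun z => fderiv ℝ (osc c φ) z (v, 0)) := by
    rintro ⟨v, η⟩
    simp only [hder]
    refine LocDom.add (LocDom.add (h0.mul_left
      (g := fun p => I * ((dotR η p.1 + dotR p.2 v : ℝ) : ℂ)) ?_)
      (LocDom.sum _ fun j _ => (locDom_osc hc _).mul_left (g := fun _ => -(I * (η j : ℂ))) (by fun_prop)))
      (locDom_osc (hc.dirD _) φ)
    exact continuous_const.mul (Complex.continuous_ofReal.comp
      ((continuous_dotR continuous_const continuous_fst).add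
        (continuous_dotR continuous_snd continuous_const)))
  refine ⟨LocDom.contDiff_integral hG1 h0 h1, fun v η p => ?_⟩
  refine ((LocDom.hasFDerivAt_integral hG1 h0 h1 p).2 (v, η)).trans ?_
  simp only [hder]
  have hi0 := (hc.integrable_osc φ p).const_mul (I * ((dotR η p.1 + dotR p.2 v : ℝ) : ℂ))
  have hi1 : Integrable (fun y => ∑ j, -(I * (η j : ℂ)) * osc c (posMul j φ) (p, y)) :=
    integrable_finsetSum _ fun j _ => (hc.integrable_osc (posMul j φ) p).const_mul _
  have hi2 := (hc.dirD (v, 0, η)).integrable_osc φ p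
  rw [integral_add (by exact hi0.add hi1) hi2, integral_add hi0 hi1, integral_const_mul,
    integral_finsetSum _ fun j _ => (hc.integrable_osc (posMul j φ) p).const_mul _]
  simp only [integral_const_mul]
  have h2 := hc.oscJ_ibp φ v p
  have h3 : oscJ (_root_.dirD (v, v, η) c) φ p =
      oscJ (_root_.dirD (v, 0, η) c) φ p + oscJ (_root_.dirD (0, v, 0) c) φ p := by
    simp only [oscJ]
    rw [← integral_add hi2 ((hc.dirD (0, v, 0)).integrable_osc φ p)]
    congr 1
    funext y
    have : (v, v, η) = (v, (0 : Fin d → ℝ), η) + (0, v, (0 : Fin d → ℝ)) := by simp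
    simp only [osc, _root_.dirD]
    rw [this, map_add]
    ring
  rw [h3]
  simp only [oscJ, neg_mul, Finset.sum_neg_distrib] at h2 ⊢
  push_cast
  linear_combination h2

end Oscillatory

section OscillatoryOperator

variable {d : ℕ} {k : ℕ → ℕ} {c : (Fin d → ℝ) × (Fin d → ℝ) × (Fin d → ℝ) → ℂ}

theorem dotR_single (x : Fin d → ℝ) (j : Fin d) : dotR x (Pi.single j 1) = x j := by
  simp [dotR, Pi.single_apply]

theorem single_dotR (x : Fin d → ℝ) (j : Fin d) : dotR (Pi.single j 1) x = x j := by
  simp [dotR, Pi.single_apply]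

theorem norm_le_sum_abs (x : Fin d → ℝ) : ‖x‖ ≤ ∑ j, |x j| :=
  (pi_norm_le_iff_of_nonneg (Finset.sum_nonneg fun _ _ => abs_nonneg _)).2 fun j =>
    Finset.single_le_sum (f := fun j => |x j|) (fun _ _ => abs_nonneg _) (Finset.mem_univ j)

theorem one_add_pow_le {r : ℝ} (hr : 0 ≤ r) (n : ℕ) : (1 + r) ^ n ≤ 2 ^ n * (1 + r ^ n) := by
  refine (add_pow_le zero_le_one hr n).trans ?_
  rw [one_pow]
  exact mul_le_mul_of_nonneg_right (pow_le_pow_right₀ one_le_two (Nat.sub_le n 1)) (by positivity)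

theorem Amp.exists_norm_pow_mul_oscJ_le (n : ℕ) : ∀ k : ℕ → ℕ, ∃ M : ℕ,
    ∀ c : (Fin d → ℝ) × (Fin d → ℝ) × (Fin d → ℝ) → ℂ, Amp k c →
    ∀ φ : SchwartzMap (Fin d → ℝ) ℂ, ∃ C : ℝ, 0 ≤ C ∧
    ∀ p, ‖p.2‖ ^ n * ‖oscJ c φ p‖ ≤ C * (1 + ‖p.1‖) ^ M := by
  induction n with
  | zero =>
    refine fun k => ⟨k 0, fun c hc φ => ?_⟩
    obtain ⟨C, hC0, hC⟩ := norm_osc_le hc φ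
    have hi : Integrable (fun y : Fin d → ℝ => ((1 + ‖y‖) ^ (d + 1))⁻¹) :=
      integrable_one_add_norm_pow_inv
    have hK : 0 ≤ ∫ y : Fin d → ℝ, ((1 + ‖y‖) ^ (d + 1))⁻¹ := integral_nonneg fun y => by positivity
    refine ⟨C * ∫ y : Fin d → ℝ, ((1 + ‖y‖) ^ (d + 1))⁻¹, by positivity, fun p => ?_⟩
    rw [pow_zero, one_mul]
    refine (norm_integral_le_of_norm_le (hi.const_mul (C * (1 + ‖p.1‖) ^ k 0))
      (Filter.Eventually.of_forall fun y => hC (p, y))).trans (le_of_eq ?_)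
    rw [integral_const_mul]
    ring
  | succ n ih =>
    intro k
    obtain ⟨M₁, h₁⟩ := ih (fun n => k (n + 1))
    obtain ⟨M₂, h₂⟩ := ih k
    refine ⟨max M₁ M₂, fun c hc φ => ?_⟩
    choose C₁ hC₁0 hC₁ using fun j : Fin d => h₁ _ (hc.dirD (0, Pi.single j 1, 0)) φ
    choose C₂ hC₂0 hC₂ using fun j : Fin d => h₂ _ hc (derS (Pi.single j 1) φ)
    refine ⟨∑ j, (C₁ j + C₂ j), Finset.sum_nonneg fun j _ => add_nonneg (hC₁0 j) (hC₂0 j),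
      fun p => ?_⟩
    have hj : ∀ j, |p.2 j| * (‖p.2‖ ^ n * ‖oscJ c φ p‖) ≤
        (C₁ j + C₂ j) * (1 + ‖p.1‖) ^ max M₁ M₂ := by
      intro j
      have e := congrArg norm (hc.oscJ_ibp φ (Pi.single j 1) p)
      rw [dotR_single, norm_mul, norm_mul, Complex.norm_I, one_mul, Complex.norm_real,
        Real.norm_eq_abs] at e
      have hx : (1 : ℝ) ≤ 1 + ‖p.1‖ := one_le_one_add_norm p.1
      calc |p.2 j| * (‖p.2‖ ^ n * ‖oscJ c φ p‖) = ‖p.2‖ ^ n * (|p.2 j| * ‖oscJ c φ p‖) := by ring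
        _ ≤ ‖p.2‖ ^ n * (‖oscJ (_root_.dirD (0, Pi.single j 1, 0) c) φ p‖ +
            ‖oscJ c (derS (Pi.single j 1) φ) p‖) := by
          rw [e]; exact mul_le_mul_of_nonneg_left (norm_add_le _ _) (by positivity)
        _ ≤ C₁ j * (1 + ‖p.1‖) ^ M₁ + C₂ j * (1 + ‖p.1‖) ^ M₂ := by
          rw [mul_add]; exact add_le_add (hC₁ j p) (hC₂ j p)
        _ ≤ _ := by
          rw [add_mul]
          exact add_le_add
            (mul_le_mul_of_nonneg_left (pow_le_pow_right₀ hx (le_max_left _ _)) (hC₁0 j))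
            (mul_le_mul_of_nonneg_left (pow_le_pow_right₀ hx (le_max_right _ _)) (hC₂0 j))
    calc ‖p.2‖ ^ (n + 1) * ‖oscJ c φ p‖ = ‖p.2‖ * (‖p.2‖ ^ n * ‖oscJ c φ p‖) := by ring
      _ ≤ (∑ j, |p.2 j|) * (‖p.2‖ ^ n * ‖oscJ c φ p‖) :=
        mul_le_mul_of_nonneg_right (norm_le_sum_abs _) (by positivity)
      _ ≤ _ := by
        rw [Finset.sum_mul, Finset.sum_mul]
        exact Finset.sum_le_sum fun j _ => hj j

theorem Amp.exists_norm_oscJ_le (k : ℕ → ℕ) : ∃ M : ℕ,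
    ∀ c : (Fin d → ℝ) × (Fin d → ℝ) × (Fin d → ℝ) → ℂ, Amp k c →
    ∀ φ : SchwartzMap (Fin d → ℝ) ℂ, ∃ C : ℝ, 0 ≤ C ∧
    ∀ p, ‖oscJ c φ p‖ ≤ C * (1 + ‖p.1‖) ^ M * ((1 + ‖p.2‖) ^ (d + 1))⁻¹ := by
  obtain ⟨M₁, h₁⟩ := Amp.exists_norm_pow_mul_oscJ_le (d := d) 0 k
  obtain ⟨M₂, h₂⟩ := Amp.exists_norm_pow_mul_oscJ_le (d := d) (d + 1) k
  refine ⟨max M₁ M₂, fun c hc φ => ?_⟩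
  obtain ⟨C₁, hC₁0, hC₁⟩ := h₁ c hc φ
  obtain ⟨C₂, hC₂0, hC₂⟩ := h₂ c hc φ
  refine ⟨2 ^ (d + 1) * (C₁ + C₂), by positivity, fun p => ?_⟩
  rw [← div_eq_mul_inv, le_div_iff₀ (by positivity)]
  have hx : (1 : ℝ) ≤ 1 + ‖p.1‖ := one_le_one_add_norm p.1
  have e1 := (hC₁ p).trans
    (mul_le_mul_of_nonneg_left (pow_le_pow_right₀ hx (le_max_left M₁ M₂)) hC₁0)
  have e2 := (hC₂ p).trans
    (mul_le_mul_of_nonneg_left (pow_le_pow_right₀ hx (le_max_right M₁ M₂)) hC₂0)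
  rw [pow_zero, one_mul] at e1
  calc ‖oscJ c φ p‖ * (1 + ‖p.2‖) ^ (d + 1)
      ≤ ‖oscJ c φ p‖ * (2 ^ (d + 1) * (1 + ‖p.2‖ ^ (d + 1))) :=
        mul_le_mul_of_nonneg_left (one_add_pow_le (norm_nonneg _) _) (norm_nonneg _)
    _ = 2 ^ (d + 1) * (‖oscJ c φ p‖ + ‖p.2‖ ^ (d + 1) * ‖oscJ c φ p‖) := by ring
    _ ≤ 2 ^ (d + 1) * (C₁ * (1 + ‖p.1‖) ^ max M₁ M₂ + C₂ * (1 + ‖p.1‖) ^ max M₁ M₂) :=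
        mul_le_mul_of_nonneg_left (add_le_add e1 e2) (by positivity)
    _ = _ := by ring

theorem Amp.locDom_oscJ (hc : Amp k c) (φ : SchwartzMap (Fin d → ℝ) ℂ) :
    LocDom volume (oscJ c φ) := by
  obtain ⟨M, hM⟩ := Amp.exists_norm_oscJ_le (d := d) k
  obtain ⟨C, hC0, hC⟩ := hM c hc φ
  intro p₀
  refine ⟨fun y => C * (2 + ‖p₀‖) ^ M * ((1 + ‖y‖) ^ (d + 1))⁻¹,
    integrable_one_add_norm_pow_inv.const_mul _, fun p hp => Filter.Eventually.of_forall fun y => ?_⟩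
  refine (hC (p, y)).trans (mul_le_mul_of_nonneg_right (mul_le_mul_of_nonneg_left ?_ hC0)
    (by positivity))
  refine pow_le_pow_left₀ (by positivity) ?_ _
  have h2 : ‖p‖ ≤ ‖p₀‖ + ‖p - p₀‖ := by simpa using norm_add_le p₀ (p - p₀)
  have h3 : ‖p - p₀‖ < 1 := by rwa [← dist_eq_norm]
  simp only
  linarith

theorem Amp.integrable_oscJ (hc : Amp k c) (φ : SchwartzMap (Fin d → ℝ) ℂ) (x : Fin d → ℝ) :
    Integrable (fun ξ => oscJ c φ (x, ξ)) :=
  (hc.locDom_oscJ φ).integrable (hc.oscJ_diff φ).1.continuous x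

/-- The oscillatory integral operator with amplitude `c`. -/
def opT (c : (Fin d → ℝ) × (Fin d → ℝ) × (Fin d → ℝ) → ℂ) (φ : (Fin d → ℝ) → ℂ)
    (x : Fin d → ℝ) : ℂ := ∫ ξ, oscJ c φ (x, ξ)

theorem Amp.opT_diff (hc : Amp k c) (φ : SchwartzMap (Fin d → ℝ) ℂ) :
    ContDiff ℝ 1 (opT c φ) ∧ ∀ v : Fin d → ℝ, _root_.dirD v (opT c φ) =
      fun x => opT (_root_.dirD (v, v, 0) c) φ x + opT c (derS v φ) x := by
  have h1 := hc.oscJ_diff φ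
  have h0 := hc.locDom_oscJ φ
  have e : ∀ (v : Fin d → ℝ) p, fderiv ℝ (oscJ c φ) p (v, 0) =
      oscJ (_root_.dirD (v, v, 0) c) φ p + oscJ c (derS v φ) p := by
    intro v p
    simpa [dotR] using h1.2 v 0 p
  have h2 : ∀ v : Fin d → ℝ, LocDom volume (fun z => fderiv ℝ (oscJ c φ) z (v, 0)) := by
    intro v
    simp only [e]
    exact ((hc.dirD (v, v, 0)).locDom_oscJ φ).add (hc.locDom_oscJ (derS v φ))
  refine ⟨LocDom.contDiff_integral h1.1 h0 h2, fun v => funext fun x => ?_⟩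
  refine ((LocDom.hasFDerivAt_integral h1.1 h0 h2 x).2 v).trans ?_
  simp only [e]
  exact integral_add ((hc.dirD (v, v, 0)).integrable_oscJ φ x) (hc.integrable_oscJ (derS v φ) x)

theorem Amp.coord_mul_opT (hc : Amp k c) (φ : SchwartzMap (Fin d → ℝ) ℂ) (j : Fin d)
    (x : Fin d → ℝ) :
    (x j : ℂ) * opT c φ x =
      opT c (posMul j φ) x + I * opT (_root_.dirD (0, 0, Pi.single j 1) c) φ x := by
  have h1 := hc.oscJ_diff φ
  have hi0 := hc.integrable_oscJ φ x
  have hi1 := hc.integrable_oscJ (posMul j φ) x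
  have hi2 := (hc.dirD_xi (Pi.single j 1)).integrable_oscJ φ x
  let g : (Fin d → ℝ) → ℂ := fun ξ => oscJ c φ (x, ξ)
  have hd : ∀ ξ, HasFDerivAt g
      ((fderiv ℝ (oscJ c φ) (x, ξ)).comp (ContinuousLinearMap.inr ℝ (Fin d → ℝ) (Fin d → ℝ))) ξ :=
    fun ξ => HasFDerivAt.comp (f := fun ξ : Fin d → ℝ => (x, ξ)) ξ
      (h1.1.differentiable (by simp) (x, ξ)).hasFDerivAt (hasFDerivAt_prodMk_right x ξ)
  have e : ∀ ξ, fderiv ℝ g ξ (Pi.single j 1) = (I * (x j : ℂ)) * oscJ c φ (x, ξ) +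
      (-I) * oscJ c (posMul j φ) (x, ξ) + oscJ (_root_.dirD (0, 0, Pi.single j 1) c) φ (x, ξ) := by
    intro ξ
    rw [(hd ξ).fderiv]
    refine (h1.2 0 (Pi.single j 1) (x, ξ)).trans ?_
    have h3 : oscJ c (derS 0 φ) (x, ξ) = 0 := by
      simp [oscJ, osc, derS_apply, _root_.dirD]
    rw [h3, single_dotR, Finset.sum_eq_single j (by
      intro b _ hb
      simp [hb]) (by simp)]
    simp
    ring
  have hi := ((hi0.const_mul (I * (x j : ℂ))).add (hi1.const_mul (-I))).add hi2
  have h := integral_fderiv_eq_zero_of_integrable (v := Pi.single j 1)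
    (fun ξ => (hd ξ).differentiableAt) hi0 (by simp only [e]; exact hi)
  simp only [e] at h
  rw [integral_add (by exact (hi0.const_mul _).add (hi1.const_mul _)) hi2,
    integral_add (hi0.const_mul _) (hi1.const_mul _), integral_const_mul, integral_const_mul] at h
  simp only [opT]
  linear_combination (-I) * h +
    ((x j : ℂ) * (∫ ξ, oscJ c φ (x, ξ)) - ∫ ξ, oscJ c (posMul j φ) (x, ξ)) * Complex.I_sq

theorem Amp.exists_norm_pow_mul_opT_le (k : ℕ → ℕ) : ∃ M : ℕ, ∀ n : ℕ,
    ∀ c : (Fin d → ℝ) × (Fin d → ℝ) × (Fin d → ℝ) → ℂ, Amp k c →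
    ∀ φ : SchwartzMap (Fin d → ℝ) ℂ, ∃ C : ℝ, 0 ≤ C ∧
    ∀ x, ‖x‖ ^ n * ‖opT c φ x‖ ≤ C * (1 + ‖x‖) ^ M := by
  obtain ⟨M, hM⟩ := Amp.exists_norm_oscJ_le (d := d) k
  refine ⟨M, fun n => ?_⟩
  induction n with
  | zero =>
    intro c hc φ
    obtain ⟨C, hC0, hC⟩ := hM c hc φ
    have hi : Integrable (fun y : Fin d → ℝ => ((1 + ‖y‖) ^ (d + 1))⁻¹) :=
      integrable_one_add_norm_pow_inv
    have hK : 0 ≤ ∫ y : Fin d → ℝ, ((1 + ‖y‖) ^ (d + 1))⁻¹ := integral_nonneg fun y => by positivity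
    refine ⟨C * ∫ y : Fin d → ℝ, ((1 + ‖y‖) ^ (d + 1))⁻¹, by positivity, fun x => ?_⟩
    rw [pow_zero, one_mul]
    refine (norm_integral_le_of_norm_le (hi.const_mul (C * (1 + ‖x‖) ^ M))
      (Filter.Eventually.of_forall fun y => hC (x, y))).trans (le_of_eq ?_)
    rw [integral_const_mul]
    ring
  | succ n ih =>
    intro c hc φ
    choose C₁ hC₁0 hC₁ using fun j : Fin d => ih _ (hc.dirD_xi (Pi.single j 1)) φ
    choose C₂ hC₂0 hC₂ using fun j : Fin d => ih _ hc (posMul j φ)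
    refine ⟨∑ j, (C₁ j + C₂ j), Finset.sum_nonneg fun j _ => add_nonneg (hC₁0 j) (hC₂0 j),
      fun x => ?_⟩
    have hj : ∀ j, |x j| * (‖x‖ ^ n * ‖opT c φ x‖) ≤ (C₁ j + C₂ j) * (1 + ‖x‖) ^ M := by
      intro j
      have e := congrArg norm (hc.coord_mul_opT φ j x)
      rw [norm_mul, Complex.norm_real, Real.norm_eq_abs] at e
      have e2 := norm_add_le (opT c (posMul j φ) x)
        (I * opT (_root_.dirD (0, 0, Pi.single j 1) c) φ x)
      rw [norm_mul, Complex.norm_I, one_mul] at e2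
      calc |x j| * (‖x‖ ^ n * ‖opT c φ x‖) = ‖x‖ ^ n * (|x j| * ‖opT c φ x‖) := by ring
        _ ≤ ‖x‖ ^ n * (‖opT c (posMul j φ) x‖ +
            ‖opT (_root_.dirD (0, 0, Pi.single j 1) c) φ x‖) := by
          rw [e]; exact mul_le_mul_of_nonneg_left e2 (by positivity)
        _ ≤ _ := by
          rw [mul_add, add_comm (C₁ j), add_mul]
          exact add_le_add (hC₂ j x) (hC₁ j x)
    calc ‖x‖ ^ (n + 1) * ‖opT c φ x‖ = ‖x‖ * (‖x‖ ^ n * ‖opT c φ x‖) := by ring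
      _ ≤ (∑ j, |x j|) * (‖x‖ ^ n * ‖opT c φ x‖) :=
        mul_le_mul_of_nonneg_right (norm_le_sum_abs _) (by positivity)
      _ ≤ _ := by
        rw [Finset.sum_mul, Finset.sum_mul]
        exact Finset.sum_le_sum fun j _ => hj j

theorem Amp.exists_norm_opT_le (hc : Amp k c) (φ : SchwartzMap (Fin d → ℝ) ℂ) (n : ℕ) :
    ∃ C : ℝ, ∀ x, ‖opT c φ x‖ ≤ C * ((1 + ‖x‖) ^ n)⁻¹ := by
  obtain ⟨M, hM⟩ := Amp.exists_norm_pow_mul_opT_le (d := d) k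
  obtain ⟨C₁, hC₁0, hC₁⟩ := hM 0 c hc φ
  obtain ⟨C₂, hC₂0, hC₂⟩ := hM (n + M) c hc φ
  refine ⟨2 ^ (n + M) * (C₁ + C₂), fun x => ?_⟩
  rw [← div_eq_mul_inv, le_div_iff₀ (by positivity)]
  have h1 := hC₁ x
  rw [pow_zero, one_mul] at h1
  refine le_of_mul_le_mul_right ?_ (by positivity : 0 < (1 + ‖x‖) ^ M)
  calc ‖opT c φ x‖ * (1 + ‖x‖) ^ n * (1 + ‖x‖) ^ M = ‖opT c φ x‖ * (1 + ‖x‖) ^ (n + M) := by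
        rw [pow_add]; ring
    _ ≤ ‖opT c φ x‖ * (2 ^ (n + M) * (1 + ‖x‖ ^ (n + M))) :=
        mul_le_mul_of_nonneg_left (one_add_pow_le (norm_nonneg _) _) (norm_nonneg _)
    _ = 2 ^ (n + M) * (‖opT c φ x‖ + ‖x‖ ^ (n + M) * ‖opT c φ x‖) := by ring
    _ ≤ 2 ^ (n + M) * (C₁ * (1 + ‖x‖) ^ M + C₂ * (1 + ‖x‖) ^ M) :=
        mul_le_mul_of_nonneg_left (add_le_add h1 (hC₂ x)) (by positivity)
    _ = _ := by ring

theorem Amp.contDiff_opT (hc : Amp k c) (φ : SchwartzMap (Fin d → ℝ) ℂ) :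
    ContDiff ℝ ∞ (opT c φ) := by
  refine contDiff_infty.2 fun n => ?_
  induction n generalizing k c φ with
  | zero => exact contDiff_zero.2 (hc.opT_diff φ).1.continuous
  | succ n ih =>
    refine (contDiff_succ_iff_fderiv_apply (n := (n : WithTop ℕ∞))).2
      ⟨(hc.opT_diff φ).1.differentiable (by simp), by simp, fun v => ?_⟩
    have e : (fun p => fderiv ℝ (opT c φ) p v) = _ := (hc.opT_diff φ).2 v
    rw [e]
    exact (ih (hc.dirD _) φ).add (ih hc _)

theorem Amp.symB_opT (hc : Amp k c) (φ : SchwartzMap (Fin d → ℝ) ℂ) (l n : ℕ) :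
    SymB (fun (_ : Unit) (x : Fin d → ℝ) => ((1 + ‖x‖) ^ l)⁻¹) n (fun _ => opT c φ) := by
  have h0 : ∀ {k : ℕ → ℕ} {c : (Fin d → ℝ) × (Fin d → ℝ) × (Fin d → ℝ) → ℂ} (_ : Amp k c)
      (φ : SchwartzMap (Fin d → ℝ) ℂ),
      ∃ C : ℝ, ∀ (_ : Unit) x, ‖opT c φ x‖ ≤ C * ((1 + ‖x‖) ^ l)⁻¹ := fun hc φ => by
    obtain ⟨C, hC⟩ := hc.exists_norm_opT_le φ l
    exact ⟨C, fun _ => hC⟩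
  induction n generalizing k c φ with
  | zero => exact h0 hc φ
  | succ n ih =>
    refine ⟨h0 hc φ, fun v => ?_⟩
    change SymB _ n (fun _ => _root_.dirD v (opT c φ))
    rw [(hc.opT_diff φ).2 v]
    exact (ih (hc.dirD _) φ).add (fun _ => (hc.dirD _).contDiff_opT φ)
      (fun _ => hc.contDiff_opT _) (ih hc _)

theorem SymB.norm_iteratedFDeriv_le {E : Type*} [NormedAddCommGroup E] [NormedSpace ℝ E]
    [FiniteDimensional ℝ E] {m : E → ℝ} {n : ℕ} {f : E → ℂ} (hf : ContDiff ℝ ∞ f)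
    (h : SymB (fun (_ : Unit) => m) n (fun _ => f)) :
    ∃ C : ℝ, ∀ x, ‖iteratedFDeriv ℝ n f x‖ ≤ C * m x := by
  induction n generalizing f with
  | zero =>
    obtain ⟨C, hC⟩ := h
    exact ⟨C, fun x => by simpa using hC () x⟩
  | succ n ih =>
    let b := Module.finBasis ℝ E
    let l : Fin (Module.finrank ℝ E) → ℂ →L[ℝ] E →L[ℝ] ℂ := fun i =>
      ContinuousLinearMap.smulRightL ℝ E ℂ (LinearMap.toContinuousLinearMap (b.coord i))
    choose C hC using fun i => ih (hf.dirD (b i)) (h.2 (b i))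
    refine ⟨∑ i, ‖l i‖ * C i, fun x => ?_⟩
    have e : fderiv ℝ f = fun x => ∑ i, l i (_root_.dirD (b i) f x) := by
      funext x
      ext v
      have h1 : fderiv ℝ f x v = fderiv ℝ f x (∑ i, b.repr v i • b i) := by rw [b.sum_repr]
      rw [h1, map_sum]
      simp [l, _root_.dirD]
    have hs : ∀ i, ContDiff ℝ ∞ (fun x => l i (_root_.dirD (b i) f x)) := fun i =>
      (l i).contDiff.comp (hf.dirD (b i))
    rw [← norm_iteratedFDeriv_fderiv, e, iteratedFDeriv_fun_sum_apply
      fun i _ => ((hs i).of_le (by exact_mod_cast le_top)).contDiffAt]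
    refine (norm_sum_le _ _).trans ?_
    rw [Finset.sum_mul]
    refine Finset.sum_le_sum fun i _ => ?_
    rw [mul_assoc]
    exact ((l i).norm_iteratedFDeriv_comp_left (f := _root_.dirD (b i) f) (hf.dirD (b i)).contDiffAt
      (by exact_mod_cast le_top)).trans (mul_le_mul_of_nonneg_left (hC i x) (norm_nonneg _))

/-- The oscillatory integral operator maps Schwartz functions to Schwartz functions. -/
def Amp.opS (hc : Amp k c) (φ : SchwartzMap (Fin d → ℝ) ℂ) : SchwartzMap (Fin d → ℝ) ℂ where
  toFun := opT c φ
  smooth' := hc.contDiff_opT φ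
  decay' := by
    intro l n
    obtain ⟨C, hC⟩ := (hc.symB_opT φ l n).norm_iteratedFDeriv_le (hc.contDiff_opT φ)
    refine ⟨|C|, fun x => ?_⟩
    have h1 : ‖x‖ ^ l ≤ (1 + ‖x‖) ^ l :=
      pow_le_pow_left₀ (norm_nonneg x) (by linarith [norm_nonneg x]) l
    calc ‖x‖ ^ l * ‖iteratedFDeriv ℝ n (opT c φ) x‖
        ≤ (1 + ‖x‖) ^ l * (|C| * ((1 + ‖x‖) ^ l)⁻¹) :=
          mul_le_mul h1 ((hC x).trans (mul_le_mul_of_nonneg_right (le_abs_self C) (by positivity)))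
            (norm_nonneg _) (by positivity)
      _ = |C| := by field_simp

theorem Amp.opS_apply (hc : Amp k c) (φ : SchwartzMap (Fin d → ℝ) ℂ) (x : Fin d → ℝ) :
    hc.opS φ x = opT c φ x := rfl

/-- The oscillatory integral operator as a linear map on Schwartz space. -/
def Amp.opL (hc : Amp k c) : SchwartzMap (Fin d → ℝ) ℂ →ₗ[ℂ] SchwartzMap (Fin d → ℝ) ℂ where
  toFun := hc.opS
  map_add' φ ψ := by
    ext x
    have h1 : ∀ p, oscJ c (φ + ψ : SchwartzMap (Fin d → ℝ) ℂ) p = oscJ c φ p + oscJ c ψ p := by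
      intro p
      rw [oscJ, oscJ, oscJ, ← integral_add (hc.integrable_osc φ p) (hc.integrable_osc ψ p)]
      congr 1
      funext y
      simp only [osc, add_apply]
      ring
    simp only [add_apply, hc.opS_apply, opT, h1]
    exact integral_add (hc.integrable_oscJ φ x) (hc.integrable_oscJ ψ x)
  map_smul' r φ := by
    ext x
    have h1 : ∀ p, oscJ c (r • φ : SchwartzMap (Fin d → ℝ) ℂ) p = r * oscJ c φ p := by
      intro p
      rw [oscJ, oscJ, ← integral_const_mul]
      congr 1
      funext y
      simp only [osc, smul_apply, smul_eq_mul]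
      ring
    simp only [smul_apply, hc.opS_apply, opT, h1, RingHom.id_apply, smul_eq_mul]
    exact integral_const_mul _ _

end OscillatoryOperator

section Commutator

variable {d : ℕ} {k k' : ℕ → ℕ} {c c' : (Fin d → ℝ) × (Fin d → ℝ) × (Fin d → ℝ) → ℂ}

theorem Amp.oscJ_add (hc : Amp k c) (hc' : Amp k' c') (φ : SchwartzMap (Fin d → ℝ) ℂ)
    (p : (Fin d → ℝ) × (Fin d → ℝ)) :
    oscJ (fun q => c q + c' q) φ p = oscJ c φ p + oscJ c' φ p := by
  rw [oscJ, oscJ, oscJ, ← integral_add (hc.integrable_osc φ p) (hc'.integrable_osc φ p)]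
  congr 1
  funext y
  simp only [osc]
  ring

theorem oscJ_const_mul (r : ℂ) (c : (Fin d → ℝ) × (Fin d → ℝ) × (Fin d → ℝ) → ℂ)
    (φ : (Fin d → ℝ) → ℂ) (p : (Fin d → ℝ) × (Fin d → ℝ)) :
    oscJ (fun q => r * c q) φ p = r * oscJ c φ p := by
  rw [oscJ, oscJ, ← integral_const_mul]
  congr 1
  funext y
  simp only [osc]
  ring

theorem Amp.oscJ_sum {ι : Type*} (s : Finset ι) {c : ι → (Fin d → ℝ) × (Fin d → ℝ) × (Fin d → ℝ) → ℂ}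
    (hc : ∀ i, Amp k (c i)) (φ : SchwartzMap (Fin d → ℝ) ℂ) (p : (Fin d → ℝ) × (Fin d → ℝ)) :
    oscJ (fun q => ∑ i ∈ s, c i q) φ p = ∑ i ∈ s, oscJ (c i) φ p := by
  simp only [oscJ]
  rw [← integral_finsetSum _ fun i _ => (hc i).integrable_osc φ p]
  congr 1
  funext y
  simp only [osc, Finset.sum_mul, Finset.mul_sum]

theorem Amp.opT_add (hc : Amp k c) (hc' : Amp k' c') (φ : SchwartzMap (Fin d → ℝ) ℂ)
    (x : Fin d → ℝ) :
    opT (fun q => c q + c' q) φ x = opT c φ x + opT c' φ x := by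
  simp only [opT, hc.oscJ_add hc']
  exact integral_add (hc.integrable_oscJ φ x) (hc'.integrable_oscJ φ x)

theorem opT_const_mul (r : ℂ) (c : (Fin d → ℝ) × (Fin d → ℝ) × (Fin d → ℝ) → ℂ)
    (φ : (Fin d → ℝ) → ℂ) (x : Fin d → ℝ) :
    opT (fun q => r * c q) φ x = r * opT c φ x := by
  simp only [opT, oscJ_const_mul]
  exact integral_const_mul _ _

theorem Amp.opT_sum {ι : Type*} (s : Finset ι) {c : ι → (Fin d → ℝ) × (Fin d → ℝ) × (Fin d → ℝ) → ℂ}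
    (hc : ∀ i, Amp k (c i)) (φ : SchwartzMap (Fin d → ℝ) ℂ) (x : Fin d → ℝ) :
    opT (fun q => ∑ i ∈ s, c i q) φ x = ∑ i ∈ s, opT (c i) φ x := by
  simp only [opT, Amp.oscJ_sum s hc]
  exact integral_finsetSum _ fun i _ => (hc i).integrable_oscJ φ x

theorem Amp.oscJ_diffCoord (hc : Amp k c) (φ : SchwartzMap (Fin d → ℝ) ℂ) (j : Fin d)
    (p : (Fin d → ℝ) × (Fin d → ℝ)) :
    oscJ (fun q => diffCoord j (q.1, q.2.1) * c q) φ p =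
      oscJ c (posMul j φ) p - (p.1 j : ℂ) * oscJ c φ p := by
  rw [oscJ, oscJ, oscJ, ← integral_const_mul,
    ← integral_sub (hc.integrable_osc _ p) ((hc.integrable_osc φ p).const_mul _)]
  congr 1
  funext y
  simp only [osc, diffCoord_apply, posMul_apply, Complex.ofReal_sub]
  ring

theorem Amp.opT_diffCoord (hc : Amp k c) (φ : SchwartzMap (Fin d → ℝ) ℂ) (j : Fin d)
    (x : Fin d → ℝ) :
    opT (fun q => diffCoord j (q.1, q.2.1) * c q) φ x =
      -I * opT (_root_.dirD (0, 0, Pi.single j 1) c) φ x := by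
  have h : opT (fun q => diffCoord j (q.1, q.2.1) * c q) φ x =
      opT c (posMul j φ) x - (x j : ℂ) * opT c φ x := by
    simp only [opT, hc.oscJ_diffCoord]
    rw [integral_sub (hc.integrable_oscJ _ x) ((hc.integrable_oscJ φ x).const_mul _),
      integral_const_mul]
  rw [h, hc.coord_mul_opT φ j x]
  ring

variable {A : (Fin d → ℝ) → (Fin d → ℝ)}

/-- The magnetic phase as a function on pairs of points. -/
def phase (A : (Fin d → ℝ) → (Fin d → ℝ)) (p : (Fin d → ℝ) × (Fin d → ℝ)) : ℂ :=
  cexp (-I * circ A p)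

theorem norm_phase (A : (Fin d → ℝ) → (Fin d → ℝ)) (p : (Fin d → ℝ) × (Fin d → ℝ)) :
    ‖phase A p‖ = 1 := by
  rw [phase, Complex.norm_exp]
  simp [circ_im]

theorem phase_tempG (hA : Function.HasTemperateGrowth A) : TempG (phase A) :=
  PolyB.exp' (fun _ p => one_le_one_add_norm p) (fun _ p => by simp [circ_im])
    (PolyB.const_mul (-I) (circ_tempG hA))

/-- The amplitude of the magnetic operator with reduced amplitude `a`. -/
def magAmp (A : (Fin d → ℝ) → (Fin d → ℝ)) (a : (Fin d → ℝ) × (Fin d → ℝ) × (Fin d → ℝ) → ℂ)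
    (q : (Fin d → ℝ) × (Fin d → ℝ) × (Fin d → ℝ)) : ℂ := phase A (q.1, q.2.1) * a q

theorem exists_amp_magAmp (hA : Function.HasTemperateGrowth A) :
    ∃ k, ∀ {a : (Fin d → ℝ) × (Fin d → ℝ) × (Fin d → ℝ) → ℂ}, BddG a → Amp k (magAmp A a) :=
  Amp.exists_of_mul (phase_tempG hA)

/-- The projection `(x, y, ξ) ↦ (x, y)`. -/
def projXY : (Fin d → ℝ) × (Fin d → ℝ) × (Fin d → ℝ) →L[ℝ] (Fin d → ℝ) × (Fin d → ℝ) :=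
  (ContinuousLinearMap.fst ℝ _ _).prod
    ((ContinuousLinearMap.fst ℝ _ _).comp (ContinuousLinearMap.snd ℝ _ _))

theorem dirD_phase (hA : ContDiff ℝ ∞ A) (v : (Fin d → ℝ) × (Fin d → ℝ)) :
    dirD v (phase A) = fun p => -I * (∑ j, (v.2 j : ℂ) * potC A j p.2 -
      ∑ j, (v.1 j : ℂ) * potC A j p.1 + fluxForm A v p) * phase A p := by
  have h := dirD_exp (contDiff_const.mul (contDiff_circ hA) : ContDiff ℝ ∞ fun p => -I * circ A p) v
  rw [dirD_const_mul (contDiff_circ hA), dirD_circ hA] at h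
  exact h

theorem dirD_magAmp (hA : Function.HasTemperateGrowth A)
    {a : (Fin d → ℝ) × (Fin d → ℝ) × (Fin d → ℝ) → ℂ} (ha : ContDiff ℝ ∞ a)
    (v : (Fin d → ℝ) × (Fin d → ℝ) × (Fin d → ℝ)) :
    dirD v (magAmp A a) = fun q => dirD (v.1, v.2.1) (phase A) (q.1, q.2.1) * a q +
      magAmp A (dirD v a) q := by
  have hp := TempG.smooth (phase_tempG hA)
  have h1 := dirD_comp_affine hp (projXY (d := d)) 0 v
  simp only [add_zero] at h1
  have h2 : ContDiff ℝ ∞ (fun q => phase A (projXY (d := d) q)) := hp.comp projXY.contDiff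
  have h3 := dirD_mul h2 ha v
  rw [h1] at h3
  exact h3

theorem dirD_xi_magAmp (hA : Function.HasTemperateGrowth A)
    {a : (Fin d → ℝ) × (Fin d → ℝ) × (Fin d → ℝ) → ℂ} (ha : ContDiff ℝ ∞ a) (η : Fin d → ℝ) :
    dirD (0, 0, η) (magAmp A a) = magAmp A (dirD (0, 0, η) a) := by
  rw [dirD_magAmp hA ha]
  funext q
  have : dirD ((0 : Fin d → ℝ), (0 : Fin d → ℝ)) (phase A) (q.1, q.2.1) = 0 := by
    rw [dirD]
    exact map_zero _
  simp [this]

/-- The averaged field strength entering the commutator with the `j`-th magnetic momentum. -/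
def fieldAvg (A : (Fin d → ℝ) → (Fin d → ℝ)) (j l : Fin d)
    (q : (Fin d → ℝ) × (Fin d → ℝ) × (Fin d → ℝ)) : ℂ :=
  lineInt (fun t => 1 - (t : ℂ)) (fieldC A j l) (q.1, q.2.1) +
    lineInt (fun t => (t : ℂ)) (fieldC A j l) (q.1, q.2.1)

theorem fluxForm_single (A : (Fin d → ℝ) → (Fin d → ℝ)) (j : Fin d)
    (q : (Fin d → ℝ) × (Fin d → ℝ) × (Fin d → ℝ)) :
    fluxForm A (Pi.single j 1, Pi.single j 1) (q.1, q.2.1) =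
      ∑ l, diffCoord l (q.1, q.2.1) * fieldAvg A j l q := by
  rw [fluxForm, Finset.sum_eq_single j (fun b _ hb => by simp [hb]) (by simp)]
  simp [diffCoord_apply, fieldAvg]

theorem fieldAvg_bddG (hA : ContDiff ℝ ∞ A) (hB : BBounded (Bof A)) (j l : Fin d) :
    BddG (fieldAvg A j l) := by
  have h := fieldC_bddG hA hB j l
  have h1 : BddG (lineInt (fun t => 1 - (t : ℂ)) (fieldC A j l)) :=
    BddG.lineInt (contDiff_const.sub Complex.ofRealCLM.contDiff) h
  have h2 : BddG (lineInt (fun t => (t : ℂ)) (fieldC A j l)) :=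
    BddG.lineInt Complex.ofRealCLM.contDiff h
  exact BddG.add (BddG.comp_linear h1 projXY) (BddG.comp_linear h2 projXY)

theorem dirD_single_magAmp (hA : Function.HasTemperateGrowth A)
    {a : (Fin d → ℝ) × (Fin d → ℝ) × (Fin d → ℝ) → ℂ} (ha : ContDiff ℝ ∞ a) (j : Fin d) :
    dirD (Pi.single j 1, Pi.single j 1, 0) (magAmp A a) = fun q =>
      -I * (potC A j q.2.1 - potC A j q.1) * magAmp A a q +
      (-I * (∑ l, diffCoord l (q.1, q.2.1) * magAmp A (fun q => fieldAvg A j l q * a q) q) +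
      magAmp A (dirD (Pi.single j 1, Pi.single j 1, 0) a) q) := by
  rw [dirD_magAmp hA ha]
  funext q
  rw [dirD_phase hA.1]
  simp only [fluxForm_single]
  have h : ∀ x, ∑ i, ((Pi.single j (1 : ℝ) : Fin d → ℝ) i : ℂ) * potC A i x = potC A j x := by
    intro x
    rw [Finset.sum_eq_single j (fun b _ hb => by simp [hb]) (by simp)]
    simp
  simp only [h, magAmp, mul_add, add_mul, Finset.mul_sum, Finset.sum_mul]
  rw [← add_assoc]
  congr 2
  · ring
  · refine Finset.sum_congr rfl fun l _ => ?_
    ring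

/-- The commutator with a coordinate multiplication. -/
theorem coord_mul_opT_sub (hA : Function.HasTemperateGrowth A)
    {a : (Fin d → ℝ) × (Fin d → ℝ) × (Fin d → ℝ) → ℂ} (ha : BddG a)
    (φ : SchwartzMap (Fin d → ℝ) ℂ) (j : Fin d) (x : Fin d → ℝ) :
    (x j : ℂ) * opT (magAmp A a) φ x - opT (magAmp A a) (posMul j φ) x =
      opT (magAmp A (fun q => I * dirD (0, 0, Pi.single j 1) a q)) φ x := by
  obtain ⟨k, hk⟩ := exists_amp_magAmp hA
  rw [(hk ha).coord_mul_opT φ j x, dirD_xi_magAmp hA ha.smooth, add_sub_cancel_left,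
    ← opT_const_mul]
  congr 1
  funext q
  simp only [magAmp]
  ring

/-- The reduced amplitude of the commutator with the `j`-th magnetic momentum. -/
def momAmp (A : (Fin d → ℝ) → (Fin d → ℝ)) (j : Fin d)
    (a : (Fin d → ℝ) × (Fin d → ℝ) × (Fin d → ℝ) → ℂ)
    (q : (Fin d → ℝ) × (Fin d → ℝ) × (Fin d → ℝ)) : ℂ :=
  I * (∑ l, dirD (0, 0, Pi.single l 1) (fun q => fieldAvg A j l q * a q) q) +
    -I * dirD (Pi.single j 1, Pi.single j 1, 0) a q

theorem momAmp_bddG (hA : ContDiff ℝ ∞ A) (hB : BBounded (Bof A)) (j : Fin d)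
    {a : (Fin d → ℝ) × (Fin d → ℝ) × (Fin d → ℝ) → ℂ} (ha : BddG a) : BddG (momAmp A j a) :=
  BddG.add (BddG.const_mul _ (BddG.sum _ fun l _ =>
    BddG.dirD (BddG.mul (fieldAvg_bddG hA hB j l) ha) _)) (BddG.const_mul _ (BddG.dirD ha _))

theorem integral_commutator_terms {X : Type*} [MeasurableSpace X] {μ : Measure X}
    {U V W : X → ℂ} {R S : Fin d → X → ℂ} (hU : Integrable U μ) (hV : Integrable V μ)
    (hW : Integrable W μ) (hR : ∀ l, Integrable (R l) μ) (hS : ∀ l, Integrable (S l) μ)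
    (r b : ℂ) (s : Fin d → ℂ) :
    ∫ y, (b * (U y - r * V y) + (b * ∑ l, (R l y - s l * S l y) + W y)) ∂μ =
      b * (∫ y, U y ∂μ - r * ∫ y, V y ∂μ) +
        (b * ∑ l, (∫ y, R l y ∂μ - s l * ∫ y, S l y ∂μ) + ∫ y, W y ∂μ) := by
  have i1 : Integrable (fun y => U y - r * V y) μ := hU.sub (hV.const_mul r)
  have i2 : ∀ l, Integrable (fun y => R l y - s l * S l y) μ :=
    fun l => (hR l).sub ((hS l).const_mul (s l))
  have i3 : Integrable (fun y => b * ∑ l, (R l y - s l * S l y)) μ :=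
    (integrable_finsetSum _ fun l _ => i2 l).const_mul b
  have i4 : Integrable (fun y => b * ∑ l, (R l y - s l * S l y) + W y) μ := i3.add hW
  rw [integral_add (i1.const_mul b) i4, integral_add i3 hW, integral_const_mul,
    integral_const_mul, integral_sub hU (hV.const_mul r), integral_const_mul,
    integral_finsetSum _ fun l _ => i2 l]
  congr 3
  refine Finset.sum_congr rfl fun l _ => ?_
  rw [integral_sub (hR l) ((hS l).const_mul (s l)), integral_const_mul]

/-- The commutator with a magnetic momentum; `χ` stands for `A_j φ`. -/
theorem momentum_opT_sub (hA : Function.HasTemperateGrowth A) (hB : BBounded (Bof A))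
    {a : (Fin d → ℝ) × (Fin d → ℝ) × (Fin d → ℝ) → ℂ} (ha : BddG a)
    (φ χ : SchwartzMap (Fin d → ℝ) ℂ) (j : Fin d) (hχ : ∀ y, χ y = (A y j : ℂ) * φ y)
    (x : Fin d → ℝ) :
    -I * opT (dirD (Pi.single j 1, Pi.single j 1, 0) (magAmp A a)) φ x -
      (A x j : ℂ) * opT (magAmp A a) φ x + opT (magAmp A a) χ x =
      opT (magAmp A (momAmp A j a)) φ x := by
  obtain ⟨k, hk⟩ := exists_amp_magAmp hA
  have hb : ∀ l, BddG (fun q => fieldAvg A j l q * a q) := fun l =>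
    BddG.mul (fieldAvg_bddG hA.1 hB j l) ha
  have ha' := BddG.dirD ha (Pi.single j 1, Pi.single j 1, 0)
  have h1 : ∀ p, oscJ (dirD (Pi.single j 1, Pi.single j 1, 0) (magAmp A a)) φ p =
      -I * (oscJ (magAmp A a) χ p - (A p.1 j : ℂ) * oscJ (magAmp A a) φ p) +
      (-I * (∑ l, (oscJ (magAmp A fun q => fieldAvg A j l q * a q) (posMul l φ) p -
        (p.1 l : ℂ) * oscJ (magAmp A fun q => fieldAvg A j l q * a q) φ p)) +
      oscJ (magAmp A (dirD (Pi.single j 1, Pi.single j 1, 0) a)) φ p) := by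
    intro p
    refine Eq.trans ?_ (integral_commutator_terms ((hk ha).integrable_osc χ p)
      ((hk ha).integrable_osc φ p) ((hk ha').integrable_osc φ p)
      (fun l => (hk (hb l)).integrable_osc (posMul l φ) p)
      (fun l => (hk (hb l)).integrable_osc φ p) (A p.1 j : ℂ) (-I) (fun l => (p.1 l : ℂ)))
    rw [oscJ]
    congr 1
    funext y
    rw [dirD_single_magAmp hA ha.smooth]
    simp only [osc, posMul_apply, hχ, diffCoord_apply, potC,
      mul_add, Finset.mul_sum, Finset.sum_mul, add_mul, Complex.ofReal_sub]
    congr 1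
    · ring
    · congr 1
      refine Finset.sum_congr rfl fun l _ => ?_
      ring
  have h2 : opT (dirD (Pi.single j 1, Pi.single j 1, 0) (magAmp A a)) φ x =
      -I * (opT (magAmp A a) χ x - (A x j : ℂ) * opT (magAmp A a) φ x) +
      (-I * (∑ l, (opT (magAmp A fun q => fieldAvg A j l q * a q) (posMul l φ) x -
        (x l : ℂ) * opT (magAmp A fun q => fieldAvg A j l q * a q) φ x)) +
      opT (magAmp A (dirD (Pi.single j 1, Pi.single j 1, 0) a)) φ x) := by
    rw [opT]
    simp only [h1]
    exact integral_commutator_terms ((hk ha).integrable_oscJ χ x)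
      ((hk ha).integrable_oscJ φ x) ((hk ha').integrable_oscJ φ x)
      (fun l => (hk (hb l)).integrable_oscJ (posMul l φ) x)
      (fun l => (hk (hb l)).integrable_oscJ φ x) (A x j : ℂ) (-I) (fun l => (x l : ℂ))
  have h3 : ∀ l, opT (magAmp A fun q => fieldAvg A j l q * a q) (posMul l φ) x -
      (x l : ℂ) * opT (magAmp A fun q => fieldAvg A j l q * a q) φ x =
      -I * opT (magAmp A (dirD (0, 0, Pi.single l 1) fun q => fieldAvg A j l q * a q)) φ x := by
    intro l
    rw [(hk (hb l)).coord_mul_opT φ l x, dirD_xi_magAmp hA (hb l).smooth]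
    ring
  have h4 : opT (magAmp A (momAmp A j a)) φ x = I * (∑ l,
      opT (magAmp A (dirD (0, 0, Pi.single l 1) fun q => fieldAvg A j l q * a q)) φ x) +
      -I * opT (magAmp A (dirD (Pi.single j 1, Pi.single j 1, 0) a)) φ x := by
    rw [← Amp.opT_sum Finset.univ (fun l => hk (BddG.dirD (hb l) (0, 0, Pi.single l 1))),
      ← opT_const_mul, ← opT_const_mul]
    have hs : BddG fun q => I * ∑ l, dirD (0, 0, Pi.single l 1)
      (fun q => fieldAvg A j l q * a q) q :=
      BddG.const_mul _ (BddG.sum _ fun l _ => BddG.dirD (hb l) _)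
    have e := (hk hs).opT_add
      (hk (BddG.const_mul (-I) (BddG.dirD ha (Pi.single j 1, Pi.single j 1, 0)))) φ x
    refine Eq.trans ?_ (e.trans ?_)
    · congr 1
      funext q
      simp only [magAmp, momAmp]
      ring
    · congr 2 <;>
      · funext q
        simp only [magAmp, Finset.mul_sum]
        first
        | ring1
        | exact Finset.sum_congr rfl fun l _ => by ring
  rw [h2, h4]
  simp only [h3, ← Finset.mul_sum]
  linear_combination (opT (magAmp A a) χ x - (A x j : ℂ) * opT (magAmp A a) φ x -
    I * (∑ l, opT (magAmp A (dirD (0, 0, Pi.single l 1) fun q => fieldAvg A j l q * a q)) φ x)) * I_sq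

end Commutator

section MagneticOperators

variable {d : ℕ}

theorem HormClass.bddG {Φ : ((Fin d → ℝ) × (Fin d → ℝ)) → ℂ} (hΦ : HormClass d 0 Φ) : BddG Φ := by
  have hs : ContDiff ℝ ∞ Φ := hΦ.1
  let b := (Pi.basisFun ℝ (Fin d)).prod (Pi.basisFun ℝ (Fin d))
  have hb : ∀ L : List (Fin d ⊕ Fin d), ∃ l l' : List (Fin d),
      (L.map b).Perm (l.map dirX ++ l'.map dirXi) := by
    intro L
    induction L with
    | nil => exact ⟨[], [], by simp⟩
    | cons s L ih =>
      obtain ⟨l, l', h⟩ := ih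
      rcases s with j | j
      · refine ⟨j :: l, l', ?_⟩
        have e : b (Sum.inl j) = dirX j := by simp [b, dirX]
        simpa [e] using h
      · refine ⟨l, j :: l', ?_⟩
        have e : b (Sum.inr j) = dirXi j := by simp [b, dirXi]
        simp only [List.map_cons, e]
        exact (h.cons _).trans List.perm_middle.symm
  refine BddG.of_symB hs fun n => SymB.of_basis b (fun _ => hs) fun L => ?_
  obtain ⟨l, l', h⟩ := hb L
  obtain ⟨C, hC⟩ := hΦ.2 l l'
  refine ⟨C, fun _ p => ?_⟩
  rw [dList_perm hs h]
  simpa using hC p.1 p.2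

variable {A : (Fin d → ℝ) → (Fin d → ℝ)}

/-- The reduced amplitude `(2π)^{-d/2} Φ((x+y)/2, ξ)` of the magnetic Weyl quantization of `Φ`. -/
def weylAmp (Φ : ((Fin d → ℝ) × (Fin d → ℝ)) → ℂ)
    (q : (Fin d → ℝ) × (Fin d → ℝ) × (Fin d → ℝ)) : ℂ :=
  (((2 * Real.pi) ^ (-(d : ℝ) / 2) : ℝ) : ℂ) * Φ ((2:ℝ)⁻¹ • (q.1 + q.2.1), q.2.2)

theorem weylAmp_bddG {Φ : ((Fin d → ℝ) × (Fin d → ℝ)) → ℂ} (hΦ : BddG Φ) : BddG (weylAmp Φ) := by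
  let l : (Fin d → ℝ) × (Fin d → ℝ) × (Fin d → ℝ) →L[ℝ] (Fin d → ℝ) × (Fin d → ℝ) :=
    ContinuousLinearMap.prod ((2:ℝ)⁻¹ • (ContinuousLinearMap.fst ℝ _ _ +
      (ContinuousLinearMap.fst ℝ _ _).comp (ContinuousLinearMap.snd ℝ _ _)))
    ((ContinuousLinearMap.snd ℝ _ _).comp (ContinuousLinearMap.snd ℝ _ _))
  exact BddG.const_mul _ (BddG.comp_linear hΦ l)

theorem opInt_eq (hA : Continuous A) (Φ : ((Fin d → ℝ) × (Fin d → ℝ)) → ℂ) (φ : (Fin d → ℝ) → ℂ)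
    (x ξ : Fin d → ℝ) : opInt A Φ φ x ξ = oscJ (magAmp A (weylAmp Φ)) φ (x, ξ) := by
  rw [opInt, oscJ, ← integral_const_mul]
  congr 1
  funext y
  rw [magPhase_eq hA]
  simp only [osc, magAmp, weylAmp, wave, phase]
  ring

/-- Operators on Schwartz space given by a magnetic oscillatory integral with an amplitude all of
whose derivatives are bounded. -/
def IsMagOp (A : (Fin d → ℝ) → (Fin d → ℝ))
    (T : SchwartzMap (Fin d → ℝ) ℂ →ₗ[ℂ] SchwartzMap (Fin d → ℝ) ℂ) : Prop :=
  ∃ a : (Fin d → ℝ) × (Fin d → ℝ) × (Fin d → ℝ) → ℂ, BddG a ∧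
    ∀ φ x, T φ x = opT (magAmp A a) φ x

theorem IsMagOp.commL_position (hA : Function.HasTemperateGrowth A)
    {T Q : SchwartzMap (Fin d → ℝ) ℂ →ₗ[ℂ] SchwartzMap (Fin d → ℝ) ℂ} (hT : IsMagOp A T)
    {j : Fin d} (hQ : ∀ φ x, Q φ x = (x j : ℂ) * φ x) : IsMagOp A (commL Q T) := by
  obtain ⟨a, ha, h⟩ := hT
  refine ⟨_, BddG.const_mul I (BddG.dirD ha (0, 0, Pi.single j 1)), fun φ x => ?_⟩
  have e : Q φ = posMul j φ := by
    ext x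
    rw [hQ, posMul_apply]
  rw [← coord_mul_opT_sub hA ha φ j x, commL]
  simp only [LinearMap.sub_apply, LinearMap.comp_apply, sub_apply]
  rw [hQ, h, h, e]

theorem IsMagOp.commL_momentum (hA : Function.HasTemperateGrowth A) (hB : BBounded (Bof A))
    {T P : SchwartzMap (Fin d → ℝ) ℂ →ₗ[ℂ] SchwartzMap (Fin d → ℝ) ℂ} (hT : IsMagOp A T)
    {j : Fin d} (hP : ∀ φ : SchwartzMap (Fin d → ℝ) ℂ, ∀ x, P φ x =
      -Complex.I * fderiv ℝ (fun y => φ y) x (Pi.single j 1) - (A x j : ℝ) * φ x) :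
    IsMagOp A (commL P T) := by
  obtain ⟨a, ha, h⟩ := hT
  refine ⟨_, momAmp_bddG hA.1 hB j ha, fun φ x => ?_⟩
  obtain ⟨k, hk⟩ := exists_amp_magAmp hA
  let χ : SchwartzMap (Fin d → ℝ) ℂ := (-I) • derS (Pi.single j 1) φ - P φ
  have hχ : ∀ y, χ y = (A y j : ℂ) * φ y := by
    intro y
    simp only [χ, sub_apply, smul_apply, smul_eq_mul, derS_apply, hP, dirD]
    ring
  have e : P φ = (-I) • derS (Pi.single j 1) φ - χ := by simp [χ]
  rw [← momentum_opT_sub hA hB ha φ χ j hχ x, commL]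
  simp only [LinearMap.sub_apply, LinearMap.comp_apply, sub_apply]
  have hf : (fun y => T φ y) = opT (magAmp A a) φ := funext (h φ)
  have h1 := congrFun (((hk ha).opT_diff φ).2 (Pi.single j 1)) x
  rw [dirD] at h1
  rw [hP, hf, h1, e, map_sub, map_smul, sub_apply, smul_apply, h, h, h, smul_eq_mul]
  ring

theorem IsMagOp.iterComm (hA : Function.HasTemperateGrowth A) (hB : BBounded (Bof A))
    {T : SchwartzMap (Fin d → ℝ) ℂ →ₗ[ℂ] SchwartzMap (Fin d → ℝ) ℂ} (hT : IsMagOp A T)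
    {Q P : Fin d → (SchwartzMap (Fin d → ℝ) ℂ →ₗ[ℂ] SchwartzMap (Fin d → ℝ) ℂ)}
    (hQ : ∀ j : Fin d, ∀ φ : SchwartzMap (Fin d → ℝ) ℂ, ∀ x : Fin d → ℝ,
      Q j φ x = (x j : ℂ) * φ x)
    (hP : ∀ j : Fin d, ∀ φ : SchwartzMap (Fin d → ℝ) ℂ, ∀ x : Fin d → ℝ,
      P j φ x = -Complex.I * fderiv ℝ (fun y => φ y) x (Pi.single j 1) -
        (A x j : ℝ) * φ x)
    (Ls : List (SchwartzMap (Fin d → ℝ) ℂ →ₗ[ℂ] SchwartzMap (Fin d → ℝ) ℂ))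
    (hL : ∀ L ∈ Ls, (∃ j, L = Q j) ∨ (∃ j, L = P j)) : IsMagOp A (iterComm Ls T) := by
  induction Ls with
  | nil => exact hT
  | cons L Ls ih =>
    have h := ih fun L' h' => hL L' (List.mem_cons_of_mem _ h')
    rcases hL L List.mem_cons_self with ⟨j, rfl⟩ | ⟨j, rfl⟩
    · exact h.commL_position hA (hQ j)
    · exact h.commL_momentum hA hB (hP j)

end MagneticOperators

/-! ### Recovering a function from its mixed derivative -/

section FundamentalTheorem

theorem integrable_prod_inv_one_add_sq {n : ℕ} (c : Fin n → ℝ) :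
    Integrable fun x : Fin n → ℝ => ∏ j, (1 + (x j - c j) ^ 2)⁻¹ :=
  Integrable.fintype_prod fun j => (integrable_inv_one_add_sq.comp_sub_right (c j))

theorem ContDiff.hasDerivAt_line {E : Type*} [NormedAddCommGroup E] [NormedSpace ℝ E]
    {f : E → ℂ} (hf : ContDiff ℝ ∞ f) (v w : E) (t : ℝ) :
    HasDerivAt (fun s : ℝ => f (s • v + w)) (_root_.dirD v f (t • v + w)) t := by
  have h : HasDerivAt (fun s : ℝ => s • v + w) v t := by
    simpa using ((hasDerivAt_id t).smul_const v).add_const w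
  exact ((hf.diff_at _).hasFDerivAt.comp_hasDerivAt t h)

/-- A smooth function whose derivatives decay is the integral of its full mixed derivative
over the orthant below the point. -/
theorem eq_setIntegral_Iic_dList {n : ℕ} : ∀ {f : (Fin n → ℝ) → ℂ} (_ : ContDiff ℝ ∞ f)
    (c : Fin n → ℝ)
    (_ : ∀ L : List (Fin n → ℝ), L.length ≤ n →
      ∃ C : ℝ, ∀ X, ‖dList L f X‖ ≤ C * ∏ j, (1 + (X j - c j) ^ 2)⁻¹)
    (X : Fin n → ℝ),
    f X = ∫ X' in Set.Iic X, dList ((List.finRange n).map fun i => Pi.single i (1 : ℝ)) f X' := by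
  induction n with
  | zero =>
    intro f hf c h X
    have e : Set.Iic X = Set.univ := by
      ext Y; simp [Subsingleton.elim Y X]
    rw [e, Measure.restrict_univ, Measure.volume_pi_eq_dirac X, integral_dirac]
    rfl
  | succ n ih =>
    intro f hf c h X
    let l : (Fin n → ℝ) →L[ℝ] (Fin (n + 1) → ℝ) :=
      ContinuousLinearMap.pi (Fin.cons 0 fun i => ContinuousLinearMap.proj i)
    have hl : ∀ Y, l Y = Fin.cons 0 Y := by
      intro Y
      funext i
      refine Fin.cases ?_ (fun i => ?_) i <;> simp [l]
    have hcons : ∀ (t : ℝ) Y, (Fin.cons t Y : Fin (n + 1) → ℝ) = l Y + Fin.cons t 0 := by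
      intro t Y
      rw [hl]
      funext i
      refine Fin.cases ?_ (fun i => ?_) i <;> simp
    have hcons' : ∀ (t : ℝ) Y,
        (Fin.cons t Y : Fin (n + 1) → ℝ) = t • Pi.single 0 (1 : ℝ) + l Y := by
      intro t Y
      rw [hl]
      funext i
      refine Fin.cases ?_ (fun i => ?_) i <;> simp
    have hls : ∀ i : Fin n, l (Pi.single i 1) = Pi.single i.succ 1 := by
      intro i
      rw [hl]
      funext j
      refine Fin.cases ?_ (fun j => ?_) j
      · simp [(Fin.succ_ne_zero i).symm]
      · simp [Pi.single_apply]
    set G := dList ((List.finRange (n + 1)).map fun i => Pi.single i (1 : ℝ)) f with hG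
    have hGc : ContDiff ℝ ∞ G := hf.dList _
    obtain ⟨CG, hCG⟩ := h ((List.finRange (n + 1)).map fun i => Pi.single i (1 : ℝ)) (by simp)
    have hGi : Integrable G :=
      ((integrable_prod_inv_one_add_sq c).const_mul CG).mono' hGc.continuous.aestronglyMeasurable
        (.of_forall hCG)
    have hslice : ∀ t Y, dirD (Pi.single 0 1) f (Fin.cons t Y) =
        ∫ Y' in Set.Iic Y, G (Fin.cons t Y') := by
      intro t Y
      have hD := hf.dirD (Pi.single (0 : Fin (n + 1)) (1 : ℝ))
      have hg : ContDiff ℝ ∞ fun Y => dirD (Pi.single 0 1) f (l Y + Fin.cons t 0) :=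
        hD.comp (l.contDiff.add contDiff_const)
      have key := ih hg (fun i => c i.succ) (fun L hL => by
        obtain ⟨C, hC⟩ := h (L.map l ++ [Pi.single 0 1]) (by simpa using hL)
        refine ⟨C * (1 + (t - c 0) ^ 2)⁻¹, fun Y => ?_⟩
        rw [dList_comp_affine hD, ← dList_concat]
        beta_reduce
        rw [← hcons]
        refine (hC _).trans_eq ?_
        rw [Fin.prod_univ_succ]
        simp [mul_assoc]) Y
      rw [← hcons] at key
      rw [key, dList_comp_affine hD]
      congr 1
      funext Y'
      rw [← dList_concat]
      beta_reduce
      rw [← hcons, hG]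
      refine congrFun (dList_perm hf ?_) _
      rw [List.finRange_succ, List.map_cons, List.map_map, List.map_map]
      refine (List.perm_append_singleton _ _).trans (List.Perm.of_eq ?_)
      congr 1
      refine List.map_congr_left fun i _ => ?_
      simp [hls]
    obtain ⟨C0, hC0⟩ := h [] (by simp)
    obtain ⟨C1, hC1⟩ := h [Pi.single 0 1] (by simp)
    have hX : X = Fin.cons (X 0) (Fin.tail X) := (Fin.cons_self_tail X).symm
    have hline : f X = ∫ t in Set.Iic (X 0), dirD (Pi.single 0 1) f (Fin.cons t (Fin.tail X)) := by
      have hder : ∀ t ∈ Set.Iic (X 0), HasDerivAt (fun t => f (Fin.cons t (Fin.tail X)))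
          (dirD (Pi.single 0 1) f (Fin.cons t (Fin.tail X))) t := by
        intro t _
        simp only [hcons' _ (Fin.tail X)]
        exact hf.hasDerivAt_line _ _ t
      have hP : ∀ t, ∏ j, (1 + ((Fin.cons t (Fin.tail X) : Fin (n + 1) → ℝ) j - c j) ^ 2)⁻¹ =
          (1 + (t - c 0) ^ 2)⁻¹ * ∏ j : Fin n, (1 + (X j.succ - c j.succ) ^ 2)⁻¹ := by
        intro t
        rw [Fin.prod_univ_succ]
        rfl
      have hint : IntegrableOn (fun t => dirD (Pi.single 0 1) f (Fin.cons t (Fin.tail X)))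
          (Set.Iic (X 0)) := by
        refine Integrable.integrableOn (Integrable.mono' (((integrable_inv_one_add_sq.comp_sub_right
          (c 0)).mul_const (∏ j : Fin n, (1 + (X j.succ - c j.succ) ^ 2)⁻¹)).const_mul C1)
          ?_ (.of_forall fun t => (hC1 _).trans_eq (by rw [hP])))
        refine Continuous.aestronglyMeasurable ?_
        simp only [hcons' _ (Fin.tail X)]
        exact (hf.dirD _).continuous.comp (by fun_prop)
      have hlim : Filter.Tendsto (fun t => f (Fin.cons t (Fin.tail X))) Filter.atBot (𝓝 0) := by
        have hb : Filter.Tendsto (fun t : ℝ => C0 * ((1 + (t - c 0) ^ 2)⁻¹ *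
            ∏ j : Fin n, (1 + (X j.succ - c j.succ) ^ 2)⁻¹)) Filter.atBot (𝓝 0) := by
          have h1 : Filter.Tendsto (fun t : ℝ => 1 + (t - c 0) ^ 2) Filter.atBot Filter.atTop := by
            refine Filter.tendsto_atTop_add_const_left _ _ ?_
            have h2 : Filter.Tendsto (fun t : ℝ => t - c 0) Filter.atBot Filter.atBot :=
              Filter.tendsto_atBot_add_const_right _ (-c 0) Filter.tendsto_id
            simpa [sq] using h2.atBot_mul_atBot₀ h2
          simpa using (h1.inv_tendsto_atTop.mul_const _).const_mul C0
        refine squeeze_zero_norm (fun t => ?_) hb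
        rw [← hP]
        exact hC0 _
      rw [integral_Iic_of_hasDerivAt_of_tendsto' hder hint hlim, sub_zero, ← hX]
    have hmp := (volume_preserving_piFinSuccAbove (fun _ : Fin (n + 1) => ℝ) 0).symm
    have hsymm : ∀ p : ℝ × (Fin n → ℝ),
        (MeasurableEquiv.piFinSuccAbove (fun _ : Fin (n + 1) => ℝ) 0).symm p =
          Fin.cons p.1 p.2 := by
      intro p
      simp [MeasurableEquiv.piFinSuccAbove, Fin.consEquiv]
    have hset : (MeasurableEquiv.piFinSuccAbove (fun _ : Fin (n + 1) => ℝ) 0).symm ⁻¹' Set.Iic X =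
        Set.Iic (X 0) ×ˢ Set.Iic (Fin.tail X) := by
      ext p
      simp only [Set.mem_preimage, hsymm, Set.mem_Iic, Set.mem_prod]
      constructor
      · intro hp
        exact ⟨by simpa using hp 0, fun i => by simpa [Fin.tail] using hp i.succ⟩
      · rintro ⟨h1, h2⟩ i
        refine Fin.cases ?_ (fun i => ?_) i
        · simpa using h1
        · simpa [Fin.tail] using h2 i
    rw [← hmp.setIntegral_preimage_emb (MeasurableEquiv.measurableEmbedding _), hset,
      Measure.volume_eq_prod, setIntegral_prod]
    · rw [hline]
      simp only [hslice, hsymm]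
    · refine Integrable.integrableOn ?_
      exact hmp.integrable_comp_of_integrable hGi

end FundamentalTheorem

/-! ### Bessel's inequality for the Fourier integral -/

section Bessel

variable {d : ℕ}

theorem ENNReal.mul_le_sq_add_sq (a b : ENNReal) : a * b ≤ a ^ 2 + b ^ 2 := by
  rcases le_total a b with h | h
  · exact (mul_le_mul_left h b).trans ((sq b).symm.le.trans le_add_self)
  · exact (mul_le_mul_right h a).trans ((sq a).symm.le.trans le_self_add)

/-- The Gaussian kernel `∫ exp(-b|ξ|² + i⟨ξ,r⟩) dξ`. -/
def gaussKernel (b : ℝ) (r : Fin d → ℝ) : ℂ :=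
  ∫ ξ : Fin d → ℝ, cexp (-(b : ℂ) * ∑ i, (ξ i : ℂ) ^ 2) * cexp (I * (dotR ξ r : ℝ))

theorem gaussKernel_eq {b : ℝ} (hb : 0 < b) (r : Fin d → ℝ) :
    gaussKernel b r = (Real.pi / b : ℂ) ^ ((Fintype.card (Fin d) : ℂ) / 2) *
      cexp (-(((4 * b)⁻¹ : ℝ) : ℂ) * ∑ i, (r i : ℂ) ^ 2) := by
  have h := GaussianFourier.integral_cexp_neg_mul_sum_add (ι := Fin d) (b := (b : ℂ)) (by simpa using hb)
    (fun i => I * (r i : ℂ))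
  rw [gaussKernel]
  convert h using 1
  · congr 1
    funext ξ
    rw [← Complex.exp_add]
    congr 2
    simp only [dotR, ofReal_sum, ofReal_mul, Finset.mul_sum]
    exact Finset.sum_congr rfl fun i _ => by ring
  · congr 2
    simp only [mul_pow, I_sq, ← Finset.mul_sum]
    push_cast
    have : (b : ℂ) ≠ 0 := by exact_mod_cast hb.ne'
    field_simp

theorem continuous_gaussKernel {b : ℝ} (hb : 0 < b) : Continuous (gaussKernel (d := d) b) := by
  have e : gaussKernel (d := d) b = fun r => _ := funext fun r => gaussKernel_eq hb r
  rw [e]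
  fun_prop

theorem integral_norm_cexp_sum_sq {b : ℝ} (hb : 0 < b) :
    ∫ r : Fin d → ℝ, ‖cexp (-(b : ℂ) * ∑ i, (r i : ℂ) ^ 2)‖ =
      (Real.pi / b) ^ ((Fintype.card (Fin d) : ℝ) / 2) := by
  have h := GaussianFourier.integral_cexp_neg_mul_sum_add (ι := Fin d) (b := (b : ℂ)) (by simpa using hb) 0
  simp only [Pi.zero_apply, zero_mul, Finset.sum_const_zero, add_zero, ne_eq, OfNat.ofNat_ne_zero,
    not_false_eq_true, zero_pow, zero_div, Complex.exp_zero, mul_one] at h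
  have e : ∀ r : Fin d → ℝ, cexp (-(b : ℂ) * ∑ i, (r i : ℂ) ^ 2) =
      ((‖cexp (-(b : ℂ) * ∑ i, (r i : ℂ) ^ 2)‖ : ℝ) : ℂ) := by
    intro r
    have : -(b : ℂ) * ∑ i, (r i : ℂ) ^ 2 = ((-b * ∑ i, r i ^ 2 : ℝ) : ℂ) := by push_cast; rfl
    rw [this, ← ofReal_exp, norm_real, Real.norm_of_nonneg (Real.exp_pos _).le]
  have h2 : ((∫ r : Fin d → ℝ, ‖cexp (-(b : ℂ) * ∑ i, (r i : ℂ) ^ 2)‖ : ℝ) : ℂ) =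
      (((Real.pi / b) ^ ((Fintype.card (Fin d) : ℝ) / 2) : ℝ) : ℂ) := by
    rw [← integral_complex_ofReal, ofReal_cpow (by positivity)]
    simp only [← e]
    rw [h]
    push_cast
    rfl
  exact_mod_cast h2

theorem integrable_cexp_sum_sq {b : ℝ} (hb : 0 < b) :
    Integrable fun r : Fin d → ℝ => cexp (-(b : ℂ) * ∑ i, (r i : ℂ) ^ 2) := by
  simpa using GaussianFourier.integrable_cexp_neg_mul_sum_add (ι := Fin d) (b := (b : ℂ)) (by simpa using hb) 0

theorem lintegral_enorm_gaussKernel {b : ℝ} (hb : 0 < b) :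
    ∫⁻ r : Fin d → ℝ, ‖gaussKernel b r‖ₑ =
      ENNReal.ofReal ((4 * Real.pi ^ 2) ^ ((Fintype.card (Fin d) : ℝ) / 2)) := by
  have hb' : 0 < (4 * b)⁻¹ := by positivity
  have e : gaussKernel (d := d) b = fun r => _ := funext fun r => gaussKernel_eq hb r
  have hi : Integrable (gaussKernel (d := d) b) := by
    rw [e]
    exact (integrable_cexp_sum_sq hb').const_mul _
  rw [← ofReal_integral_norm_eq_lintegral_enorm hi]
  congr 1
  simp only [gaussKernel_eq hb, norm_mul]
  rw [integral_const_mul, integral_norm_cexp_sum_sq hb']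
  have : (Real.pi / b : ℂ) = ((Real.pi / b : ℝ) : ℂ) := by push_cast; rfl
  rw [this, norm_cpow_eq_rpow_re_of_pos (by positivity)]
  have e2 : ((Fintype.card (Fin d) : ℂ) / 2).re = (Fintype.card (Fin d) : ℝ) / 2 := by simp
  rw [e2, ← Real.mul_rpow (by positivity) (by positivity)]
  congr 1
  field_simp

theorem lintegral_gauss_mul_enorm_sq_le {b : ℝ} (hb : 0 < b) {f : (Fin d → ℝ) → ℂ}
    (hm : Measurable f) (hf : Integrable f) :
    ∫⁻ ξ : Fin d → ℝ, ‖cexp (-(b : ℂ) * ∑ i, (ξ i : ℂ) ^ 2)‖ₑ *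
        ‖∫ x, f x * cexp (I * (dotR ξ x : ℝ))‖ₑ ^ 2 ≤
      2 * ENNReal.ofReal ((4 * Real.pi ^ 2) ^ ((Fintype.card (Fin d) : ℝ) / 2)) *
        ∫⁻ x, ‖f x‖ₑ ^ 2 := by
  set g : (Fin d → ℝ) → ℂ := fun ξ => cexp (-(b : ℂ) * ∑ i, (ξ i : ℂ) ^ 2) with hg
  set F : (Fin d → ℝ) → ℂ := fun ξ => ∫ x, f x * cexp (I * (dotR ξ x : ℝ)) with hF
  have hgr : ∀ ξ, g ξ = ((‖g ξ‖ : ℝ) : ℂ) := by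
    intro r
    have : -(b : ℂ) * ∑ i, (r i : ℂ) ^ 2 = ((-b * ∑ i, r i ^ 2 : ℝ) : ℂ) := by push_cast; rfl
    simp only [hg]
    rw [this, ← ofReal_exp, norm_real, Real.norm_of_nonneg (Real.exp_pos _).le]
  have hF2 : ∀ ξ, g ξ * (F ξ * conj (F ξ)) = ∫ p : (Fin d → ℝ) × (Fin d → ℝ),
      g ξ * (f p.1 * conj (f p.2)) * cexp (I * (dotR ξ (p.1 - p.2) : ℝ)) := by
    intro ξ
    simp only [hF]
    rw [← integral_conj, ← integral_prod_mul, ← integral_const_mul]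
    congr 1
    funext p
    have : cexp (I * (dotR ξ (p.1 - p.2) : ℝ)) =
        cexp (I * (dotR ξ p.1 : ℝ)) * conj (cexp (I * (dotR ξ p.2 : ℝ))) := by
      rw [← Complex.exp_conj, ← Complex.exp_add]
      congr 1
      simp only [dotR, Pi.sub_apply, map_mul, conj_I, conj_ofReal]
      push_cast
      simp only [mul_sub, Finset.sum_sub_distrib]
      ring
    rw [this, map_mul]
    ring
  have hint : Integrable (fun q : (Fin d → ℝ) × (Fin d → ℝ) × (Fin d → ℝ) =>
      g q.1 * (f q.2.1 * conj (f q.2.2)) * cexp (I * (dotR q.1 (q.2.1 - q.2.2) : ℝ))) := by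
    have h0 : Integrable (fun q : (Fin d → ℝ) × (Fin d → ℝ) × (Fin d → ℝ) =>
        g q.1 * (f q.2.1 * conj (f q.2.2))) := by
      refine (integrable_cexp_sum_sq hb).mul_prod (g := fun p : (Fin d → ℝ) × (Fin d → ℝ) =>
        f p.1 * conj (f p.2)) ?_
      exact hf.mul_prod (g := fun y => conj (f y))
        (hf.mono (continuous_conj.comp_aestronglyMeasurable hf.1) (.of_forall fun y => by simp))
    refine h0.mul_bdd (c := 1) (Continuous.aestronglyMeasurable ?_) (.of_forall fun q => ?_)
    · have := continuous_dotR (d := d) (f := fun q : (Fin d → ℝ) × (Fin d → ℝ) × (Fin d → ℝ) => q.1)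
        (g := fun q => q.2.1 - q.2.2) (by fun_prop) (by fun_prop)
      fun_prop
    · rw [mul_comm, norm_exp_ofReal_mul_I]
  have hgF : ∀ ξ, ‖g ξ‖ₑ * ‖F ξ‖ₑ ^ 2 = ‖g ξ * (F ξ * conj (F ξ))‖ₑ := by
    intro ξ
    rw [enorm_mul, enorm_mul, sq, RCLike.enorm_conj]
  have hFi : Integrable (fun ξ => g ξ * (F ξ * conj (F ξ))) := by
    simp only [hF2]
    exact hint.integral_prod_left
  have hpos : ∀ ξ, g ξ * (F ξ * conj (F ξ)) = ((‖g ξ * (F ξ * conj (F ξ))‖ : ℝ) : ℂ) := by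
    intro ξ
    rw [norm_mul, norm_mul, RCLike.norm_conj, Complex.mul_conj, normSq_eq_norm_sq]
    nth_rewrite 1 [hgr ξ]
    push_cast
    ring
  have hswap : ∫ ξ, g ξ * (F ξ * conj (F ξ)) = ∫ p : (Fin d → ℝ) × (Fin d → ℝ),
      f p.1 * conj (f p.2) * gaussKernel b (p.1 - p.2) := by
    simp only [hF2]
    rw [integral_integral_swap hint]
    congr 1
    funext p
    rw [gaussKernel, ← integral_const_mul]
    congr 1
    funext ξ
    ring
  have hΓ : Measurable (gaussKernel (d := d) b) := (continuous_gaussKernel hb).measurable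
  calc ∫⁻ ξ, ‖g ξ‖ₑ * ‖F ξ‖ₑ ^ 2
      = ‖∫ ξ, g ξ * (F ξ * conj (F ξ))‖ₑ := by
        simp only [hgF]
        rw [← ofReal_integral_norm_eq_lintegral_enorm hFi]
        rw [integral_congr_ae (f := fun ξ => g ξ * (F ξ * conj (F ξ))) (.of_forall hpos),
          integral_complex_ofReal, ← ofReal_norm, norm_real,
          Real.norm_of_nonneg (integral_nonneg fun _ => norm_nonneg _)]
    _ ≤ ∫⁻ p : (Fin d → ℝ) × (Fin d → ℝ), ‖f p.1 * conj (f p.2) * gaussKernel b (p.1 - p.2)‖ₑ := by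
        rw [hswap]
        exact enorm_integral_le_lintegral_enorm _
    _ ≤ ∫⁻ p : (Fin d → ℝ) × (Fin d → ℝ), (‖f p.1‖ₑ ^ 2 * ‖gaussKernel b (p.1 - p.2)‖ₑ +
          ‖f p.2‖ₑ ^ 2 * ‖gaussKernel b (p.1 - p.2)‖ₑ) := by
        refine lintegral_mono fun p => ?_
        rw [enorm_mul, enorm_mul, RCLike.enorm_conj, ← add_mul]
        gcongr
        exact ENNReal.mul_le_sq_add_sq _ _
    _ = 2 * ENNReal.ofReal ((4 * Real.pi ^ 2) ^ ((Fintype.card (Fin d) : ℝ) / 2)) *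
        ∫⁻ x, ‖f x‖ₑ ^ 2 := by
        rw [lintegral_add_left (by fun_prop), Measure.volume_eq_prod,
          lintegral_prod _ (by fun_prop), lintegral_prod_symm _ (by fun_prop)]
        have h1 : ∀ x : Fin d → ℝ, ∫⁻ y, ‖f x‖ₑ ^ 2 * ‖gaussKernel b (x - y)‖ₑ =
            ‖f x‖ₑ ^ 2 * ∫⁻ r : Fin d → ℝ, ‖gaussKernel b r‖ₑ := by
          intro x
          rw [lintegral_const_mul _ (by fun_prop),
            lintegral_sub_left_eq_self (fun r => ‖gaussKernel b r‖ₑ)]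
        have h2 : ∀ y : Fin d → ℝ, ∫⁻ x, ‖f y‖ₑ ^ 2 * ‖gaussKernel b (x - y)‖ₑ =
            ‖f y‖ₑ ^ 2 * ∫⁻ r : Fin d → ℝ, ‖gaussKernel b r‖ₑ := by
          intro x
          rw [lintegral_const_mul _ (by fun_prop),
            lintegral_sub_right_eq_self (fun r => ‖gaussKernel b r‖ₑ)]
        simp only [h1, h2]
        rw [lintegral_mul_const _ (by fun_prop), lintegral_enorm_gaussKernel hb]
        ring

/-- Bessel's inequality for the Fourier integral of an integrable function. -/
theorem lintegral_enorm_fourier_sq_le {f : (Fin d → ℝ) → ℂ} (hm : Measurable f)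
    (hf : Integrable f) :
    ∫⁻ ξ : Fin d → ℝ, ‖∫ x, f x * cexp (I * (dotR ξ x : ℝ))‖ₑ ^ 2 ≤
      2 * ENNReal.ofReal ((4 * Real.pi ^ 2) ^ ((Fintype.card (Fin d) : ℝ) / 2)) *
        ∫⁻ x, ‖f x‖ₑ ^ 2 := by
  let b : ℕ → ℝ := fun n => 1 / ((n : ℝ) + 1)
  have hb : ∀ n, 0 < b n := fun n => by positivity
  have hFm : Measurable fun ξ : Fin d → ℝ => ∫ x, f x * cexp (I * (dotR ξ x : ℝ)) := by
    refine (StronglyMeasurable.integral_prod_right (f := fun (ξ x : Fin d → ℝ) =>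
      f x * cexp (I * (dotR ξ x : ℝ))) (Measurable.stronglyMeasurable ?_)).measurable
    have := (continuous_dotR (d := d) (f := fun q : (Fin d → ℝ) × (Fin d → ℝ) => q.1)
        (g := fun q => q.2) (by fun_prop) (by fun_prop)).measurable
    unfold Function.uncurry
    fun_prop
  have hlim : ∀ ξ : Fin d → ℝ, Filter.Tendsto (fun n =>
      ‖cexp (-(b n : ℂ) * ∑ i, (ξ i : ℂ) ^ 2)‖ₑ * ‖∫ x, f x * cexp (I * (dotR ξ x : ℝ))‖ₑ ^ 2)
      Filter.atTop (𝓝 (‖∫ x, f x * cexp (I * (dotR ξ x : ℝ))‖ₑ ^ 2)) := by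
    intro ξ
    have h1 : Filter.Tendsto (fun n => ‖cexp (-(b n : ℂ) * ∑ i, (ξ i : ℂ) ^ 2)‖ₑ)
        Filter.atTop (𝓝 1) := by
      have h2 : Continuous fun s : ℝ => ‖cexp (-(s : ℂ) * ∑ i, (ξ i : ℂ) ^ 2)‖ₑ := by fun_prop
      have h3 := (h2.tendsto 0).comp (tendsto_one_div_add_atTop_nhds_zero_nat (𝕜 := ℝ))
      simpa [b, Function.comp_def] using h3
    simpa using ENNReal.Tendsto.mul_const h1 (Or.inl one_ne_zero)
  calc ∫⁻ ξ : Fin d → ℝ, ‖∫ x, f x * cexp (I * (dotR ξ x : ℝ))‖ₑ ^ 2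
      = ∫⁻ ξ : Fin d → ℝ, Filter.liminf (fun n => ‖cexp (-(b n : ℂ) * ∑ i, (ξ i : ℂ) ^ 2)‖ₑ *
          ‖∫ x, f x * cexp (I * (dotR ξ x : ℝ))‖ₑ ^ 2) Filter.atTop :=
        lintegral_congr fun ξ => (hlim ξ).liminf_eq.symm
    _ ≤ _ := lintegral_liminf_le fun n => by fun_prop
    _ ≤ _ := Filter.liminf_le_of_le (by isBoundedDefault) fun c hc => by
        obtain ⟨n, hn⟩ := hc.exists
        exact hn.trans (lintegral_gauss_mul_enorm_sq_le (hb n) hm hf)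

end Bessel

/-! ### Pairing with products of tails -/

section Tails

variable {d : ℕ}

/-- The product weight `∏ⱼ (1 + (xⱼ - cⱼ)²)⁻¹`. -/
def prodDecay (c x : Fin d → ℝ) : ℝ := ∏ j, (1 + (x j - c j) ^ 2)⁻¹

theorem prodDecay_pos (c x : Fin d → ℝ) : 0 < prodDecay c x :=
  Finset.prod_pos fun _ _ => by positivity

theorem prodDecay_le_one (c x : Fin d → ℝ) : prodDecay c x ≤ 1 :=
  Finset.prod_le_one (fun _ _ => by positivity) fun j _ =>
    inv_le_one_of_one_le₀ (by nlinarith [sq_nonneg (x j - c j)])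

theorem prodDecay_eq (c x : Fin d → ℝ) : prodDecay c x = prodDecay 0 (x - c) := by
  simp [prodDecay]

theorem continuous_prodDecay : Continuous fun p : (Fin d → ℝ) × (Fin d → ℝ) =>
    prodDecay p.1 p.2 := by
  unfold prodDecay
  refine continuous_finsetProd _ fun j _ => Continuous.inv₀ (by fun_prop) fun p => ?_
  positivity

theorem integrable_prodDecay (c : Fin d → ℝ) : Integrable (prodDecay c) :=
  integrable_prod_inv_one_add_sq c

/-- The integral of `u` over the orthant above `t`. -/
def upTail (u : (Fin d → ℝ) → ℂ) (t : Fin d → ℝ) : ℂ := ∫ x in Set.Ici t, u x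

theorem norm_upTail_le {u : (Fin d → ℝ) → ℂ} (hu : Integrable u) (t : Fin d → ℝ) :
    ‖upTail u t‖ ≤ ∫ x, ‖u x‖ :=
  (norm_integral_le_integral_norm _).trans
    (setIntegral_le_integral hu.norm (.of_forall fun _ => norm_nonneg _))

theorem measurable_upTail {P : Type*} [MeasurableSpace P] {U : P → (Fin d → ℝ) → ℂ}
    (hU : Measurable fun q : P × (Fin d → ℝ) => U q.1 q.2) :
    Measurable fun q : P × (Fin d → ℝ) => upTail (U q.1) q.2 := by
  have hS : MeasurableSet {q : (P × (Fin d → ℝ)) × (Fin d → ℝ) | q.1.2 ≤ q.2} :=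
    measurableSet_le (by fun_prop) (by fun_prop)
  have hm : Measurable fun q : (P × (Fin d → ℝ)) × (Fin d → ℝ) => U q.1.1 q.2 :=
    hU.comp (f := fun q : (P × (Fin d → ℝ)) × (Fin d → ℝ) => (q.1.1, q.2)) (by fun_prop)
  have h := ((hm.indicator hS).stronglyMeasurable.integral_prod_right'
    (ν := (volume : Measure (Fin d → ℝ)))).measurable
  convert h using 2 with q
  rw [upTail, ← integral_indicator measurableSet_Ici]
  rfl

theorem aestronglyMeasurable_upTail {u : (Fin d → ℝ) → ℂ} (hu : AEStronglyMeasurable u) :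
    AEStronglyMeasurable (upTail u) := by
  have h : upTail u = upTail (hu.mk u) := by
    funext t
    exact setIntegral_congr_ae measurableSet_Ici (hu.ae_eq_mk.mono fun x hx _ => hx)
  rw [h]
  have h2 := measurable_upTail (P := Unit) (U := fun _ => hu.mk u)
    (hu.stronglyMeasurable_mk.measurable.comp measurable_snd)
  exact (h2.comp (g := fun q : Unit × (Fin d → ℝ) => upTail (hu.mk u) q.2)
    (measurable_const (a := ()).prodMk measurable_id)).aestronglyMeasurable

theorem integral_mul_eq_integral_upTail {u f : (Fin d → ℝ) → ℂ} (hu : Integrable u)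
    (hf : ContDiff ℝ ∞ f) (c : Fin d → ℝ)
    (h : ∀ L : List (Fin d → ℝ), L.length ≤ d → ∃ C, ∀ x, ‖dList L f x‖ ≤ C * prodDecay c x) :
    ∫ x, u x * f x =
      ∫ t, dList ((List.finRange d).map fun i => Pi.single i (1 : ℝ)) f t * upTail u t := by
  set D := dList ((List.finRange d).map fun i => Pi.single i (1 : ℝ)) f with hD
  obtain ⟨C, hC⟩ := h ((List.finRange d).map fun i => Pi.single i (1 : ℝ)) (by simp)
  have hDi : Integrable D :=
    ((integrable_prodDecay c).const_mul C).mono' (hf.dList _).continuous.aestronglyMeasurable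
      (.of_forall hC)
  have hS : MeasurableSet {q : (Fin d → ℝ) × (Fin d → ℝ) | q.2 ≤ q.1} :=
    measurableSet_le (by fun_prop) (by fun_prop)
  have hint := (hu.mul_prod hDi).indicator hS
  have h1 : ∀ x, u x * f x = ∫ t, {q : (Fin d → ℝ) × (Fin d → ℝ) | q.2 ≤ q.1}.indicator
      (fun q => u q.1 * D q.2) (x, t) := by
    intro x
    rw [eq_setIntegral_Iic_dList hf c h x, ← integral_indicator measurableSet_Iic,
      ← integral_const_mul]
    congr 1
    funext t
    by_cases ht : t ≤ x
    · simp [ht, hD]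
    · simp [ht]
  simp only [h1]
  rw [integral_integral_swap (f := fun x t => {q : (Fin d → ℝ) × (Fin d → ℝ) | q.2 ≤ q.1}.indicator
      (fun q => u q.1 * D q.2) (x, t)) hint]
  congr 1
  funext t
  rw [upTail, ← integral_indicator measurableSet_Ici, ← integral_const_mul]
  congr 1
  funext x
  by_cases ht : t ≤ x
  · simp [ht, mul_comm]
  · simp [ht]

/-- Directions of the full mixed derivative in the first variable. -/
def allDirX (d : ℕ) : List ((Fin d → ℝ) × (Fin d → ℝ)) := (List.finRange d).map dirX

/-- Directions of the full mixed derivative in the second variable. -/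
def allDirY (d : ℕ) : List ((Fin d → ℝ) × (Fin d → ℝ)) := (List.finRange d).map dirXi

theorem integral_mul_mul_eq_integral_upTail {u v : (Fin d → ℝ) → ℂ} (hu : Integrable u)
    (hv : Integrable v) {s : (Fin d → ℝ) × (Fin d → ℝ) → ℂ} (hs : ContDiff ℝ ∞ s)
    (a b : Fin d → ℝ)
    (h : ∀ L : List ((Fin d → ℝ) × (Fin d → ℝ)), L.length ≤ d + d →
      ∃ C, ∀ p, ‖dList L s p‖ ≤ C * (prodDecay a p.1 * prodDecay b p.2)) :
    ∫ x, ∫ y, u x * v y * s (x, y) =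
      ∫ r, ∫ t, dList (allDirX d ++ allDirY d) s (t, r) * (upTail u t * upTail v r) := by
  let lx : (Fin d → ℝ) →L[ℝ] (Fin d → ℝ) × (Fin d → ℝ) := ContinuousLinearMap.inl ℝ _ _
  let ly : (Fin d → ℝ) →L[ℝ] (Fin d → ℝ) × (Fin d → ℝ) := ContinuousLinearMap.inr ℝ _ _
  have hlx : ∀ x y : Fin d → ℝ, (x, y) = lx x + (0, y) := fun x y => by simp [lx]
  have hly : ∀ x y : Fin d → ℝ, (x, y) = ly y + (x, 0) := fun x y => by simp [ly]
  set g := dList (allDirY d) s with hg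
  have hgs : ContDiff ℝ ∞ g := hs.dList _
  have hY : ∀ x, ∫ y, v y * s (x, y) = ∫ r, g (x, r) * upTail v r := by
    intro x
    have hsx : ContDiff ℝ ∞ fun y => s (ly y + (x, 0)) := hs.comp (by fun_prop)
    have := integral_mul_eq_integral_upTail hv hsx b (fun L hL => by
      obtain ⟨C, hC⟩ := h (L.map ly) (by simp; omega)
      refine ⟨C * prodDecay a x, fun y => ?_⟩
      rw [dList_comp_affine hs]
      beta_reduce
      rw [← hly, mul_assoc]
      exact hC (x, y))
    simp only [dList_comp_affine hs, List.map_map] at this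
    simp only [← hly] at this
    rw [this]
    rfl
  have hX : ∀ r, ∫ x, u x * g (x, r) =
      ∫ t, dList (allDirX d ++ allDirY d) s (t, r) * upTail u t := by
    intro r
    have hsx : ContDiff ℝ ∞ fun x => g (lx x + (0, r)) := hgs.comp (by fun_prop)
    have := integral_mul_eq_integral_upTail hu hsx a (fun L hL => by
      obtain ⟨C, hC⟩ := h (L.map lx ++ allDirY d) (by simp [allDirY]; omega)
      refine ⟨C * prodDecay b r, fun x => ?_⟩
      rw [dList_comp_affine hgs]
      beta_reduce
      rw [← hlx, hg, ← dList_append, mul_assoc, mul_comm (prodDecay b r)]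
      exact hC (x, r))
    simp only [dList_comp_affine hgs, List.map_map] at this
    simp only [← hlx] at this
    rw [this, dList_append]
    rfl
  obtain ⟨C, hC⟩ := h (allDirY d) (by simp [allDirY])
  have hint : Integrable fun p : (Fin d → ℝ) × (Fin d → ℝ) =>
      u p.1 * (g (p.1, p.2) * upTail v p.2) := by
    have h1 : Integrable fun p : (Fin d → ℝ) × (Fin d → ℝ) => ‖u p.1‖ *
        (prodDecay b p.2 * C * ∫ x, ‖v x‖) :=
      hu.norm.mul_prod (((integrable_prodDecay b).mul_const _).mul_const _)
    refine h1.mono' ((hu.1.comp_fst).mul (hgs.continuous.aestronglyMeasurable.mul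
      (aestronglyMeasurable_upTail hv.1).comp_snd)) (.of_forall fun p => ?_)
    rw [norm_mul, norm_mul]
    have hC0 : 0 ≤ C := by
      have := (norm_nonneg _).trans (hC p)
      exact nonneg_of_mul_nonneg_left this (mul_pos (prodDecay_pos _ _) (prodDecay_pos _ _))
    gcongr
    · exact mul_nonneg (prodDecay_pos _ _).le hC0
    · refine (hC p).trans ?_
      rw [mul_comm C]
      gcongr
      exact mul_le_of_le_one_left (prodDecay_pos _ _).le (prodDecay_le_one _ _)
    · exact norm_upTail_le hv _
  calc ∫ x, ∫ y, u x * v y * s (x, y) = ∫ x, ∫ r, u x * (g (x, r) * upTail v r) := by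
        congr 1
        funext x
        simp only [mul_assoc]
        rw [integral_const_mul, hY, integral_const_mul]
    _ = ∫ r, ∫ x, u x * (g (x, r) * upTail v r) := integral_integral_swap hint
    _ = _ := by
        congr 1
        funext r
        simp only [← mul_assoc]
        rw [integral_mul_const, hX, integral_mul_const]

/-- The mass of the product weight. -/
def decayMass (d : ℕ) : ENNReal := ∫⁻ x : Fin d → ℝ, ENNReal.ofReal (prodDecay 0 x)

theorem decayMass_ne_top : decayMass d ≠ ⊤ := by
  have h := (integrable_prodDecay (0 : Fin d → ℝ)).lintegral_lt_top
  exact h.ne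

theorem measurable_ofReal_prodDecay (c : Fin d → ℝ) :
    Measurable fun x => ENNReal.ofReal (prodDecay c x) :=
  (continuous_prodDecay.comp (Continuous.prodMk_right c)).measurable.ennreal_ofReal

theorem lintegral_prodDecay (c : Fin d → ℝ) :
    ∫⁻ x, ENNReal.ofReal (prodDecay c x) = decayMass d := by
  simp only [prodDecay_eq c]
  exact lintegral_sub_right_eq_self (fun x => ENNReal.ofReal (prodDecay 0 x)) c

theorem lintegral_prodDecay_left (x : Fin d → ℝ) :
    ∫⁻ c, ENNReal.ofReal (prodDecay c x) = decayMass d := by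
  simp only [prodDecay_eq _ x]
  exact lintegral_sub_left_eq_self (fun x => ENNReal.ofReal (prodDecay 0 x)) x

theorem ENNReal.mul_le_smul_sq_add (a b : ENNReal) {δ : ENNReal} (h0 : δ ≠ 0) (h1 : δ ≠ ⊤) :
    a * b ≤ δ * a ^ 2 + δ⁻¹ * b ^ 2 := by
  rcases le_total b (δ * a) with h | h
  · refine le_trans ?_ le_self_add
    calc a * b ≤ a * (δ * a) := mul_le_mul_right h a
      _ = δ * a ^ 2 := by ring
  · refine le_trans ?_ le_add_self
    have : a ≤ δ⁻¹ * b := by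
      rw [← ENNReal.div_eq_inv_mul, ENNReal.le_div_iff_mul_le (.inl h0) (.inl h1), mul_comm]
      exact h
    calc a * b ≤ δ⁻¹ * b * b := mul_le_mul_left this b
      _ = δ⁻¹ * b ^ 2 := by ring

theorem enorm_integral_mul_mul_le {u v : (Fin d → ℝ) → ℂ} (hu : Integrable u)
    (hv : Integrable v) {s : (Fin d → ℝ) × (Fin d → ℝ) → ℂ} (hs : ContDiff ℝ ∞ s)
    (z : Fin d → ℝ)
    (h : ∀ L : List ((Fin d → ℝ) × (Fin d → ℝ)), L.length ≤ d + d →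
      ∃ C, ∀ p, ‖dList L s p‖ ≤ C * (prodDecay z p.1 * prodDecay z p.2)) {K : ℝ}
    (hK : ∀ p, ‖dList (allDirX d ++ allDirY d) s p‖ ≤ K * (prodDecay z p.1 * prodDecay z p.2))
    {δ : ENNReal} (h0 : δ ≠ 0) (h1 : δ ≠ ⊤) :
    ‖∫ x, ∫ y, u x * v y * s (x, y)‖ₑ ≤ ENNReal.ofReal K * decayMass d *
      (δ * (∫⁻ t, ENNReal.ofReal (prodDecay z t) * ‖upTail u t‖ₑ ^ 2) +
        δ⁻¹ * (∫⁻ t, ENNReal.ofReal (prodDecay z t) * ‖upTail v t‖ₑ ^ 2)) := by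
  rw [integral_mul_mul_eq_integral_upTail hu hv hs z z h]
  have hK0 : 0 ≤ K := by
    have := (norm_nonneg _).trans (hK 0)
    exact nonneg_of_mul_nonneg_left this (mul_pos (prodDecay_pos _ _) (prodDecay_pos _ _))
  set w : (Fin d → ℝ) → ENNReal := fun t => ENNReal.ofReal (prodDecay z t) with hw
  have hwm : Measurable w := measurable_ofReal_prodDecay z
  have hTu : AEMeasurable fun t => ‖upTail u t‖ₑ := (aestronglyMeasurable_upTail hu.1).enorm
  have hTv : AEMeasurable fun t => ‖upTail v t‖ₑ := (aestronglyMeasurable_upTail hv.1).enorm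
  have hmass : ∫⁻ t, w t = decayMass d := lintegral_prodDecay z
  set Tu := ∫⁻ t, w t * ‖upTail u t‖ₑ ^ 2 with hTu'
  have hb : ∀ r t, ‖dList (allDirX d ++ allDirY d) s (t, r) * (upTail u t * upTail v r)‖ₑ ≤
      ENNReal.ofReal K * (w t * w r) *
        (δ * ‖upTail u t‖ₑ ^ 2 + δ⁻¹ * ‖upTail v r‖ₑ ^ 2) := by
    intro r t
    rw [enorm_mul, enorm_mul]
    gcongr
    · rw [← ofReal_norm, ← ENNReal.ofReal_mul (prodDecay_pos _ _).le, ← ENNReal.ofReal_mul hK0]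
      exact ENNReal.ofReal_le_ofReal (hK (t, r))
    · exact ENNReal.mul_le_smul_sq_add _ _ h0 h1
  have hin : ∀ r, ∫⁻ t, ENNReal.ofReal K * (w t * w r) *
        (δ * ‖upTail u t‖ₑ ^ 2 + δ⁻¹ * ‖upTail v r‖ₑ ^ 2) =
      ENNReal.ofReal K * (w r * (δ * Tu + δ⁻¹ * ‖upTail v r‖ₑ ^ 2 * decayMass d)) := by
    intro r
    have e : ∀ t, ENNReal.ofReal K * (w t * w r) *
        (δ * ‖upTail u t‖ₑ ^ 2 + δ⁻¹ * ‖upTail v r‖ₑ ^ 2) = ENNReal.ofReal K * (w r *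
          (δ * (w t * ‖upTail u t‖ₑ ^ 2) + δ⁻¹ * ‖upTail v r‖ₑ ^ 2 * w t)) := fun t => by ring
    simp only [e]
    rw [lintegral_const_mul'' _ (by fun_prop), lintegral_const_mul'' _ (by fun_prop),
      lintegral_add_left' (by fun_prop), lintegral_const_mul'' _ (by fun_prop),
      lintegral_const_mul _ hwm, hmass]
  calc ‖∫ r, ∫ t, dList (allDirX d ++ allDirY d) s (t, r) * (upTail u t * upTail v r)‖ₑ
      ≤ ∫⁻ r, ∫⁻ t, ‖dList (allDirX d ++ allDirY d) s (t, r) * (upTail u t * upTail v r)‖ₑ :=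
        (enorm_integral_le_lintegral_enorm _).trans
          (lintegral_mono fun r => enorm_integral_le_lintegral_enorm _)
    _ ≤ ∫⁻ r, ENNReal.ofReal K * (w r * (δ * Tu + δ⁻¹ * ‖upTail v r‖ₑ ^ 2 * decayMass d)) := by
        refine lintegral_mono fun r => ?_
        rw [← hin]
        exact lintegral_mono (hb r)
    _ = _ := by
        have e : ∀ r, ENNReal.ofReal K * (w r * (δ * Tu + δ⁻¹ * ‖upTail v r‖ₑ ^ 2 * decayMass d)) =
            ENNReal.ofReal K * (δ * Tu * w r +
              δ⁻¹ * decayMass d * (w r * ‖upTail v r‖ₑ ^ 2)) := fun r => by ring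
        simp only [e]
        rw [lintegral_const_mul'' _ (by fun_prop), lintegral_add_left' (by fun_prop),
          lintegral_const_mul _ hwm, lintegral_const_mul'' _ (by fun_prop), hmass]
        ring

end Tails

/-! ### Weights and gauge invariant kernels -/

section Weights

variable {d : ℕ}

/-- The weight `1 + |r|²`. -/
def sqW (r : Fin d → ℝ) : ℝ := 1 + dotR r r

theorem dotR_self_nonneg (r : Fin d → ℝ) : 0 ≤ dotR r r :=
  Finset.sum_nonneg fun j _ => mul_self_nonneg (r j)

theorem one_le_sqW (r : Fin d → ℝ) : 1 ≤ sqW r := le_add_of_nonneg_right (dotR_self_nonneg r)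

theorem sqW_pos (r : Fin d → ℝ) : 0 < sqW r := zero_lt_one.trans_le (one_le_sqW r)

theorem sqW_neg (r : Fin d → ℝ) : sqW (-r) = sqW r := by simp [sqW, dotR]

theorem sqW_add_le (r s : Fin d → ℝ) : sqW (r + s) ≤ 2 * (sqW r * sqW s) := by
  have h : dotR (r + s) (r + s) ≤ 2 * dotR r r + 2 * dotR s s := by
    simp only [dotR, Finset.mul_sum, ← Finset.sum_add_distrib]
    refine Finset.sum_le_sum fun j _ => ?_
    simp only [Pi.add_apply]
    nlinarith [sq_nonneg (r j - s j)]
  have := mul_nonneg (dotR_self_nonneg r) (dotR_self_nonneg s)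
  simp only [sqW]
  nlinarith

theorem sq_le_sqW (r : Fin d → ℝ) (j : Fin d) : 1 + r j ^ 2 ≤ sqW r := by
  have := Finset.single_le_sum (f := fun j => r j * r j) (fun j _ => mul_self_nonneg (r j))
    (Finset.mem_univ j)
  simp only [sqW, dotR]
  nlinarith

theorem inv_sqW_pow_le (r : Fin d → ℝ) : (sqW r)⁻¹ ^ d ≤ prodDecay 0 r := by
  have h : (sqW r)⁻¹ ^ d = ∏ _j : Fin d, (sqW r)⁻¹ := by simp
  rw [h, prodDecay]
  refine Finset.prod_le_prod (fun j _ => (inv_pos.2 (sqW_pos r)).le) fun j _ => ?_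
  simp only [Pi.zero_apply, sub_zero]
  exact inv_anti₀ (by positivity) (sq_le_sqW r j)

theorem abs_le_sqrt_sqW (r : Fin d → ℝ) (j : Fin d) : |r j| ≤ √(sqW r) :=
  Real.abs_le_sqrt (by linarith [sq_le_sqW r j])

/-- The weight `1 + |r|²` as a complex function. -/
def bigW (r : Fin d → ℝ) : ℂ := (sqW r : ℝ)

/-- The inverse weight `(1 + |r|²)⁻¹` as a complex function. -/
def invW (r : Fin d → ℝ) : ℂ := ((sqW r)⁻¹ : ℝ)

theorem contDiff_sqW : ContDiff ℝ ∞ (sqW (d := d)) := by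
  unfold sqW dotR
  fun_prop

theorem contDiff_bigW : ContDiff ℝ ∞ (bigW (d := d)) :=
  Complex.ofRealCLM.contDiff.comp contDiff_sqW

theorem contDiff_invW : ContDiff ℝ ∞ (invW (d := d)) :=
  Complex.ofRealCLM.contDiff.comp (contDiff_sqW.inv fun r => (sqW_pos r).ne')

theorem invW_mul_bigW (r : Fin d → ℝ) : invW r * bigW r = 1 := by
  rw [invW, bigW, ← Complex.ofReal_mul, inv_mul_cancel₀ (sqW_pos r).ne', Complex.ofReal_one]

theorem norm_invW (r : Fin d → ℝ) : ‖invW r‖ = (sqW r)⁻¹ := by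
  rw [invW, Complex.norm_real, Real.norm_of_nonneg (inv_pos.2 (sqW_pos r)).le]

theorem SymB.clm {ι E : Type*} [NormedAddCommGroup E] [NormedSpace ℝ E] {m : ι → E → ℝ}
    (hm : ∀ i p, 1 ≤ m i p) (l : E →L[ℝ] ℂ) (hl : ∀ i p, ‖l p‖ ≤ m i p) (n : ℕ) :
    SymB m n (fun _ p => l p) := by
  have h0 : ∃ C : ℝ, ∀ i p, ‖l p‖ ≤ C * m i p := ⟨1, fun i p => by simpa using hl i p⟩
  cases n with
  | zero => exact h0
  | succ n =>
    refine ⟨h0, fun v => ?_⟩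
    simp only [dirD_clm]
    exact SymB.const _ hm

theorem SymB.pow {ι E : Type*} [NormedAddCommGroup E] [NormedSpace ℝ E] {m : ι → E → ℝ}
    {f : ι → E → ℂ} {n : ℕ} (hm : ∀ i p, 0 ≤ m i p) (hfs : ∀ i, ContDiff ℝ ∞ (f i))
    (hf : SymB m n f) (k : ℕ) : SymB (fun i p => m i p ^ k) n (fun i p => f i p ^ k) := by
  induction k with
  | zero => simpa using SymB.const (m := fun (_ : ι) (_ : E) => (1 : ℝ)) 1 fun _ _ => le_rfl
  | succ k ih =>
    simp only [pow_succ]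
    exact ih.mul hm (fun i => (hfs i).pow k) hfs hf

theorem symB_bigW (n : ℕ) : SymB (fun (_ : Unit) => sqW (d := d)) n (fun _ => bigW) := by
  let co : Fin d → (Fin d → ℝ) →L[ℝ] ℂ := fun j => Complex.ofRealCLM.comp (ContinuousLinearMap.proj j)
  have hw : ∀ r : Fin d → ℝ, 1 ≤ √(sqW r) := fun r => Real.one_le_sqrt.2 (one_le_sqW r)
  have hco : ∀ j, SymB (fun (_ : Unit) (r : Fin d → ℝ) => √(sqW r)) n (fun _ r => co j r) := fun j =>
    SymB.clm (fun _ => hw) _ (fun _ r => by simpa [co] using abs_le_sqrt_sqW r j) n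
  have hsum : SymB (fun (_ : Unit) => sqW (d := d)) n (fun _ r => ∑ j, co j r * co j r) := by
    refine SymB.sum _ (fun j _ _ => (co j).contDiff.mul (co j).contDiff) fun j _ => ?_
    refine SymB.weight_mono (K := 1) (fun _ r => by positivity) (fun _ r => ?_)
      ((hco j).mul (fun _ r => Real.sqrt_nonneg _) (fun _ => (co j).contDiff)
        (fun _ => (co j).contDiff) (hco j))
    rw [Real.mul_self_sqrt (sqW_pos r).le, one_mul]
  have e : (bigW : (Fin d → ℝ) → ℂ) = fun r => 1 + ∑ j, co j r * co j r := by
    funext r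
    simp [bigW, sqW, dotR, co]
  rw [e]
  exact SymB.add (fun _ => contDiff_const) (fun _ => ContDiff.sum fun j _ =>
    (co j).contDiff.mul (co j).contDiff) (SymB.const 1 fun _ => one_le_sqW) hsum

theorem dirD_invW (v : Fin d → ℝ) :
    dirD v invW = fun r => (-1 : ℂ) * (invW r * invW r * dirD v bigW r) := by
  funext r
  have h : dirD v (fun r => invW r * bigW r) r = 0 := by
    simp only [invW_mul_bigW, dirD_const]
  rw [dirD_mul contDiff_invW contDiff_bigW] at h
  beta_reduce at h
  linear_combination invW r * h - dirD v invW r * invW_mul_bigW r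

theorem symB_invW (n : ℕ) : SymB (fun (_ : Unit) (r : Fin d → ℝ) => (sqW r)⁻¹) n (fun _ => invW) := by
  have hb : ∃ C : ℝ, ∀ (_ : Unit) (r : Fin d → ℝ), ‖invW r‖ ≤ C * (sqW r)⁻¹ :=
    ⟨1, fun _ r => by rw [norm_invW, one_mul]⟩
  have h0 : ∀ r : Fin d → ℝ, 0 ≤ (sqW r)⁻¹ := fun r => (inv_pos.2 (sqW_pos r)).le
  induction n with
  | zero => exact hb
  | succ n ih =>
    refine ⟨hb, fun v => ?_⟩
    beta_reduce
    rw [dirD_invW]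
    have hs := contDiff_invW (d := d)
    have hd := (contDiff_bigW (d := d)).dirD v
    refine SymB.const_mul _ (fun _ => (hs.mul hs).mul hd) ?_
    refine SymB.weight_mono (K := 1) (fun _ r => ?_) (fun _ r => ?_)
      ((ih.mul (fun _ => h0) (fun _ => hs) (fun _ => hs) ih).mul (fun _ r => (sqW_pos r).le)
        (fun _ => hs.mul hs) (fun _ => hd) ((symB_bigW (n + 1)).dirD_mem v))
    · exact mul_nonneg (mul_nonneg (h0 r) (h0 r)) (sqW_pos r).le
    · rw [mul_assoc, inv_mul_cancel₀ (sqW_pos r).ne', mul_one, one_mul]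

theorem bddG_invW : BddG (invW (d := d)) := by
  refine BddG.of_symB contDiff_invW fun n => ?_
  exact (symB_invW n).weight_mono (K := 1) (fun _ r => (inv_pos.2 (sqW_pos r)).le)
    fun _ r => by rw [one_mul]; exact inv_le_one_of_one_le₀ (one_le_sqW r)

end Weights

section TrianglePhase

variable {d : ℕ} {A : (Fin d → ℝ) → (Fin d → ℝ)}

/-- The phase of the circulation around the triangle `z, x, y`. -/
def triPhase (A : (Fin d → ℝ) → (Fin d → ℝ)) (z : Fin d → ℝ) (p : (Fin d → ℝ) × (Fin d → ℝ)) : ℂ :=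
  phase A (z, p.1) * phase A p * phase A (p.2, z)

/-- The weight controlling `triPhase`. -/
def triW (z : Fin d → ℝ) (p : (Fin d → ℝ) × (Fin d → ℝ)) : ℝ := sqW (p.1 - z) * sqW (p.2 - p.1)

theorem one_le_triW (z : Fin d → ℝ) (p : (Fin d → ℝ) × (Fin d → ℝ)) : 1 ≤ triW z p :=
  one_le_mul_of_one_le_of_one_le (one_le_sqW _) (one_le_sqW _)

theorem sqW_sub_le_triW (z : Fin d → ℝ) (p : (Fin d → ℝ) × (Fin d → ℝ)) :
    sqW (p.2 - z) ≤ 2 * triW z p := by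
  simpa [triW] using sqW_add_le (p.1 - z) (p.2 - p.1)

theorem fluxForm_polyB_sqW (hA : ContDiff ℝ ∞ A) (hB : BBounded (Bof A))
    (v : (Fin d → ℝ) × (Fin d → ℝ)) :
    PolyB (fun (_ : Unit) (p : (Fin d → ℝ) × (Fin d → ℝ)) => sqW (p.2 - p.1))
      (fun _ => fluxForm A v) := by
  refine fluxForm_polyB hA hB (fun p => one_le_sqW _) (fun k => ?_) v
  refine ⟨fun _ => (diffCoord k).contDiff, fun n => ⟨1, ?_⟩⟩
  simp only [pow_one]
  refine SymB.clm (fun _ p => one_le_sqW _) _ (fun _ p => ?_) n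
  rw [diffCoord_apply, Complex.norm_real]
  refine (abs_le_sqrt_sqW (p.2 - p.1) k).trans (Real.sqrt_le_iff.2 ⟨(sqW_pos _).le, ?_⟩)
  exact le_self_pow₀ (one_le_sqW _) two_ne_zero

theorem triPhase_polyB (hA : ContDiff ℝ ∞ A) (hB : BBounded (Bof A)) :
    PolyB (triW (d := d)) (triPhase A) := by
  let l₁ : (Fin d → ℝ) × (Fin d → ℝ) →L[ℝ] (Fin d → ℝ) × (Fin d → ℝ) :=
    ContinuousLinearMap.prod 0 (ContinuousLinearMap.fst ℝ _ _)
  let l₂ : (Fin d → ℝ) × (Fin d → ℝ) →L[ℝ] (Fin d → ℝ) × (Fin d → ℝ) :=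
    ContinuousLinearMap.id ℝ _
  let l₃ : (Fin d → ℝ) × (Fin d → ℝ) →L[ℝ] (Fin d → ℝ) × (Fin d → ℝ) :=
    ContinuousLinearMap.prod (ContinuousLinearMap.snd ℝ _ _) 0
  let g : (Fin d → ℝ) → (Fin d → ℝ) × (Fin d → ℝ) → ℂ := fun z p =>
    circ A (l₁ p + (z, 0)) + circ A (l₂ p + 0) + circ A (l₃ p + (0, z))
  have hc := contDiff_circ hA
  have hl : ∀ (l : (Fin d → ℝ) × (Fin d → ℝ) →L[ℝ] (Fin d → ℝ) × (Fin d → ℝ))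
      (c : (Fin d → ℝ) × (Fin d → ℝ)), ContDiff ℝ ∞ (fun p => circ A (l p + c)) := fun l c =>
    hc.comp (l.contDiff.add contDiff_const)
  have hg : ∀ z, ContDiff ℝ ∞ (g z) := fun z => ((hl _ _).add (hl _ _)).add (hl _ _)
  have e : triPhase A = fun z p => cexp (-I * g z p) := by
    funext z p
    simp only [triPhase, phase, ← Complex.exp_add, g, l₁, l₂, l₃]
    congr 1
    simp
    ring
  have hd : ∀ v z, dirD v (fun p => -I * g z p) = fun p => -I * (fluxForm A (l₁ v) (l₁ p + (z, 0)) +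
      fluxForm A (l₂ v) (l₂ p + 0) + fluxForm A (l₃ v) (l₃ p + (0, z))) := by
    intro v z
    rw [dirD_const_mul (hg z)]
    funext p
    simp only [g]
    rw [dirD_add ((hl _ _).add (hl _ _)) (hl _ _), dirD_add (hl _ _) (hl _ _)]
    rw [dirD_comp_affine hc, dirD_comp_affine hc, dirD_comp_affine hc]
    simp only [dirD_circ hA]
    simp [l₁, l₂, l₃]
    ring
  rw [e]
  refine PolyB.exp_of_dirD one_le_triW (fun z => contDiff_const.mul (hg z)) (fun z p => ?_) fun v => ?_
  · simp [g, circ_im]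
  · simp only [hd]
    have hW0 : ∀ (z : Fin d → ℝ) (p : (Fin d → ℝ) × (Fin d → ℝ)), 0 ≤ sqW (p.2 - p.1) :=
      fun _ p => (sqW_pos _).le
    have key : ∀ (l : (Fin d → ℝ) × (Fin d → ℝ) →L[ℝ] (Fin d → ℝ) × (Fin d → ℝ))
        (c : (Fin d → ℝ) → (Fin d → ℝ) × (Fin d → ℝ)),
        (∀ z p, sqW ((l p + c z).2 - (l p + c z).1) ≤ 2 * triW z p) →
        PolyB (triW (d := d)) (fun z p => fluxForm A (l v) (l p + c z)) := fun l c h =>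
      PolyB.weight_mono (K := 2) (fun z p => (sqW_pos _).le) h
        ((fluxForm_polyB_sqW hA hB (l v)).comp_affine (fun _ => ()) l c)
    refine PolyB.const_mul _ (PolyB.add one_le_triW (PolyB.add one_le_triW
      (key l₁ (fun z => (z, 0)) fun z p => ?_) (key l₂ (fun _ => 0) fun z p => ?_))
      (key l₃ (fun z => (0, z)) fun z p => ?_))
    · have : sqW (p.1 - z) ≤ triW z p :=
        le_mul_of_one_le_right (sqW_pos _).le (one_le_sqW _)
      simp only [l₁, ContinuousLinearMap.prod_apply]
      simp
      linarith [one_le_triW z p]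
    · have : sqW (p.2 - p.1) ≤ triW z p :=
        le_mul_of_one_le_left (sqW_pos _).le (one_le_sqW _)
      simp only [l₂]
      simp
      linarith [one_le_triW z p]
    · have := sqW_sub_le_triW z p
      rw [← sqW_neg] at this
      simpa [l₃] using this

/-- The localized and conjugated kernel of a magnetic operator with reduced amplitude `a`. -/
def locKernel (A : (Fin d → ℝ) → (Fin d → ℝ)) (k : ℕ)
    (a : (Fin d → ℝ) × (Fin d → ℝ) × (Fin d → ℝ) → ℂ) (i : (Fin d → ℝ) × (Fin d → ℝ))
    (p : (Fin d → ℝ) × (Fin d → ℝ)) : ℂ :=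
  invW (p.1 - i.1) ^ (k + d + (d + d)) * bigW (p.2 - i.1) ^ d * invW (p.2 - p.1) ^ (k + d + d) *
    triPhase A i.1 p * a (p.1, p.2, i.2)

theorem locKernel_symB (hA : ContDiff ℝ ∞ A) (hB : BBounded (Bof A)) :
    ∃ k : ℕ, ∀ {a}, BddG a → (∀ i, ContDiff ℝ ∞ (locKernel A k a i)) ∧
      SymB (fun i p => prodDecay i.1 p.1 * prodDecay i.1 p.2) (d + d) (locKernel A k a) := by
  obtain ⟨k, hk⟩ := (triPhase_polyB hA hB).bounds (d + d)
  refine ⟨k, fun {a} ha => ?_⟩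
  have hsE := (triPhase_polyB hA hB).smooth
  let sx : (Fin d → ℝ) × (Fin d → ℝ) →L[ℝ] (Fin d → ℝ) := ContinuousLinearMap.fst ℝ _ _
  let sy : (Fin d → ℝ) × (Fin d → ℝ) →L[ℝ] (Fin d → ℝ) := ContinuousLinearMap.snd ℝ _ _
  let em : (Fin d → ℝ) × (Fin d → ℝ) →L[ℝ] (Fin d → ℝ) × (Fin d → ℝ) × (Fin d → ℝ) :=
    ContinuousLinearMap.prod sx (ContinuousLinearMap.prod sy 0)
  have ex : ∀ i p : (Fin d → ℝ) × (Fin d → ℝ), sx p + -i.1 = p.1 - i.1 := fun i p => by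
    simp [sx, sub_eq_add_neg]
  have ey : ∀ i p : (Fin d → ℝ) × (Fin d → ℝ), sy p + -i.1 = p.2 - i.1 := fun i p => by
    simp [sy, sub_eq_add_neg]
  have exy : ∀ p : (Fin d → ℝ) × (Fin d → ℝ), (sy - sx) p + 0 = p.2 - p.1 := fun p => by
    simp [sy, sx]
  have ea : ∀ i p : (Fin d → ℝ) × (Fin d → ℝ), em p + (0, 0, i.2) = (p.1, p.2, i.2) := fun i p => by
    simp [em, sx, sy]
  have hJ : ∀ r : Fin d → ℝ, 0 ≤ sqW r := fun r => (sqW_pos r).le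
  have hR : ∀ r : Fin d → ℝ, 0 ≤ (sqW r)⁻¹ := fun r => inv_nonneg.2 (hJ r)
  have h1 := ((symB_invW (d := d) (d + d)).comp_affine (fun _ => contDiff_invW)
    (fun _ : (Fin d → ℝ) × (Fin d → ℝ) => ()) sx (fun i => -i.1))
  have h2 := ((symB_bigW (d := d) (d + d)).comp_affine (fun _ => contDiff_bigW)
    (fun _ : (Fin d → ℝ) × (Fin d → ℝ) => ()) sy (fun i => -i.1))
  have h3 := ((symB_invW (d := d) (d + d)).comp_affine (fun _ => contDiff_invW)
    (fun _ : (Fin d → ℝ) × (Fin d → ℝ) => ()) (sy - sx) (fun i => 0))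
  have h4 := hk.comp_affine hsE (fun i : (Fin d → ℝ) × (Fin d → ℝ) => i.1)
    (ContinuousLinearMap.id ℝ _) (fun _ => 0)
  have h5 := (ha.symB (d + d)).comp_affine (fun _ => ha.smooth)
    (fun _ : (Fin d → ℝ) × (Fin d → ℝ) => ()) em (fun i => (0, 0, i.2))
  simp only [ex, ey, exy, ea, ContinuousLinearMap.id_apply, add_zero] at h1 h2 h3 h4 h5
  have s1 : ∀ i : (Fin d → ℝ) × (Fin d → ℝ), ContDiff ℝ ∞
      (fun p : (Fin d → ℝ) × (Fin d → ℝ) => invW (p.1 - i.1)) := fun i =>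
    contDiff_invW.comp (contDiff_fst.sub contDiff_const)
  have s2 : ∀ i : (Fin d → ℝ) × (Fin d → ℝ), ContDiff ℝ ∞
      (fun p : (Fin d → ℝ) × (Fin d → ℝ) => bigW (p.2 - i.1)) := fun i =>
    contDiff_bigW.comp (contDiff_snd.sub contDiff_const)
  have s3 : ContDiff ℝ ∞ (fun p : (Fin d → ℝ) × (Fin d → ℝ) => invW (p.2 - p.1)) :=
    contDiff_invW.comp (contDiff_snd.sub contDiff_fst)
  have s5 : ∀ i : (Fin d → ℝ) × (Fin d → ℝ), ContDiff ℝ ∞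
      (fun p : (Fin d → ℝ) × (Fin d → ℝ) => a (p.1, p.2, i.2)) := fun i =>
    ha.smooth.comp (contDiff_fst.prodMk (contDiff_snd.prodMk contDiff_const))
  have h := ((((h1.pow (fun _ _ => hR _) s1 (k + d + (d + d))).mul (fun _ _ => pow_nonneg (hJ _) _)
    (fun i => (s1 i).pow _) (fun i => (s2 i).pow _) (h2.pow (fun _ _ => hJ _) s2 d)).mul
    (fun _ _ => pow_nonneg (hR _) _) (fun i => ((s1 i).pow _).mul ((s2 i).pow _)) (fun i => s3.pow _)
    (h3.pow (fun _ _ => hR _) (fun _ => s3) (k + d + d))).mul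
    (fun _ _ => pow_nonneg (zero_le_one.trans (one_le_triW _ _)) _)
    (fun i => (((s1 i).pow _).mul ((s2 i).pow _)).mul (s3.pow _)) (fun i => hsE i.1) h4).mul
    (fun _ _ => zero_le_one)
    (fun i => ((((s1 i).pow _).mul ((s2 i).pow _)).mul (s3.pow _)).mul (hsE i.1)) s5 h5
  refine ⟨fun i => (((((s1 i).pow _).mul ((s2 i).pow _)).mul (s3.pow _)).mul (hsE i.1)).mul (s5 i), ?_⟩
  refine h.weight_mono (K := 2 ^ (d + d)) (fun i p => ?_) fun i p => ?_
  · have := zero_le_one.trans (one_le_triW i.1 p)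
    have := hR (p.1 - i.1)
    have := hR (p.2 - p.1)
    have := hJ (p.2 - i.1)
    positivity
  · have hx := sqW_pos (p.1 - i.1)
    have hxy := sqW_pos (p.2 - p.1)
    have hy := sqW_pos (p.2 - i.1)
    have hle : sqW (p.2 - i.1) ≤ 2 * (sqW (p.1 - i.1) * sqW (p.2 - p.1)) := sqW_sub_le_triW i.1 p
    have d1 := inv_sqW_pow_le (p.1 - i.1)
    have d2 := inv_sqW_pow_le (p.2 - i.1)
    rw [← prodDecay_eq] at d1 d2
    have hle' : (sqW (p.1 - i.1))⁻¹ * (sqW (p.2 - p.1))⁻¹ ≤ 2 * (sqW (p.2 - i.1))⁻¹ := by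
      rw [← mul_inv, ← div_eq_mul_inv, le_div_iff₀ hy, inv_mul_le_iff₀ (by positivity)]
      linarith
    unfold triW
    generalize sqW (p.1 - i.1) = X at *
    generalize sqW (p.2 - p.1) = R at *
    generalize sqW (p.2 - i.1) = Y at *
    calc X⁻¹ ^ (k + d + (d + d)) * Y ^ d * R⁻¹ ^ (k + d + d) * (X * R) ^ k * 1
        ≤ X⁻¹ ^ (k + d + (d + d)) * (2 * (X * R)) ^ d * R⁻¹ ^ (k + d + d) * (X * R) ^ k * 1 := by
          gcongr
      _ = 2 ^ d * X⁻¹ ^ d * (X⁻¹ * R⁻¹) ^ d * ((X⁻¹ * X) ^ k * (R⁻¹ * R) ^ k * (X⁻¹ * X) ^ d * (R⁻¹ * R) ^ d) := by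
          ring
      _ = 2 ^ d * X⁻¹ ^ d * (X⁻¹ * R⁻¹) ^ d := by
          simp [inv_mul_cancel₀ hx.ne', inv_mul_cancel₀ hxy.ne']
      _ ≤ 2 ^ d * X⁻¹ ^ d * (2 * Y⁻¹) ^ d := by gcongr
      _ = 2 ^ (d + d) * (X⁻¹ ^ d * Y⁻¹ ^ d) := by ring
      _ ≤ _ := by
        have := prodDecay_pos i.1 p.1
        gcongr

end TrianglePhase

/-! ### Gaining off-diagonal decay -/

section OffDiagonal

variable {d : ℕ} {A : (Fin d → ℝ) → (Fin d → ℝ)}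

theorem symB_coord (j : Fin d) (n : ℕ) :
    SymB (fun (_ : Unit) (r : Fin d → ℝ) => √(sqW r)) n (fun _ r => ((r j : ℝ) : ℂ)) :=
  SymB.clm (fun _ r => Real.one_le_sqrt.2 (one_le_sqW r))
    (Complex.ofRealCLM.comp (ContinuousLinearMap.proj j))
    (fun _ r => by simpa using abs_le_sqrt_sqW r j) n

theorem contDiff_coord (j : Fin d) : ContDiff ℝ ∞ (fun r : Fin d → ℝ => ((r j : ℝ) : ℂ)) :=
  (Complex.ofRealCLM.comp (ContinuousLinearMap.proj (R := ℝ) (φ := fun _ : Fin d => ℝ) j)).contDiff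

theorem bddG_coord_mul_invW (j : Fin d) : BddG (fun r : Fin d → ℝ => (r j : ℂ) * invW r) := by
  refine BddG.of_symB ((contDiff_coord j).mul contDiff_invW) fun n => ?_
  refine ((symB_coord j n).mul (fun _ r => (inv_pos.2 (sqW_pos r)).le) (fun _ => contDiff_coord j)
    (fun _ => contDiff_invW) (symB_invW n)).weight_mono (K := 1) (fun _ r => ?_) fun _ r => ?_
  · have := sqW_pos r
    positivity
  · rw [one_mul, mul_inv_le_iff₀ (sqW_pos r), one_mul]
    exact Real.sqrt_le_iff.2 ⟨(sqW_pos _).le, le_self_pow₀ (one_le_sqW _) two_ne_zero⟩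

theorem bddG_coord_sq_mul_invW (j : Fin d) :
    BddG (fun r : Fin d → ℝ => (r j : ℂ) * ((r j : ℂ) * invW r)) := by
  have hs := contDiff_coord j
  refine BddG.of_symB (hs.mul (hs.mul contDiff_invW)) fun n => ?_
  have hR : ∀ r : Fin d → ℝ, 0 ≤ (sqW r)⁻¹ := fun r => (inv_pos.2 (sqW_pos r)).le
  refine ((symB_coord j n).mul (fun _ r => mul_nonneg (Real.sqrt_nonneg _) (hR r)) (fun _ => hs)
    (fun _ => hs.mul contDiff_invW) ((symB_coord j n).mul (fun _ r => hR r) (fun _ => hs)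
    (fun _ => contDiff_invW) (symB_invW n))).weight_mono (K := 1) (fun _ r => ?_) fun _ r => ?_
  · have := sqW_pos r
    positivity
  · rw [← mul_assoc, Real.mul_self_sqrt (sqW_pos r).le, mul_inv_cancel₀ (sqW_pos r).ne', one_mul]

/-- The operator `1 - Δ` in the momentum variable. -/
def lapXi (a : (Fin d → ℝ) × (Fin d → ℝ) × (Fin d → ℝ) → ℂ)
    (q : (Fin d → ℝ) × (Fin d → ℝ) × (Fin d → ℝ)) : ℂ :=
  a q + (-1) * ∑ j, dirD (0, 0, Pi.single j 1) (dirD (0, 0, Pi.single j 1) a) q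

theorem BddG.lapXi {a : (Fin d → ℝ) × (Fin d → ℝ) × (Fin d → ℝ) → ℂ} (ha : BddG a) :
    BddG (lapXi a) :=
  ha.add (BddG.const_mul _ (BddG.sum _ fun _ _ => (ha.dirD _).dirD _))

theorem dirD_xi_mul {b : (Fin d → ℝ) → ℂ}
    {a : (Fin d → ℝ) × (Fin d → ℝ) × (Fin d → ℝ) → ℂ} (hb : ContDiff ℝ ∞ b)
    (ha : ContDiff ℝ ∞ a) (η : Fin d → ℝ) :
    dirD (0, 0, η) (fun q => b (q.2.1 - q.1) * a q) =
      fun q => b (q.2.1 - q.1) * dirD (0, 0, η) a q := by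
  let l : (Fin d → ℝ) × (Fin d → ℝ) × (Fin d → ℝ) →L[ℝ] (Fin d → ℝ) :=
    (ContinuousLinearMap.fst ℝ _ _).comp (ContinuousLinearMap.snd ℝ _ _) -
      ContinuousLinearMap.fst ℝ _ _
  have e : (fun q : (Fin d → ℝ) × (Fin d → ℝ) × (Fin d → ℝ) => b (q.2.1 - q.1)) =
      fun q => b (l q + 0) := by
    funext q
    simp [l]
  have hs : ContDiff ℝ ∞ (fun q : (Fin d → ℝ) × (Fin d → ℝ) × (Fin d → ℝ) => b (q.2.1 - q.1)) := by
    rw [e]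
    exact hb.comp (l.contDiff.add contDiff_const)
  rw [dirD_mul hs ha]
  funext q
  rw [e, dirD_comp_affine hb]
  simp [l, dirD]

theorem bddG_invW_pow (n : ℕ) : BddG (fun r : Fin d → ℝ => invW r ^ n) := by
  induction n with
  | zero => simpa using PolyB.const 1
  | succ n ih => simpa only [pow_succ] using ih.mul bddG_invW

theorem BddG.diff_mul {b : (Fin d → ℝ) → ℂ}
    {a : (Fin d → ℝ) × (Fin d → ℝ) × (Fin d → ℝ) → ℂ} (hb : BddG b) (ha : BddG a) :
    BddG (fun q => b (q.2.1 - q.1) * a q) := by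
  let l : (Fin d → ℝ) × (Fin d → ℝ) × (Fin d → ℝ) →L[ℝ] (Fin d → ℝ) :=
    (ContinuousLinearMap.fst ℝ _ _).comp (ContinuousLinearMap.snd ℝ _ _) -
      ContinuousLinearMap.fst ℝ _ _
  exact BddG.mul (hb.comp_linear l) ha

theorem opT_magAmp_diff_mul (hA : Function.HasTemperateGrowth A) {b : (Fin d → ℝ) → ℂ}
    (hb : BddG b) {a : (Fin d → ℝ) × (Fin d → ℝ) × (Fin d → ℝ) → ℂ} (ha : BddG a)
    (φ : SchwartzMap (Fin d → ℝ) ℂ) (x : Fin d → ℝ) :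
    opT (magAmp A (fun q => b (q.2.1 - q.1) * a q)) φ x =
      opT (magAmp A (fun q => b (q.2.1 - q.1) * invW (q.2.1 - q.1) * lapXi a q)) φ x := by
  obtain ⟨k, hk⟩ := exists_amp_magAmp hA
  have hb0 : BddG (fun r => b r * invW r) := hb.mul bddG_invW
  have hb1 : ∀ j, BddG (fun r => b r * ((r j : ℂ) * invW r)) := fun j => hb.mul (bddG_coord_mul_invW j)
  have hb2 : ∀ j, BddG (fun r => b r * ((r j : ℂ) * ((r j : ℂ) * invW r))) := fun j =>
    hb.mul (bddG_coord_sq_mul_invW j)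
  let D : Fin d → ((Fin d → ℝ) × (Fin d → ℝ) × (Fin d → ℝ) → ℂ) →
      (Fin d → ℝ) × (Fin d → ℝ) × (Fin d → ℝ) → ℂ := fun j => dirD (0, 0, Pi.single j 1)
  have hj : ∀ j, opT (magAmp A (fun q => b (q.2.1 - q.1) *
      (((q.2.1 - q.1) j : ℂ) * (((q.2.1 - q.1) j : ℂ) * invW (q.2.1 - q.1))) * a q)) φ x =
      -opT (magAmp A (fun q => b (q.2.1 - q.1) * invW (q.2.1 - q.1) * D j (D j a) q)) φ x := by
    intro j
    have e1 : magAmp A (fun q => b (q.2.1 - q.1) *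
        (((q.2.1 - q.1) j : ℂ) * (((q.2.1 - q.1) j : ℂ) * invW (q.2.1 - q.1))) * a q) =
        fun q => diffCoord j (q.1, q.2.1) *
          magAmp A (fun q => b (q.2.1 - q.1) * (((q.2.1 - q.1) j : ℂ) * invW (q.2.1 - q.1)) * a q) q := by
      funext q
      simp only [magAmp, diffCoord_apply, Pi.sub_apply]
      ring
    rw [e1, (hk ((hb1 j).diff_mul ha)).opT_diffCoord φ j x, dirD_xi_magAmp hA ((hb1 j).diff_mul ha).smooth,
      dirD_xi_mul (hb1 j).smooth ha.smooth]
    have e2 : magAmp A (fun q => b (q.2.1 - q.1) * (((q.2.1 - q.1) j : ℂ) * invW (q.2.1 - q.1)) *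
        dirD (0, 0, Pi.single j 1) a q) = fun q => diffCoord j (q.1, q.2.1) *
          magAmp A (fun q => b (q.2.1 - q.1) * invW (q.2.1 - q.1) * dirD (0, 0, Pi.single j 1) a q) q := by
      funext q
      simp only [magAmp, diffCoord_apply, Pi.sub_apply]
      ring
    have had := ha.dirD (0, 0, Pi.single j 1)
    rw [e2, (hk (hb0.diff_mul had)).opT_diffCoord φ j x, dirD_xi_magAmp hA (hb0.diff_mul had).smooth,
      dirD_xi_mul hb0.smooth had.smooth, ← mul_assoc]
    simp [D]
  have hl : opT (magAmp A (fun q => b (q.2.1 - q.1) * a q)) φ x =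
      opT (magAmp A (fun q => b (q.2.1 - q.1) * invW (q.2.1 - q.1) * a q)) φ x +
      ∑ j, opT (magAmp A (fun q => b (q.2.1 - q.1) *
        (((q.2.1 - q.1) j : ℂ) * (((q.2.1 - q.1) j : ℂ) * invW (q.2.1 - q.1))) * a q)) φ x := by
    rw [← Amp.opT_sum _ (fun j => hk ((hb2 j).diff_mul ha))]
    have hs : BddG (fun q => ∑ j, b (q.2.1 - q.1) *
        (((q.2.1 - q.1) j : ℂ) * (((q.2.1 - q.1) j : ℂ) * invW (q.2.1 - q.1))) * a q) :=
      BddG.sum _ fun j _ => (hb2 j).diff_mul ha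
    have he := (hk (hb0.diff_mul ha)).opT_add (hk hs) φ x
    refine Eq.trans ?_ (he.trans ?_)
    · congr 1
      funext q
      have h1 := invW_mul_bigW (q.2.1 - q.1)
      have h2 : bigW (q.2.1 - q.1) = 1 + ∑ j, ((q.2.1 - q.1) j : ℂ) * ((q.2.1 - q.1) j : ℂ) := by
        simp [bigW, sqW, dotR]
      rw [h2] at h1
      simp only [magAmp]
      rw [← mul_add]
      congr 1
      have h3 : ∑ j, b (q.2.1 - q.1) *
          (((q.2.1 - q.1) j : ℂ) * (((q.2.1 - q.1) j : ℂ) * invW (q.2.1 - q.1))) * a q =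
          b (q.2.1 - q.1) * invW (q.2.1 - q.1) *
            (∑ j, ((q.2.1 - q.1) j : ℂ) * ((q.2.1 - q.1) j : ℂ)) * a q := by
        rw [Finset.mul_sum, Finset.sum_mul]
        exact Finset.sum_congr rfl fun j _ => by ring
      rw [h3]
      linear_combination (-(b (q.2.1 - q.1) * a q)) * h1
    · congr 2
      funext q
      simp only [magAmp, Finset.mul_sum]
  have hd2 : ∀ j, BddG (fun q => b (q.2.1 - q.1) * invW (q.2.1 - q.1) * D j (D j a) q) := fun j =>
    hb0.diff_mul ((ha.dirD _).dirD _)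
  rw [hl]
  simp only [hj]
  rw [Finset.sum_neg_distrib, ← Amp.opT_sum _ (fun j => hk (hd2 j)), ← neg_one_mul, ← opT_const_mul]
  have he := (hk (hb0.diff_mul ha)).opT_add
    (hk (BddG.const_mul (-1) (BddG.sum Finset.univ fun j _ => hd2 j))) φ x
  refine Eq.trans ?_ (he.symm.trans ?_)
  · congr 2
    funext q
    simp only [magAmp, Finset.mul_sum]
    exact Finset.sum_congr rfl fun j _ => by ring
  · congr 1
    funext q
    simp only [magAmp, lapXi, ← mul_add, D]
    congr 1
    rw [mul_add]
    congr 1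
    simp only [Finset.mul_sum]
    exact Finset.sum_congr rfl fun j _ => by ring

theorem exists_opT_eq_decay (hA : Function.HasTemperateGrowth A)
    {a : (Fin d → ℝ) × (Fin d → ℝ) × (Fin d → ℝ) → ℂ} (ha : BddG a) (n : ℕ) :
    ∃ a', BddG a' ∧ ∀ (φ : SchwartzMap (Fin d → ℝ) ℂ) (x : Fin d → ℝ), opT (magAmp A a) φ x =
      opT (magAmp A (fun q => invW (q.2.1 - q.1) ^ n * a' q)) φ x := by
  induction n with
  | zero => exact ⟨a, ha, fun φ x => by simp⟩
  | succ n ih =>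
    obtain ⟨a', ha', h⟩ := ih
    refine ⟨lapXi a', ha'.lapXi, fun φ x => ?_⟩
    rw [h, opT_magAmp_diff_mul hA (bddG_invW_pow n) ha' φ x]
    simp only [pow_succ]

end OffDiagonal

/-! ### Phase space localization -/

section Localization

variable {d : ℕ} {A : (Fin d → ℝ) → (Fin d → ℝ)}

theorem continuous_phase (hA : ContDiff ℝ ∞ A) : Continuous (phase A) :=
  (continuous_const.mul (contDiff_circ hA).continuous).cexp

theorem phase_swap (A : (Fin d → ℝ) → (Fin d → ℝ)) (x y : Fin d → ℝ) :
    phase A (y, x) = conj (phase A (x, y)) := by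
  have h : conj (circ A (x, y)) = circ A (x, y) := Complex.conj_eq_iff_im.2 (circ_im A _)
  simp only [phase]
  rw [circ_swap, ← Complex.exp_conj, map_mul, h]
  simp

theorem phase_mul_swap (A : (Fin d → ℝ) → (Fin d → ℝ)) (x y : Fin d → ℝ) :
    phase A (y, x) * phase A (x, y) = 1 := by
  simp only [phase]
  rw [circ_swap, ← Complex.exp_add]
  simp

/-- The function `conj g` localized at the position `z` in the gauge adapted to `z`. -/
def localize (A : (Fin d → ℝ) → (Fin d → ℝ)) (g : (Fin d → ℝ) → ℂ) (z x : Fin d → ℝ) : ℂ :=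
  conj (g x) * (invW (x - z) ^ d * phase A (x, z))

/-- The function `conj g` localized at the position `z` and modulated to the momentum `ξ`. -/
def packet (A : (Fin d → ℝ) → (Fin d → ℝ)) (g : (Fin d → ℝ) → ℂ)
    (i : (Fin d → ℝ) × (Fin d → ℝ)) (x : Fin d → ℝ) : ℂ :=
  localize A g i.1 x * cexp (I * (dotR i.2 x : ℝ))

theorem continuous_localize (hA : ContDiff ℝ ∞ A) {g : (Fin d → ℝ) → ℂ} (hg : Continuous g) :
    Continuous fun q : (Fin d → ℝ) × (Fin d → ℝ) => localize A g q.1 q.2 := by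
  have h1 := (contDiff_invW (d := d)).continuous
  have h2 := continuous_phase hA
  unfold localize
  fun_prop

theorem continuous_packet (hA : ContDiff ℝ ∞ A) {g : (Fin d → ℝ) → ℂ} (hg : Continuous g) :
    Continuous fun q : ((Fin d → ℝ) × (Fin d → ℝ)) × (Fin d → ℝ) => packet A g q.1 q.2 := by
  have h1 := (continuous_localize hA hg).comp
    (f := fun q : ((Fin d → ℝ) × (Fin d → ℝ)) × (Fin d → ℝ) => (q.1.1, q.2)) (by fun_prop)
  have h2 : Continuous fun q : ((Fin d → ℝ) × (Fin d → ℝ)) × (Fin d → ℝ) => dotR q.1.2 q.2 :=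
    continuous_dotR (by fun_prop) (by fun_prop)
  have h3 : Continuous fun q : ((Fin d → ℝ) × (Fin d → ℝ)) × (Fin d → ℝ) =>
      cexp (I * (dotR q.1.2 q.2 : ℝ)) := by fun_prop
  exact h1.mul h3

theorem norm_localize (g : (Fin d → ℝ) → ℂ) (z x : Fin d → ℝ) :
    ‖localize A g z x‖ = ‖g x‖ * (sqW (x - z))⁻¹ ^ d := by
  rw [localize, norm_mul, norm_mul, norm_phase, norm_pow, norm_invW, mul_one, RCLike.norm_conj]

theorem norm_packet (g : (Fin d → ℝ) → ℂ) (i : (Fin d → ℝ) × (Fin d → ℝ)) (x : Fin d → ℝ) :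
    ‖packet A g i x‖ = ‖g x‖ * (sqW (x - i.1))⁻¹ ^ d := by
  rw [packet, norm_mul, norm_localize, mul_comm I, Complex.norm_exp_ofReal_mul_I, mul_one]

theorem inv_sqW_pow_le_one (r : Fin d → ℝ) (n : ℕ) : (sqW r)⁻¹ ^ n ≤ 1 :=
  pow_le_one₀ (inv_pos.2 (sqW_pos r)).le (inv_le_one_of_one_le₀ (one_le_sqW r))

theorem integrable_localize (hA : ContDiff ℝ ∞ A) {g : (Fin d → ℝ) → ℂ} (hg : Continuous g)
    (hi : Integrable g) (z : Fin d → ℝ) : Integrable (localize A g z) := by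
  refine hi.mono ((continuous_localize hA hg).comp (Continuous.prodMk_right z)).aestronglyMeasurable
    (.of_forall fun x => ?_)
  rw [norm_localize]
  exact mul_le_of_le_one_right (norm_nonneg _) (inv_sqW_pow_le_one _ _)

theorem integrable_packet (hA : ContDiff ℝ ∞ A) {g : (Fin d → ℝ) → ℂ} (hg : Continuous g)
    (hi : Integrable g) (i : (Fin d → ℝ) × (Fin d → ℝ)) : Integrable (packet A g i) := by
  refine hi.mono ((continuous_packet hA hg).comp (Continuous.prodMk_right i)).aestronglyMeasurable
    (.of_forall fun x => ?_)
  rw [norm_packet]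
  exact mul_le_of_le_one_right (norm_nonneg _) (inv_sqW_pow_le_one _ _)

/-- The weighted square norm of the tails of a wave packet. -/
def packetEnergy (A : (Fin d → ℝ) → (Fin d → ℝ)) (g : (Fin d → ℝ) → ℂ)
    (i : (Fin d → ℝ) × (Fin d → ℝ)) : ENNReal :=
  ∫⁻ t, ENNReal.ofReal (prodDecay i.1 t) * ‖upTail (packet A g i) t‖ₑ ^ 2

theorem measurable_packetEnergy_integrand (hA : ContDiff ℝ ∞ A) {g : (Fin d → ℝ) → ℂ}
    (hg : Continuous g) :
    Measurable fun q : ((Fin d → ℝ) × (Fin d → ℝ)) × (Fin d → ℝ) =>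
      ENNReal.ofReal (prodDecay q.1.1 q.2) * ‖upTail (packet A g q.1) q.2‖ₑ ^ 2 := by
  have h1 : Measurable fun q : ((Fin d → ℝ) × (Fin d → ℝ)) × (Fin d → ℝ) => prodDecay q.1.1 q.2 :=
    (continuous_prodDecay.comp (f := fun q : ((Fin d → ℝ) × (Fin d → ℝ)) × (Fin d → ℝ) =>
      (q.1.1, q.2)) (by fun_prop)).measurable
  exact h1.ennreal_ofReal.mul
    ((measurable_upTail (continuous_packet hA hg).measurable).enorm.pow_const 2)

theorem measurable_packetEnergy (hA : ContDiff ℝ ∞ A) {g : (Fin d → ℝ) → ℂ}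
    (hg : Continuous g) : Measurable (packetEnergy A g) :=
  (measurable_packetEnergy_integrand hA hg).lintegral_prod_right'

/-- The constant in Bessel's inequality for the Fourier transform on `ℝ^d`. -/
def besselConst (d : ℕ) : ENNReal :=
  2 * ENNReal.ofReal ((4 * Real.pi ^ 2) ^ ((Fintype.card (Fin d) : ℝ) / 2))

theorem besselConst_ne_top : besselConst d ≠ ⊤ :=
  ENNReal.mul_ne_top ENNReal.ofNat_ne_top ENNReal.ofReal_ne_top

theorem lintegral_upTail_packet_le (hA : ContDiff ℝ ∞ A) {g : (Fin d → ℝ) → ℂ} (hg : Continuous g)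
    (hi : Integrable g) (z t : Fin d → ℝ) :
    ∫⁻ ξ, ‖upTail (packet A g (z, ξ)) t‖ₑ ^ 2 ≤
      besselConst d * ∫⁻ x, ENNReal.ofReal (prodDecay z x) * ‖g x‖ₑ ^ 2 := by
  have hl := integrable_localize hA hg hi z
  have hm : Measurable (localize A g z) :=
    ((continuous_localize hA hg).comp (Continuous.prodMk_right z)).measurable
  have h := lintegral_enorm_fourier_sq_le (hm.indicator (measurableSet_Ici (a := t)))
    (hl.indicator measurableSet_Ici)
  have e : ∀ ξ, upTail (packet A g (z, ξ)) t = ∫ x, (Set.Ici t).indicator (localize A g z) x *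
      cexp (I * (dotR ξ x : ℝ)) := by
    intro ξ
    rw [upTail, ← integral_indicator measurableSet_Ici]
    congr 1
    funext x
    by_cases hx : x ∈ Set.Ici t
    · simp only [Set.indicator_of_mem hx, packet]
    · simp only [Set.indicator_of_notMem hx, zero_mul]
  simp only [e]
  refine h.trans (mul_le_mul_right (lintegral_mono fun x => ?_) _)
  refine (pow_le_pow_left₀ zero_le (enorm_indicator_le_enorm_self _ _) 2).trans ?_
  rw [← ofReal_norm, ← ofReal_norm, norm_localize, ← ENNReal.ofReal_pow (norm_nonneg _),
    ← ENNReal.ofReal_pow (mul_nonneg (norm_nonneg _) (pow_nonneg (inv_pos.2 (sqW_pos _)).le _)), ← ENNReal.ofReal_mul (prodDecay_pos _ _).le]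
  refine ENNReal.ofReal_le_ofReal ?_
  have h0 : 0 ≤ (sqW (x - z))⁻¹ ^ d := pow_nonneg (inv_pos.2 (sqW_pos _)).le _
  have h1 := inv_sqW_pow_le_one (x - z) d
  have h2 := inv_sqW_pow_le (x - z)
  rw [← prodDecay_eq] at h2
  rw [mul_pow, mul_comm]
  refine mul_le_mul_of_nonneg_right ?_ (sq_nonneg _)
  nlinarith

theorem lintegral_packetEnergy_le (hA : ContDiff ℝ ∞ A) {g : (Fin d → ℝ) → ℂ} (hg : Continuous g)
    (hi : Integrable g) :
    ∫⁻ ξ, ∫⁻ z, packetEnergy A g (z, ξ) ≤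
      besselConst d * decayMass d ^ 2 * ∫⁻ x, ‖g x‖ₑ ^ 2 := by
  have hM := measurable_packetEnergy_integrand hA hg
  have hw : Measurable fun q : (Fin d → ℝ) × (Fin d → ℝ) => ENNReal.ofReal (prodDecay q.1 q.2) :=
    continuous_prodDecay.measurable.ennreal_ofReal
  have hgm : Measurable fun x => ‖g x‖ₑ ^ 2 := hg.measurable.enorm.pow_const 2
  rw [lintegral_lintegral_swap (f := fun ξ z => packetEnergy A g (z, ξ))
    ((measurable_packetEnergy hA hg).comp measurable_swap).aemeasurable]
  have h1 : ∀ z, ∫⁻ ξ, packetEnergy A g (z, ξ) ≤ besselConst d * decayMass d *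
      ∫⁻ x, ENNReal.ofReal (prodDecay z x) * ‖g x‖ₑ ^ 2 := by
    intro z
    simp only [packetEnergy]
    rw [lintegral_lintegral_swap (f := fun ξ t => ENNReal.ofReal (prodDecay z t) *
      ‖upTail (packet A g (z, ξ)) t‖ₑ ^ 2) (hM.comp (f := fun q : (Fin d → ℝ) × (Fin d → ℝ) =>
        ((z, q.1), q.2)) (by fun_prop)).aemeasurable]
    calc ∫⁻ t, ∫⁻ ξ, ENNReal.ofReal (prodDecay z t) * ‖upTail (packet A g (z, ξ)) t‖ₑ ^ 2
        ≤ ∫⁻ t, ENNReal.ofReal (prodDecay z t) * (besselConst d *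
            ∫⁻ x, ENNReal.ofReal (prodDecay z x) * ‖g x‖ₑ ^ 2) := by
          refine lintegral_mono fun t => ?_
          rw [lintegral_const_mul' _ _ ENNReal.ofReal_ne_top]
          exact mul_le_mul_right (lintegral_upTail_packet_le hA hg hi z t) _
      _ = _ := by
          rw [lintegral_mul_const _ (measurable_ofReal_prodDecay z), lintegral_prodDecay]
          ring
  refine (lintegral_mono h1).trans ?_
  have hwg : Measurable fun q : (Fin d → ℝ) × (Fin d → ℝ) =>
      ENNReal.ofReal (prodDecay q.1 q.2) * ‖g q.2‖ₑ ^ 2 := hw.mul (hgm.comp measurable_snd)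
  rw [lintegral_const_mul _ hwg.lintegral_prod_right',
    lintegral_lintegral_swap hwg.aemeasurable]
  have h2 : ∀ x, ∫⁻ z, ENNReal.ofReal (prodDecay z x) * ‖g x‖ₑ ^ 2 = decayMass d * ‖g x‖ₑ ^ 2 := by
    intro x
    have hz : Measurable fun z => ENNReal.ofReal (prodDecay z x) :=
      hw.comp (f := fun z => (z, x)) (by fun_prop)
    rw [lintegral_mul_const _ hz, lintegral_prodDecay_left]
  simp only [h2]
  rw [lintegral_const_mul _ hgm]
  exact le_of_eq (by ring)

end Localization

/-! ### The `L²` bound -/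

section SquareIntegrable

variable {d : ℕ} {A : (Fin d → ℝ) → (Fin d → ℝ)}

theorem SchwartzMap.integrable_one_add_norm_pow_mul (ψ : SchwartzMap (Fin d → ℝ) ℂ) (M : ℕ) :
    Integrable fun x => (1 + ‖x‖) ^ M * ‖ψ x‖ := by
  obtain ⟨C, hC0, hC⟩ := ψ.exists_one_add_norm_pow_mul_le (M + (d + 1))
  have hc : Continuous fun x => (1 + ‖x‖) ^ M * ‖ψ x‖ := by
    have := ψ.continuous
    fun_prop
  refine (integrable_one_add_norm_pow_inv.const_mul C).mono' hc.aestronglyMeasurable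
    (.of_forall fun x => ?_)
  rw [Real.norm_of_nonneg (by positivity), ← div_eq_mul_inv, le_div_iff₀ (by positivity)]
  refine le_trans (le_of_eq ?_) (hC x)
  rw [pow_add]
  ring

section Form

variable {k : ℕ → ℕ} {c : (Fin d → ℝ) × (Fin d → ℝ) × (Fin d → ℝ) → ℂ}

theorem Amp.integrable_conj_mul_oscJ (hc : Amp k c) (φ ψ : SchwartzMap (Fin d → ℝ) ℂ) :
    Integrable fun q : (Fin d → ℝ) × (Fin d → ℝ) => conj (ψ q.1) * oscJ c φ q := by
  obtain ⟨M, hM⟩ := Amp.exists_norm_oscJ_le (d := d) k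
  obtain ⟨C, hC0, hC⟩ := hM c hc φ
  have hcont : Continuous fun q : (Fin d → ℝ) × (Fin d → ℝ) => conj (ψ q.1) * oscJ c φ q :=
    (continuous_conj.comp (ψ.continuous.comp continuous_fst)).mul (hc.oscJ_diff φ).1.continuous
  refine (((ψ.integrable_one_add_norm_pow_mul M).const_mul C).mul_prod
    (g := fun ξ : Fin d → ℝ => ((1 + ‖ξ‖) ^ (d + 1))⁻¹) integrable_one_add_norm_pow_inv).mono'
    hcont.aestronglyMeasurable (.of_forall fun q => ?_)
  rw [norm_mul, RCLike.norm_conj]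
  refine (mul_le_mul_of_nonneg_left (hC q) (norm_nonneg _)).trans (le_of_eq ?_)
  ring

theorem lintegral_enorm_sq_eq (ψ : SchwartzMap (Fin d → ℝ) ℂ) :
    ∫⁻ x, ‖ψ x‖ₑ ^ 2 = ‖∫ x, conj (ψ x) * ψ x‖ₑ := by
  have hi : Integrable fun x => ‖ψ x‖ ^ 2 := by
    have h := (ψ.memLp 2 volume).integrable_norm_pow (by norm_num)
    simpa using h
  have e : ∀ x, conj (ψ x) * ψ x = ((‖ψ x‖ ^ 2 : ℝ) : ℂ) := fun x => by
    rw [Complex.conj_mul']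
    push_cast
    rfl
  simp only [e]
  rw [integral_complex_ofReal, ← ofReal_norm, Complex.norm_real, Real.norm_of_nonneg
    (integral_nonneg fun x => by positivity), ofReal_integral_eq_lintegral_ofReal hi
    (.of_forall fun x => by positivity)]
  refine lintegral_congr fun x => ?_
  rw [ENNReal.ofReal_pow (norm_nonneg _), ofReal_norm]

theorem Amp.lintegral_enorm_sq_le (hc : Amp k c) {φ ψ : SchwartzMap (Fin d → ℝ) ℂ}
    (h : ∀ x, ψ x = opT c φ x) :
    ∫⁻ x, ‖ψ x‖ₑ ^ 2 ≤ ∫⁻ ξ, ‖∫ x, conj (ψ x) * oscJ c φ (x, ξ)‖ₑ := by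
  have e : ∀ x, conj (ψ x) * ψ x = ∫ ξ, conj (ψ x) * oscJ c φ (x, ξ) := fun x => by
    rw [integral_const_mul]
    exact congrArg _ (h x)
  rw [lintegral_enorm_sq_eq]
  simp only [e]
  rw [integral_integral_swap (f := fun x ξ => conj (ψ x) * oscJ c φ (x, ξ))
    (hc.integrable_conj_mul_oscJ φ ψ)]
  exact enorm_integral_le_lintegral_enorm _

theorem Amp.integrable_conj_mul_oscJ_left (hc : Amp k c) (φ ψ : SchwartzMap (Fin d → ℝ) ℂ)
    (ξ : Fin d → ℝ) : Integrable fun x => conj (ψ x) * oscJ c φ (x, ξ) := by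
  obtain ⟨M, hM⟩ := Amp.exists_norm_oscJ_le (d := d) k
  obtain ⟨C, hC0, hC⟩ := hM c hc φ
  have hcont : Continuous fun x => conj (ψ x) * oscJ c φ (x, ξ) :=
    (continuous_conj.comp ψ.continuous).mul
      ((hc.oscJ_diff φ).1.continuous.comp (Continuous.prodMk_left ξ))
  refine ((ψ.integrable_one_add_norm_pow_mul M).const_mul
    (C * ((1 + ‖ξ‖) ^ (d + 1))⁻¹)).mono' hcont.aestronglyMeasurable (.of_forall fun x => ?_)
  rw [norm_mul, RCLike.norm_conj]
  refine (mul_le_mul_of_nonneg_left (hC (x, ξ)) (norm_nonneg _)).trans (le_of_eq ?_)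
  ring

end Form

theorem integrable_inv_sqW_pow {p : ℕ} (hp : d ≤ p) :
    Integrable fun r : Fin d → ℝ => (sqW r)⁻¹ ^ p := by
  have hc : Continuous fun r : Fin d → ℝ => (sqW r)⁻¹ ^ p :=
    (contDiff_sqW.continuous.inv₀ fun r => (sqW_pos r).ne').pow p
  refine (integrable_prodDecay 0).mono' hc.aestronglyMeasurable (.of_forall fun r => ?_)
  have h0 := (inv_pos.2 (sqW_pos r)).le
  rw [Real.norm_of_nonneg (pow_nonneg h0 p)]
  exact (pow_le_pow_of_le_one h0 (inv_le_one_of_one_le₀ (one_le_sqW r)) hp).trans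
    (inv_sqW_pow_le r)

/-- The total mass of a power of the inverse weight. -/
def weightMass (d p : ℕ) : ℂ := ∫ r : Fin d → ℝ, invW r ^ p

theorem weightMass_ne_zero {p : ℕ} (hp : d ≤ p) : weightMass d p ≠ 0 := by
  have e : weightMass d p = ((∫ r : Fin d → ℝ, (sqW r)⁻¹ ^ p : ℝ) : ℂ) := by
    rw [weightMass, ← integral_complex_ofReal]
    refine integral_congr_ae (.of_forall fun r => ?_)
    simp [invW]
  have hpos : ∀ r : Fin d → ℝ, 0 < (sqW r)⁻¹ ^ p := fun r => pow_pos (inv_pos.2 (sqW_pos r)) p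
  rw [e, Complex.ofReal_ne_zero]
  refine ne_of_gt ((integral_pos_iff_support_of_nonneg (fun r => (hpos r).le)
    (integrable_inv_sqW_pow hp)).2 ?_)
  rw [Function.support_eq_univ fun r => (hpos r).ne']
  exact Measure.measure_univ_pos.2 (NeZero.ne _)

/-- Averaging an integral over translates of the weight. -/
theorem weightMass_mul_enorm_integral_le {p : ℕ} (hp : d ≤ p) {G : (Fin d → ℝ) → ℂ}
    (hG : Integrable G) :
    ‖weightMass d p‖ₑ * ‖∫ x, G x‖ₑ ≤ ∫⁻ z, ‖∫ x, invW (x - z) ^ p * G x‖ₑ := by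
  have hW : Integrable fun r : Fin d → ℝ => invW r ^ p := by
    refine (integrable_inv_sqW_pow hp).mono
      (contDiff_invW.continuous.pow p).aestronglyMeasurable (.of_forall fun r => ?_)
    rw [norm_pow, norm_invW, Real.norm_of_nonneg (pow_nonneg (inv_pos.2 (sqW_pos r)).le p)]
  have hi : Integrable fun q : (Fin d → ℝ) × (Fin d → ℝ) => invW (q.2 - q.1) ^ p * G q.2 := by
    have h := hG.convolution_integrand (ContinuousLinearMap.mul ℝ ℂ) hW
    refine h.congr (.of_forall fun q => ?_)
    simp only [ContinuousLinearMap.mul_apply', invW]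
    rw [← neg_sub q.1 q.2, sqW_neg, mul_comm]
  have e : ∫ z, ∫ x, invW (x - z) ^ p * G x = weightMass d p * ∫ x, G x := by
    rw [integral_integral_swap (f := fun z x => invW (x - z) ^ p * G x) hi]
    have h : ∀ x : Fin d → ℝ, ∫ z, invW (x - z) ^ p * G x = weightMass d p * G x := fun x => by
      rw [integral_mul_const, integral_sub_left_eq_self (fun r => invW r ^ p) volume x, weightMass]
    simp only [h]
    exact integral_const_mul _ _
  rw [← enorm_mul, ← e]
  exact enorm_integral_le_lintegral_enorm _

theorem packet_mul_packet_mul_locKernel (k : ℕ)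
    (a : (Fin d → ℝ) × (Fin d → ℝ) × (Fin d → ℝ) → ℂ) (f g : (Fin d → ℝ) → ℂ)
    (z ξ x y : Fin d → ℝ) :
    packet A f (z, ξ) x * conj (packet A g (z, ξ) y) * locKernel A k a (z, ξ) (x, y) =
      invW (x - z) ^ (k + d + (d + d) + d) * conj (f x) *
        osc (magAmp A fun q => invW (q.2.1 - q.1) ^ (k + d + d) * a q) g ((x, ξ), y) := by
  have h1 := phase_mul_swap A x z
  have h2 := phase_mul_swap A y z
  have h3 : invW (y - z) ^ d * bigW (y - z) ^ d = 1 := by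
    rw [← mul_pow, invW_mul_bigW, one_pow]
  have h4 : conj (invW (y - z)) = invW (y - z) := Complex.conj_ofReal _
  have h5 : conj (cexp (I * (dotR ξ y : ℝ))) = cexp (I * ((-dotR ξ y : ℝ) : ℂ)) := by
    rw [← Complex.exp_conj, map_mul, Complex.conj_I, Complex.conj_ofReal]
    push_cast
    ring_nf
  have h7 : dotR ξ (x - y) = dotR ξ x + -dotR ξ y := by
    simp only [dotR, Pi.sub_apply, mul_sub, Finset.sum_sub_distrib]
    ring
  have h6 : wave ((x, ξ), y) = cexp (I * (dotR ξ x : ℝ)) * cexp (I * ((-dotR ξ y : ℝ) : ℂ)) := by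
    rw [wave, ← Complex.exp_add, ← mul_add, ← Complex.ofReal_add, h7]
  simp only [packet, localize, locKernel, triPhase, osc, magAmp, map_mul, map_pow, h4, h5, h6,
    ← phase_swap, Complex.conj_conj]
  rw [pow_add (invW (x - z)) (k + d + (d + d)) d]
  set R := conj (f x) * invW (x - z) ^ (k + d + (d + d)) * invW (x - z) ^ d * phase A (x, y) *
    cexp (I * (dotR ξ x : ℝ)) * g y * cexp (I * ((-dotR ξ y : ℝ) : ℂ)) *
    invW (y - x) ^ (k + d + d) * a (x, y, ξ) with hR
  calc _ = invW (y - z) ^ d * bigW (y - z) ^ d * (phase A (z, x) * phase A (x, z)) *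
        (phase A (z, y) * phase A (y, z)) * R := by rw [hR]; ring
    _ = R := by rw [h1, h2, h3]; ring
    _ = _ := by rw [hR]; ring

theorem integral_packet_mul_packet_mul_locKernel (k : ℕ)
    (a : (Fin d → ℝ) × (Fin d → ℝ) × (Fin d → ℝ) → ℂ) (f g : (Fin d → ℝ) → ℂ)
    (z ξ : Fin d → ℝ) :
    ∫ x, ∫ y, packet A f (z, ξ) x * conj (packet A g (z, ξ) y) * locKernel A k a (z, ξ) (x, y) =
      ∫ x, invW (x - z) ^ (k + d + (d + d) + d) * (conj (f x) *
        oscJ (magAmp A fun q => invW (q.2.1 - q.1) ^ (k + d + d) * a q) g (x, ξ)) := by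
  simp only [packet_mul_packet_mul_locKernel]
  simp only [integral_const_mul, mul_assoc, oscJ]

theorem enorm_upTail_conj (u : (Fin d → ℝ) → ℂ) (t : Fin d → ℝ) :
    ‖upTail (fun x => conj (u x)) t‖ₑ = ‖upTail u t‖ₑ := by
  rw [upTail, integral_conj, RCLike.enorm_conj, upTail]

/-- The localized form is controlled by the packet energies. -/
theorem exists_enorm_integral_le (hA : ContDiff ℝ ∞ A) (hB : BBounded (Bof A)) :
    ∃ k : ℕ, ∀ {a}, BddG a → ∃ D : ENNReal, D ≠ ⊤ ∧
      ∀ {f g : (Fin d → ℝ) → ℂ}, Continuous f → Continuous g → Integrable f → Integrable g →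
      ∀ {δ : ENNReal}, δ ≠ 0 → δ ≠ ⊤ → ∀ z ξ,
      ‖∫ x, invW (x - z) ^ (k + d + (d + d) + d) * (conj (f x) *
        oscJ (magAmp A fun q => invW (q.2.1 - q.1) ^ (k + d + d) * a q) g (x, ξ))‖ₑ ≤
      D * (δ * packetEnergy A f (z, ξ) + δ⁻¹ * packetEnergy A g (z, ξ)) := by
  obtain ⟨k, hk⟩ := locKernel_symB hA hB
  refine ⟨k, fun {a} ha => ?_⟩
  obtain ⟨hs, hS⟩ := hk ha
  obtain ⟨K, hK⟩ := hS.dList_bound (allDirX d ++ allDirY d) (by simp [allDirX, allDirY])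
  refine ⟨ENNReal.ofReal K * decayMass d, ENNReal.mul_ne_top ENNReal.ofReal_ne_top
    decayMass_ne_top, fun {f g} hf hg hfi hgi {δ} h0 h1 z ξ => ?_⟩
  rw [← integral_packet_mul_packet_mul_locKernel]
  have hv : Integrable fun y => conj (packet A g (z, ξ) y) := by
    have h := integrable_packet hA hg hgi (z, ξ)
    exact h.mono (continuous_conj.comp_aestronglyMeasurable h.1)
      (.of_forall fun x => (RCLike.norm_conj _).le)
  have h := enorm_integral_mul_mul_le (integrable_packet hA hf hfi (z, ξ)) hv (hs (z, ξ)) z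
    (fun L hL => (hS.dList_bound L hL).imp fun C hC p => hC (z, ξ) p) (hK (z, ξ)) h0 h1
  simpa only [enorm_upTail_conj, packetEnergy] using h

theorem ENNReal.le_mul_of_forall_le {κ D : ENNReal} (h0 : κ ≠ 0) (h1 : κ ≠ ⊤) (hD : D ≠ ⊤)
    {X Y : ENNReal} (hX : X ≠ ⊤)
    (h : ∀ δ : ENNReal, δ ≠ 0 → δ ≠ ⊤ → κ * X ≤ D * (δ * X + δ⁻¹ * Y)) :
    X ≤ 4 * (D + 1) ^ 2 * (κ ^ 2)⁻¹ * Y := by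
  by_cases hY : Y = ⊤
  · subst hY
    rw [ENNReal.mul_top]
    · exact le_top
    · simp [h1]
  lift κ to NNReal using h1
  lift D to NNReal using hD
  lift X to NNReal using hX
  lift Y to NNReal using hY
  have hκ : 0 < κ := pos_iff_ne_zero.2 (by exact_mod_cast h0)
  have hδ : 0 < κ / (2 * (D + 1)) := by positivity
  have h2 := h ((κ / (2 * (D + 1)) : NNReal) : ENNReal) (by exact_mod_cast hδ.ne') ENNReal.coe_ne_top
  rw [← ENNReal.coe_inv hδ.ne'] at h2
  have h3 : κ * X ≤ D * (κ / (2 * (D + 1)) * X + (κ / (2 * (D + 1)))⁻¹ * Y) := by exact_mod_cast h2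
  have h4 : κ ^ 2 ≠ 0 := by positivity
  suffices X ≤ 4 * (D + 1) ^ 2 * (κ ^ 2)⁻¹ * Y by
    have e : (((κ ^ 2)⁻¹ : NNReal) : ENNReal) = ((κ : ENNReal) ^ 2)⁻¹ := by
      rw [ENNReal.coe_inv h4, ENNReal.coe_pow]
    rw [← e]
    exact_mod_cast this
  have h5 : (κ : ℝ) * X ≤ D * (κ / (2 * (D + 1)) * X + ((κ : ℝ) / (2 * (D + 1)))⁻¹ * Y) := by
    exact_mod_cast h3
  suffices (X : ℝ) ≤ 4 * (D + 1) ^ 2 * ((κ : ℝ) ^ 2)⁻¹ * Y by exact_mod_cast this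
  have hκ' : (0 : ℝ) < κ := hκ
  have hD' : (0 : ℝ) ≤ D := D.2
  have hX' : (0 : ℝ) ≤ X := X.2
  have hY' : (0 : ℝ) ≤ Y := Y.2
  have h6 : (D : ℝ) * (κ / (2 * (D + 1)) * X) ≤ κ * X / 2 := by
    rw [div_mul_eq_mul_div, ← mul_div_assoc, div_le_div_iff₀ (by positivity) (by positivity)]
    nlinarith [mul_nonneg hκ'.le hX']
  have h7 : (D : ℝ) * (((κ : ℝ) / (2 * (D + 1)))⁻¹ * Y) ≤ 2 * (D + 1) ^ 2 / κ * Y := by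
    rw [inv_div, ← mul_assoc, ← mul_div_assoc]
    refine mul_le_mul_of_nonneg_right (div_le_div_of_nonneg_right ?_ hκ'.le) hY'
    nlinarith
  have h8 : (κ : ℝ) * X ≤ 4 * (D + 1) ^ 2 / κ * Y := by
    have e : (4 : ℝ) * (D + 1) ^ 2 / κ * Y = 2 * (2 * (D + 1) ^ 2 / κ * Y) := by ring
    rw [mul_add] at h5
    rw [e]
    linarith
  calc (X : ℝ) = κ * X / κ := by field_simp
    _ ≤ 4 * (D + 1) ^ 2 / κ * Y / κ := by gcongr
    _ = _ := by field_simp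

theorem exists_lintegral_opT_le (hA : Function.HasTemperateGrowth A) (hB : BBounded (Bof A))
    {a : (Fin d → ℝ) × (Fin d → ℝ) × (Fin d → ℝ) → ℂ} (ha : BddG a) :
    ∃ C : ENNReal, C ≠ ⊤ ∧ ∀ φ : SchwartzMap (Fin d → ℝ) ℂ,
      ∫⁻ x, ‖opT (magAmp A a) φ x‖ₑ ^ 2 ≤ C * ∫⁻ x, ‖φ x‖ₑ ^ 2 := by
  obtain ⟨k, hk⟩ := exists_enorm_integral_le hA.1 hB
  obtain ⟨a', ha', hop⟩ := exists_opT_eq_decay hA ha (k + d + d)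
  obtain ⟨D, hD, hDle⟩ := hk ha'
  obtain ⟨m, hm⟩ := exists_amp_magAmp hA
  have hc := hm ((bddG_invW_pow (k + d + d)).diff_mul ha')
  set p := k + d + (d + d) + d with hp
  have hdp : d ≤ p := by omega
  have hE : D * (besselConst d * decayMass d ^ 2) ≠ ⊤ :=
    ENNReal.mul_ne_top hD (ENNReal.mul_ne_top besselConst_ne_top (ENNReal.pow_ne_top decayMass_ne_top))
  refine ⟨4 * (D * (besselConst d * decayMass d ^ 2) + 1) ^ 2 * (‖weightMass d p‖ₑ ^ 2)⁻¹, ?_,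
    fun φ => ?_⟩
  · refine ENNReal.mul_ne_top (ENNReal.mul_ne_top (by simp) (ENNReal.pow_ne_top ?_))
      (ENNReal.inv_ne_top.2 (pow_ne_zero _ (enorm_ne_zero.2 (weightMass_ne_zero hdp))))
    exact ENNReal.add_ne_top.2 ⟨hE, by simp⟩
  simp only [hop φ]
  set c := magAmp A fun q => invW (q.2.1 - q.1) ^ (k + d + d) * a' q with hcdef
  set ψ := hc.opS φ with hψ
  have hψx : ∀ x, ψ x = opT c φ x := fun x => rfl
  simp only [← hψx]
  refine ENNReal.le_mul_of_forall_le (enorm_ne_zero.2 (weightMass_ne_zero hdp)) enorm_ne_top hE ?_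
    fun δ h0 h1 => ?_
  · rw [lintegral_enorm_sq_eq]
    exact enorm_ne_top
  have hmE : ∀ (f : SchwartzMap (Fin d → ℝ) ℂ),
      Measurable fun q : (Fin d → ℝ) × (Fin d → ℝ) => packetEnergy A f (q.2, q.1) := fun f =>
    (measurable_packetEnergy hA.1 f.continuous).comp measurable_swap
  calc ‖weightMass d p‖ₑ * ∫⁻ x, ‖ψ x‖ₑ ^ 2
      ≤ ‖weightMass d p‖ₑ * ∫⁻ ξ, ‖∫ x, conj (ψ x) * oscJ c φ (x, ξ)‖ₑ :=
        mul_le_mul_right (hc.lintegral_enorm_sq_le hψx) _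
    _ = ∫⁻ ξ, ‖weightMass d p‖ₑ * ‖∫ x, conj (ψ x) * oscJ c φ (x, ξ)‖ₑ :=
        (lintegral_const_mul' _ _ enorm_ne_top).symm
    _ ≤ ∫⁻ ξ, ∫⁻ z, D * (δ * packetEnergy A ψ (z, ξ) + δ⁻¹ * packetEnergy A φ (z, ξ)) :=
        lintegral_mono fun ξ => (weightMass_mul_enorm_integral_le hdp
          (hc.integrable_conj_mul_oscJ_left φ ψ ξ)).trans (lintegral_mono fun z =>
            hDle ψ.continuous φ.continuous ψ.integrable φ.integrable h0 h1 z ξ)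
    _ = D * (δ * (∫⁻ ξ, ∫⁻ z, packetEnergy A ψ (z, ξ)) +
          δ⁻¹ * (∫⁻ ξ, ∫⁻ z, packetEnergy A φ (z, ξ))) := by
        have hδ := ENNReal.inv_ne_top.2 h0
        have hz : ∀ ξ, ∫⁻ z, D * (δ * packetEnergy A ψ (z, ξ) + δ⁻¹ * packetEnergy A φ (z, ξ)) =
            D * (δ * (∫⁻ z, packetEnergy A ψ (z, ξ)) + δ⁻¹ * (∫⁻ z, packetEnergy A φ (z, ξ))) := by
          intro ξ
          rw [lintegral_const_mul' _ _ hD, lintegral_add_left, lintegral_const_mul' _ _ h1,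
            lintegral_const_mul' _ _ hδ]
          exact ((hmE ψ).comp (f := fun z => (ξ, z)) (by fun_prop)).const_mul δ
        simp only [hz]
        rw [lintegral_const_mul' _ _ hD, lintegral_add_left, lintegral_const_mul' _ _ h1,
            lintegral_const_mul' _ _ hδ]
        exact (hmE ψ).lintegral_prod_right'.const_mul δ
    _ ≤ D * (δ * (besselConst d * decayMass d ^ 2 * ∫⁻ x, ‖ψ x‖ₑ ^ 2) +
          δ⁻¹ * (besselConst d * decayMass d ^ 2 * ∫⁻ x, ‖φ x‖ₑ ^ 2)) := by
        gcongr
        · exact lintegral_packetEnergy_le hA.1 ψ.continuous ψ.integrable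
        · exact lintegral_packetEnergy_le hA.1 φ.continuous φ.integrable
    _ = _ := by ring

theorem exists_eLpNorm_opT_le (hA : Function.HasTemperateGrowth A) (hB : BBounded (Bof A))
    {a : (Fin d → ℝ) × (Fin d → ℝ) × (Fin d → ℝ) → ℂ} (ha : BddG a) :
    ∃ C : ℝ, 0 < C ∧ ∀ φ : SchwartzMap (Fin d → ℝ) ℂ,
      eLpNorm (opT (magAmp A a) φ) 2 volume ≤ ENNReal.ofReal C * eLpNorm φ 2 volume := by
  obtain ⟨C, hC, h⟩ := exists_lintegral_opT_le hA hB ha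
  lift C to NNReal using hC
  refine ⟨(C : ℝ) ^ (1 / 2 : ℝ) + 1, by positivity, fun φ => ?_⟩
  have e : ∀ f : (Fin d → ℝ) → ℂ, eLpNorm f 2 volume = (∫⁻ x, ‖f x‖ₑ ^ 2) ^ (1 / 2 : ℝ) := fun f => by
    rw [eLpNorm_eq_lintegral_rpow_enorm_toReal (by norm_num) (by norm_num)]
    simp
  rw [e, e]
  refine (ENNReal.rpow_le_rpow (h φ) (by norm_num)).trans ?_
  rw [ENNReal.mul_rpow_of_nonneg _ _ (by norm_num)]
  gcongr
  rw [← ENNReal.ofReal_coe_nnreal, ENNReal.ofReal_rpow_of_nonneg C.coe_nonneg (by norm_num)]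
  exact ENNReal.ofReal_le_ofReal (le_add_of_nonneg_right zero_le_one)

end SquareIntegrable

/-- **Forward direction of Beals' criterion** (Theorem 3.7): for `Φ ∈ S^0_0(ℝ^{2d})`, the
magnetic Weyl operator `Op^A(Φ)` maps `𝓢(ℝ^d)` into `𝓢(ℝ^d)` (realized by a linear map
`OpT` on Schwartz space given pointwise by the convergent defining integrals), and every
iterated commutator of `Op^A(Φ)` with the position operators `Q j` and the magnetic
momenta `P^A j` (given as linear maps on Schwartz space with the indicated action) is
`L²`-bounded; the case of the empty list is the `L²`-boundedness of `Op^A(Φ)` itself. -/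
theorem beals_forward (d : ℕ) (hd : 1 ≤ d)
    (A : (Fin d → ℝ) → (Fin d → ℝ)) (hA : Function.HasTemperateGrowth A)
    (hB : BBounded (Bof A))
    (Φ : ((Fin d → ℝ) × (Fin d → ℝ)) → ℂ) (hΦ : HormClass d 0 Φ)
    (Q P : Fin d → (SchwartzMap (Fin d → ℝ) ℂ →ₗ[ℂ] SchwartzMap (Fin d → ℝ) ℂ))
    (hQ : ∀ j : Fin d, ∀ φ : SchwartzMap (Fin d → ℝ) ℂ, ∀ x : Fin d → ℝ,
      Q j φ x = (x j : ℂ) * φ x)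
    (hP : ∀ j : Fin d, ∀ φ : SchwartzMap (Fin d → ℝ) ℂ, ∀ x : Fin d → ℝ,
      P j φ x = -Complex.I * fderiv ℝ (fun y => φ y) x (Pi.single j 1) -
        (A x j : ℝ) * φ x) :
    ∃ OpT : SchwartzMap (Fin d → ℝ) ℂ →ₗ[ℂ] SchwartzMap (Fin d → ℝ) ℂ,
      (∀ φ : SchwartzMap (Fin d → ℝ) ℂ, ∀ x : Fin d → ℝ,
        Integrable (fun ξ : Fin d → ℝ => opInt A Φ (fun y => φ y) x ξ) ∧
        OpT φ x = ∫ ξ : Fin d → ℝ, opInt A Φ (fun y => φ y) x ξ) ∧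
      ∀ Ls : List (SchwartzMap (Fin d → ℝ) ℂ →ₗ[ℂ] SchwartzMap (Fin d → ℝ) ℂ),
        (∀ L ∈ Ls, (∃ j, L = Q j) ∨ (∃ j, L = P j)) →
        ∃ C : ℝ, 0 < C ∧ ∀ φ : SchwartzMap (Fin d → ℝ) ℂ,
          eLpNorm (fun x : Fin d → ℝ => iterComm Ls OpT φ x) 2 volume ≤
            ENNReal.ofReal C * eLpNorm (fun x : Fin d → ℝ => φ x) 2 volume := by

  obtain ⟨k, hk⟩ := exists_amp_magAmp hA
  have ha := weylAmp_bddG hΦ.bddG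
  have hc := hk ha
  have hop : ∀ (φ : SchwartzMap (Fin d → ℝ) ℂ) (x : Fin d → ℝ),
      (fun ξ => opInt A Φ (fun y => φ y) x ξ) = fun ξ => oscJ (magAmp A (weylAmp Φ)) φ (x, ξ) :=
    fun φ x => funext fun ξ => opInt_eq hA.1.continuous Φ φ x ξ
  refine ⟨hc.opL, fun φ x => ⟨?_, ?_⟩, fun Ls hLs => ?_⟩
  · rw [hop]
    exact hc.integrable_oscJ φ x
  · rw [hop]
    rfl
  · obtain ⟨a, ha', h⟩ := IsMagOp.iterComm hA hB (T := hc.opL) ⟨_, ha, fun φ x => rfl⟩ hQ hP Ls hLs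
    obtain ⟨C, hC, hle⟩ := exists_eLpNorm_opT_le hA hB ha'
    refine ⟨C, hC, fun φ => ?_⟩
    rw [funext (h φ)]
    exact hle φ
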